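/- arXiv:math/9711208 — 3 statements merged into one kernel-verified Lean document; each statement's English description precedes it below -/
import Mathlib

section
/- The group of surjective linear isometries of C₀(ℝ, B(H)) (the suspension of B(H)) is algebraically reflexive: every bounded linear map Φ on C₀(ℝ, B(H)) such that for each f ∈ C₀(ℝ, B(H)) there exists a surjective linear isometry Φ_f of C₀(ℝ, B(H)) with Φ(f) = Φ_f(f), is itself a surjective linear isometry of C₀(ℝ, B(H)). -/
open scoped ZeroAtInfty

/-- A surjective linear isometry of a normed space onto itself. -/
def IsSurjectiveLinearIsometry {A : Type*} [SeminormedAddCommGroup A] [Module ℂ A]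
    (Φ : A → A) : Prop :=
  IsLinearMap ℂ Φ ∧ Function.Surjective Φ ∧ ∀ a : A, ‖Φ a‖ = ‖a‖

section helpers
open InnerProductSpace

section basics
variable {H : Type*} [NormedAddCommGroup H] [InnerProductSpace ℂ H]

lemma norm_sq_sub_re (u v : H) : ‖u - v‖ ^ 2 = ‖u‖ ^ 2 - 2 * (inner ℂ u v).re + ‖v‖ ^ 2 := by
  simpa using norm_sub_sq (𝕜 := ℂ) u v

lemma norm_sq_add_re (u v : H) : ‖u + v‖ ^ 2 = ‖u‖ ^ 2 + 2 * (inner ℂ u v).re + ‖v‖ ^ 2 := by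
  simpa using norm_add_sq (𝕜 := ℂ) u v

lemma eq_of_inner_one {u v : H} (hu : ‖u‖ ≤ 1) (hv : ‖v‖ ≤ 1) (h : 1 ≤ (inner ℂ u v).re) :
    u = v := by
  have h1 := norm_sq_sub_re u v
  have h2 : ‖u - v‖ ^ 2 ≤ 0 := by nlinarith [norm_nonneg u, norm_nonneg v]
  have h3 : ‖u - v‖ = 0 := by nlinarith [norm_nonneg (u - v)]
  exact sub_eq_zero.mp (norm_eq_zero.mp h3)

/-- parallelogram: if both `u + b`, `u - b` have norm at most one and `‖u‖ = 1` then `b = 0` -/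
lemma zero_of_par {u b : H} {r : ℝ} (hr : ‖u‖ = r) (h1 : ‖u + b‖ ≤ r) (h2 : ‖u - b‖ ≤ r) :
    b = 0 := by
  have e1 := norm_sq_sub_re u b
  have e2 := norm_sq_add_re u b
  have : ‖b‖ ^ 2 ≤ 0 := by
    nlinarith [norm_nonneg (u + b), norm_nonneg (u - b), norm_nonneg u]
  have h3 : ‖b‖ = 0 := by nlinarith [norm_nonneg b]
  exact norm_eq_zero.mp h3

/-- decomposition along a unit vector -/
lemma unit_decomp {η : H} (hη : ‖η‖ = 1) (v : H) :
    inner ℂ η (v - inner ℂ η v • η) = 0 ∧ ‖v‖ ^ 2 = ‖inner ℂ η v‖ ^ 2 + ‖v - inner ℂ η v • η‖ ^ 2 := by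
  have h0 : inner ℂ η (v - inner ℂ η v • η) = 0 := by
    rw [inner_sub_right, inner_smul_right, inner_self_eq_norm_sq_to_K, hη]; simp
  refine ⟨h0, ?_⟩
  have := norm_sq_add_re (inner ℂ η v • η) (v - inner ℂ η v • η)
  rw [inner_smul_left, h0] at this
  simp [norm_smul, hη] at this
  exact this

lemma le_of_sq_bound (a : H →L[ℂ] H) {M : ℝ} (hM : 0 ≤ M) (h : ∀ v, ‖a v‖ ^ 2 ≤ M ^ 2 * ‖v‖ ^ 2) :
    ‖a‖ ≤ M := by
  refine a.opNorm_le_bound hM fun v => ?_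
  have := h v
  rw [← mul_pow] at this
  exact (sq_le_sq₀ (norm_nonneg _) (by positivity)).mp this

lemma inner_apply_norm_le (a : H →L[ℂ] H) {ξ η : H} (hξ : ‖ξ‖ = 1) (hη : ‖η‖ = 1) :
    ‖inner ℂ ξ (a η)‖ ≤ ‖a‖ := by
  calc ‖inner ℂ ξ (a η)‖ ≤ ‖ξ‖ * ‖a η‖ := norm_inner_le_norm _ _
    _ ≤ 1 * (‖a‖ * ‖η‖) := by rw [hξ]; gcongr; exact a.le_opNorm _
    _ = ‖a‖ := by rw [hη]; ring

lemma rankone_est {ξ η : H} (hξ : ‖ξ‖ = 1) (hη : ‖η‖ = 1) (a : H →L[ℂ] H) (ha : ‖a‖ ≤ 1 / 4) :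
    ‖rankOne ℂ ξ η + a‖ ≤ 1 + (inner ℂ ξ (a η)).re + 3 * ‖a‖ ^ 2 := by
  set A := ‖a‖ with hA
  have hA0 : 0 ≤ A := norm_nonneg _
  set β := (inner ℂ ξ (a η)).re with hβ
  have hβA : |β| ≤ A := (Complex.abs_re_le_norm _).trans (inner_apply_norm_le a hξ hη)
  have hb := abs_le.mp hβA
  refine le_of_sq_bound _ (by nlinarith) fun v => ?_
  obtain ⟨h0, hv⟩ := unit_decomp hη v
  set α := inner ℂ η v with hα
  set w := v - α • η with hw
  have hv' : v = α • η + w := by rw [hw]; abel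
  have e : (rankOne ℂ ξ η + a) v = α • (ξ + a η) + a w := by
    have : a v = α • a η + a w := by conv_lhs => rw [hv']
                                     simp
    simp only [add_apply, rankOne_apply, this, ← hα, smul_add]; abel
  have haw : ‖a w‖ ≤ A * ‖w‖ := a.le_opNorm w
  have haη : ‖a η‖ ≤ A := by simpa [hη] using a.le_opNorm η
  have h1 : ‖ξ + a η‖ ^ 2 ≤ 1 + 2 * β + A ^ 2 := by
    rw [norm_sq_add_re, hξ]; nlinarith [norm_nonneg (a η)]
  have h2 : ‖ξ + a η‖ ≤ 5 / 4 := by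
    calc _ ≤ ‖ξ‖ + ‖a η‖ := norm_add_le _ _
      _ ≤ 5 / 4 := by rw [hξ]; linarith
  have h3 : (inner ℂ (α • (ξ + a η)) (a w)).re ≤ ‖α‖ * (5 / 4) * (A * ‖w‖) := by
    calc _ ≤ ‖inner ℂ (α • (ξ + a η)) (a w)‖ := Complex.re_le_norm _
      _ ≤ ‖α • (ξ + a η)‖ * ‖a w‖ := norm_inner_le_norm _ _
      _ ≤ _ := by rw [norm_smul]; gcongr
  rw [e, norm_sq_add_re, hv, norm_smul, mul_pow]
  have h4 : ‖a w‖ ^ 2 ≤ A ^ 2 * ‖w‖ ^ 2 := by rw [← mul_pow]; gcongr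
  have h5 : ‖α‖ ^ 2 * ‖ξ + a η‖ ^ 2 ≤ ‖α‖ ^ 2 * (1 + 2 * β + A ^ 2) := by gcongr
  have h6 : 2 * (‖α‖ * (5 / 4) * (A * ‖w‖)) ≤ ‖w‖ ^ 2 / 2 + 4 * A ^ 2 * ‖α‖ ^ 2 := by
    nlinarith [sq_nonneg (‖w‖ - (5/2) * (A * ‖α‖)), sq_nonneg (A * ‖α‖)]
  have h7 : (1 + 2 * β + 6 * A ^ 2) ≤ (1 + β + 3 * A ^ 2) ^ 2 := by nlinarith [sq_nonneg (β + 3 * A ^ 2)]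
  have h8 : 1 / 2 * ‖w‖ ^ 2 ≤ (1 + 2 * β) * ‖w‖ ^ 2 := by gcongr; linarith
  have h9 : (1 + 2 * β + 6 * A ^ 2) * (‖α‖ ^ 2 + ‖w‖ ^ 2) ≤
    (1 + β + 3 * A ^ 2) ^ 2 * (‖α‖ ^ 2 + ‖w‖ ^ 2) := by gcongr
  have h10 : 0 ≤ A ^ 2 * ‖α‖ ^ 2 := by positivity
  have h11 : 0 ≤ A ^ 2 * ‖w‖ ^ 2 := by positivity
  nlinarith

lemma contr_right {W : H →L[ℂ] H} (hW : ‖W‖ ≤ 1) {ξ η : H} (hξ : ‖ξ‖ = 1) (hη : ‖η‖ = 1)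
    (h : inner ℂ ξ (W η) = 1) : W η = ξ := by
  refine (eq_of_inner_one hξ.le ?_ (by rw [h]; simp)).symm
  calc ‖W η‖ ≤ ‖W‖ * ‖η‖ := W.le_opNorm _
    _ ≤ 1 := by rw [hη]; linarith

variable [CompleteSpace H]

lemma contr_left {W : H →L[ℂ] H} (hW : ‖W‖ ≤ 1) {ξ η : H} (hξ : ‖ξ‖ = 1) (hη : ‖η‖ = 1)
    (h : inner ℂ ξ (W η) = 1) : W.adjoint ξ = η := by
  refine contr_right (W := W.adjoint) (by simpa using hW) hη hξ ?_
  rw [ContinuousLinearMap.adjoint_inner_right, ← inner_conj_symm, h]; simp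

end basics

section C0
variable {H : Type*} [NormedAddCommGroup H] [InnerProductSpace ℂ H]

lemma C0_apply_le {B : Type*} [NormedAddCommGroup B] (f : C₀(ℝ, B)) (x : ℝ) : ‖f x‖ ≤ ‖f‖ := by
  rw [← ZeroAtInftyContinuousMap.norm_toBCF_eq_norm]
  exact f.toBCF.norm_coe_le_norm x

lemma C0_norm_le {B : Type*} [NormedAddCommGroup B] (f : C₀(ℝ, B)) {M : ℝ} (hM : 0 ≤ M)
    (h : ∀ x, ‖f x‖ ≤ M) : ‖f‖ ≤ M := by
  rw [← ZeroAtInftyContinuousMap.norm_toBCF_eq_norm]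
  exact (BoundedContinuousFunction.norm_le hM).mpr h

lemma C0_attain {B : Type*} [NormedAddCommGroup B] (f : C₀(ℝ, B)) (hf : ‖f‖ = 1) :
    ∃ x, ‖f x‖ = 1 := by
  have h1 : Filter.Tendsto (fun x => ‖f x‖) (Filter.cocompact ℝ) (nhds 0) := by
    simpa using (zero_at_infty f).norm
  obtain ⟨x0, hx0⟩ : ∃ x0, f x0 ≠ 0 := by
    by_contra h
    push Not at h
    have : ‖f‖ ≤ 0 := C0_norm_le f le_rfl (fun x => by rw [h x]; simp)
    linarith
  have hc : Continuous (fun x => ‖f x‖) := (map_continuous f).norm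
  obtain ⟨x, hx⟩ := hc.exists_forall_ge' x0
    ((h1.eventually (gt_mem_nhds (norm_pos_iff.mpr hx0))).mono fun y hy => le_of_lt hy)
  refine ⟨x, le_antisymm (hf ▸ C0_apply_le f x) ?_⟩
  rw [← hf]
  exact C0_norm_le f (norm_nonneg _) hx

/-- `g ⊗ T` -/
noncomputable def tens (g : C₀(ℝ, ℂ)) (T : H →L[ℂ] H) : C₀(ℝ, H →L[ℂ] H) where
  toFun t := g t • T
  continuous_toFun := (map_continuous g).smul continuous_const
  zero_at_infty' := by
    simpa using (zero_at_infty g).smul_const T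

@[simp] lemma tens_apply (g : C₀(ℝ, ℂ)) (T : H →L[ℂ] H) (t : ℝ) : tens g T t = g t • T := rfl

/-- peak function -/
noncomputable def pk (y : ℝ) : C₀(ℝ, ℂ) where
  toFun t := (((1 + |t - y|)⁻¹ : ℝ) : ℂ)
  continuous_toFun := by
    refine Complex.continuous_ofReal.comp (Continuous.inv₀ (by fun_prop) fun t => by positivity)
  zero_at_infty' := by
    have : Filter.Tendsto (fun t : ℝ => (1 + |t - y|)⁻¹) (Filter.cocompact ℝ) (nhds 0) := by
      refine Filter.Tendsto.comp tendsto_inv_atTop_zero ?_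
      refine Filter.tendsto_atTop_add_const_left _ _ ?_
      have h := tendsto_norm_cocompact_atTop (E := ℝ)
      refine Filter.tendsto_atTop_mono (f := fun t : ℝ => ‖t‖ - |y|) (fun t => ?_) ?_
      · exact norm_sub_norm_le t y
      · exact Filter.tendsto_atTop_add_const_right _ _ h
    have h2 := (Complex.continuous_ofReal.tendsto 0).comp this
    rw [Complex.ofReal_zero] at h2
    exact h2

lemma pk_apply (y t : ℝ) : pk y t = (((1 + |t - y|)⁻¹ : ℝ) : ℂ) := rfl
@[simp] lemma pk_self (y : ℝ) : pk y y = 1 := by simp [pk_apply]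
lemma pk_pos (y t : ℝ) : 0 < (1 + |t - y|)⁻¹ := by positivity
lemma pk_ne (y t : ℝ) : pk y t ≠ 0 := by
  rw [pk_apply]; exact_mod_cast (pk_pos y t).ne'
lemma pk_norm (y t : ℝ) : ‖pk y t‖ = (1 + |t - y|)⁻¹ := by
  rw [pk_apply, Complex.norm_real, Real.norm_of_nonneg (pk_pos y t).le]
lemma pk_norm_le (y t : ℝ) : ‖pk y t‖ ≤ 1 := by
  rw [pk_norm]; exact inv_le_one_of_one_le₀ (by linarith [abs_nonneg (t - y)])
lemma pk_norm_eq_one {y t : ℝ} (h : 1 ≤ ‖pk y t‖) : t = y := by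
  rw [pk_norm, one_le_inv₀ (by positivity)] at h
  have : |t - y| = 0 := le_antisymm (by linarith) (abs_nonneg _)
  linarith [abs_eq_zero.mp this]

lemma tens_pk_norm (y : ℝ) (T : H →L[ℂ] H) : ‖tens (pk y) T‖ = ‖T‖ := by
  apply le_antisymm
  · refine C0_norm_le _ (norm_nonneg _) fun x => ?_
    rw [tens_apply, norm_smul]
    exact mul_le_of_le_one_left (norm_nonneg _) (pk_norm_le _ _)
  · simpa using C0_apply_le (tens (pk y) T) y

end C0

section sm
variable {H : Type*} [NormedAddCommGroup H] [InnerProductSpace ℂ H]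

def IsSm (f : C₀(ℝ, H →L[ℂ] H)) (ψ : C₀(ℝ, H →L[ℂ] H) → ℂ) : Prop :=
  ∀ a, ∀ ε : ℝ, 0 < ε → ∃ δ : ℝ, 0 < δ ∧ ∀ t : ℝ, 0 < t → t < δ →
    ‖f + (t : ℂ) • a‖ ≤ 1 + t * (ψ a).re + t * ε

lemma isSm_pk (x : ℝ) {ξ η : H} (hξ : ‖ξ‖ = 1) (hη : ‖η‖ = 1) :
    IsSm (tens (pk x) (rankOne ℂ ξ η)) (fun a => inner ℂ ξ (a x η)) := by
  intro a ε hε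
  set A := ‖a‖ + 1 with hAdef
  have hA1 : 1 ≤ A := by rw [hAdef]; linarith [norm_nonneg a]
  have haA : ∀ y, ‖a y‖ ≤ A := fun y => (C0_apply_le a y).trans (by rw [hAdef]; linarith)
  obtain ⟨r, hr, hr'⟩ := Metric.continuousAt_iff.mp
    ((map_continuous a).continuousAt (x := x)) (ε / 2) (by positivity)
  set r' := min r 1 with hr'def
  have hr'0 : 0 < r' := lt_min hr one_pos
  set κ := 1 - (1 + r')⁻¹ with hκ
  have hκ0 : 0 < κ := by
    have : (1 + r')⁻¹ < 1 := inv_lt_one_of_one_lt₀ (by linarith)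
    linarith
  refine ⟨min (min (κ / (2 * A)) (1 / (8 * A))) (ε / (12 * A ^ 2)), by positivity, fun t ht htδ => ?_⟩
  simp only [lt_min_iff, lt_div_iff₀ (show 0 < 2 * A by positivity),
    lt_div_iff₀ (show 0 < 8 * A by positivity), lt_div_iff₀ (show 0 < 12 * A ^ 2 by positivity)] at htδ
  obtain ⟨⟨ht1, ht2⟩, ht3⟩ := htδ
  set β := (inner ℂ ξ (a x η)).re with hβ
  have hβA : |β| ≤ A := (Complex.abs_re_le_norm _).trans ((inner_apply_norm_le (a x) hξ hη).trans (haA x))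
  have hb := abs_le.mp hβA
  have hβt : -(t * A) ≤ t * β := by nlinarith
  refine C0_norm_le _ ?_ fun y => ?_
  · nlinarith [mul_pos ht hε]
  set s := (1 + |y - x|)⁻¹ with hs
  have hs0 : 0 < s := pk_pos x y
  have hs1 : s ≤ 1 := inv_le_one_of_one_le₀ (by linarith [abs_nonneg (y - x)])
  have hval : (tens (pk x) (rankOne ℂ ξ η) + (t : ℂ) • a) y = (s : ℂ) • rankOne ℂ ξ η + (t : ℂ) • a y := rfl
  rw [hval]
  have hc1 : ‖rankOne ℂ ξ η‖ = 1 := by rw [norm_rankOne, hξ, hη]; ring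
  by_cases hy : |y - x| < r'
  · have hd : ‖a y - a x‖ < ε / 2 := by
      have := hr' (show dist y x < r from by rw [Real.dist_eq]; exact hy.trans_le (min_le_left _ _))
      rwa [dist_eq_norm] at this
    have hs2 : 1 / 2 ≤ s := by
      have hy1 : |y - x| ≤ 1 := hy.le.trans (min_le_right _ _)
      rw [hs, one_div]
      exact inv_anti₀ (by positivity) (by linarith)
    have hsC : (s : ℂ) ≠ 0 := by exact_mod_cast hs0.ne'
    have e1 : (s : ℂ) • rankOne ℂ ξ η + (t : ℂ) • a y =
        (s : ℂ) • (rankOne ℂ ξ η + ((t / s : ℝ) : ℂ) • a x) + (t : ℂ) • (a y - a x) := by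
      rw [smul_add, smul_smul, smul_sub]
      have : (s : ℂ) * ((t / s : ℝ) : ℂ) = t := by push_cast; field_simp
      rw [this]; abel
    have hts : t / s ≤ 2 * t := by
      rw [div_le_iff₀ hs0]; nlinarith
    have hts0 : 0 < t / s := by positivity
    have hn : ‖((t / s : ℝ) : ℂ) • a x‖ ≤ t / s * A := by
      rw [norm_smul, Complex.norm_real, Real.norm_of_nonneg hts0.le]
      exact mul_le_mul_of_nonneg_left (haA x) hts0.le
    have hest := rankone_est hξ hη (((t / s : ℝ) : ℂ) • a x) (hn.trans (by nlinarith))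
    have e2 : (inner ℂ ξ ((((t / s : ℝ) : ℂ) • a x) η)).re = t / s * β := by
      rw [ContinuousLinearMap.smul_apply, inner_smul_right, Complex.re_ofReal_mul]
    rw [e2] at hest
    have hsq : ‖((t / s : ℝ) : ℂ) • a x‖ ^ 2 ≤ (t / s * A) ^ 2 := by gcongr
    calc ‖_‖ ≤ ‖(s : ℂ) • (rankOne ℂ ξ η + ((t / s : ℝ) : ℂ) • a x)‖ + ‖(t : ℂ) • (a y - a x)‖ := by
          rw [e1]; exact norm_add_le _ _
      _ ≤ s * (1 + t / s * β + 3 * (t / s * A) ^ 2) + t * (ε / 2) := by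
          rw [norm_smul, norm_smul, Complex.norm_real, Complex.norm_real,
            Real.norm_of_nonneg hs0.le, Real.norm_of_nonneg ht.le]
          gcongr
          linarith
      _ = s + t * β + 3 * (t / s) * t * A ^ 2 + t * (ε / 2) := by field_simp
      _ ≤ 1 + t * β + 3 * (2 * t) * t * A ^ 2 + t * (ε / 2) := by gcongr
      _ ≤ _ := by nlinarith
  · push Not at hy
    have hsκ : s ≤ 1 - κ := by
      rw [hκ, hs]; simp only [sub_sub_cancel]
      exact inv_anti₀ (by positivity) (by linarith)
    calc ‖_‖ ≤ ‖(s : ℂ) • rankOne ℂ ξ η‖ + ‖(t : ℂ) • a y‖ := norm_add_le _ _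
      _ ≤ s + t * A := by
          rw [norm_smul, norm_smul, Complex.norm_real, Complex.norm_real,
            Real.norm_of_nonneg hs0.le, Real.norm_of_nonneg ht.le, hc1, mul_one]
          gcongr; exact haA y
      _ ≤ _ := by nlinarith [mul_pos ht hε]

/-- right multiplication -/
noncomputable def rmul (f : C₀(ℝ, H →L[ℂ] H)) (q : H →L[ℂ] H) : C₀(ℝ, H →L[ℂ] H) where
  toFun t := f t * q
  continuous_toFun := (map_continuous f).mul continuous_const
  zero_at_infty' := by simpa using (zero_at_infty f).mul_const q

lemma rmul_apply (f : C₀(ℝ, H →L[ℂ] H)) (q : H →L[ℂ] H) (t : ℝ) : rmul f q t = f t * q := rfl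

/-- one half of the contradiction -/
lemma isSm_rmul_ge {f : C₀(ℝ, H →L[ℂ] H)} {ψ : C₀(ℝ, H →L[ℂ] H) → ℂ} (hs : IsSm f ψ)
    (x : ℝ) (q : H →L[ℂ] H) (ζ : ℕ → H) (hζ : ∀ n, ‖ζ n‖ = 1) (hq : ∀ n, q (ζ n) = ζ n)
    (hlim : Filter.Tendsto (fun n => ‖f x (ζ n)‖) Filter.atTop (nhds 1)) :
    1 ≤ (ψ (rmul f q)).re := by
  refine le_of_forall_pos_le_add fun ε hε => ?_
  obtain ⟨δ, hδ, h⟩ := hs (rmul f q) ε hε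
  have ht := h (δ / 2) (by positivity) (by linarith)
  set t := δ / 2 with htdef
  have ht0 : 0 < t := by positivity
  have key : 1 + t ≤ ‖f + (t : ℂ) • rmul f q‖ := by
    have h1 : ∀ n, (1 + t) * ‖f x (ζ n)‖ ≤ ‖f + (t : ℂ) • rmul f q‖ := fun n => by
      have e : (f + (t : ℂ) • rmul f q) x (ζ n) = ((1 + t : ℝ) : ℂ) • f x (ζ n) := by
        have : (f + (t : ℂ) • rmul f q) x (ζ n) = f x (ζ n) + (t : ℂ) • f x (q (ζ n)) := rfl
        rw [this, hq]; push_cast; rw [add_smul, one_smul]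
      calc (1 + t) * ‖f x (ζ n)‖ = ‖(f + (t : ℂ) • rmul f q) x (ζ n)‖ := by
            rw [e, norm_smul, Complex.norm_real, Real.norm_of_nonneg (by positivity)]
        _ ≤ ‖(f + (t : ℂ) • rmul f q) x‖ * ‖ζ n‖ := ContinuousLinearMap.le_opNorm _ _
        _ ≤ _ := by rw [hζ, mul_one]; exact C0_apply_le _ _
    have := le_of_tendsto' (hlim.const_mul (1 + t)) h1
    linarith
  nlinarith

lemma isSm_of_attain {f : C₀(ℝ, H →L[ℂ] H)} {ψ : C₀(ℝ, H →L[ℂ] H) →ₗ[ℂ] ℂ} (hs : IsSm f ψ)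
    {x : ℝ} {η : H} (hη : ‖η‖ = 1) (h1 : ‖f x η‖ = 1) :
    ∀ a, ψ a = inner ℂ (f x η) (a x η) := by
  have hre : ∀ a, (inner ℂ (f x η) (a x η)).re ≤ (ψ a).re := by
    intro a
    refine le_of_forall_pos_le_add fun ε hε => ?_
    obtain ⟨δ, hδ, h⟩ := hs a ε hε
    have ht := h (δ / 2) (by positivity) (by linarith)
    set t := δ / 2 with htdef
    have ht0 : 0 < t := by positivity
    have e : (inner ℂ (f x η) ((f + (t : ℂ) • a) x η)).re = 1 + t * (inner ℂ (f x η) (a x η)).re := by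
      have : (f + (t : ℂ) • a) x η = f x η + (t : ℂ) • a x η := rfl
      rw [this, inner_add_right, inner_self_eq_norm_sq_to_K, h1, inner_smul_right, Complex.add_re,
        Complex.re_ofReal_mul]
      simp
    have : (inner ℂ (f x η) ((f + (t : ℂ) • a) x η)).re ≤ ‖f + (t : ℂ) • a‖ :=
      (Complex.re_le_norm _).trans ((inner_apply_norm_le _ h1 hη).trans (C0_apply_le _ _))
    nlinarith
  have hre' : ∀ a, (inner ℂ (f x η) (a x η)).re = (ψ a).re := fun a => by
    refine le_antisymm (hre a) ?_
    have := hre (-a)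
    have e : (-a) x η = - (a x η) := rfl
    rw [e, inner_neg_right, map_neg, Complex.neg_re, Complex.neg_re] at this
    linarith
  intro a
  apply Complex.ext
  · exact (hre' a).symm
  · have := hre' (Complex.I • a)
    have e : (Complex.I • a) x η = Complex.I • (a x η) := rfl
    rw [e, inner_smul_right, map_smul, smul_eq_mul] at this
    simp at this
    exact this.symm

variable [CompleteSpace H]

lemma weak_null {T : H →L[ℂ] H} (hT : ‖T‖ = 1) (hn : ∀ η, ‖η‖ = 1 → ‖T η‖ ≠ 1)
    (η : ℕ → H) (hη : ∀ n, ‖η n‖ = 1) (hl : Filter.Tendsto (fun n => ‖T (η n)‖) Filter.atTop (nhds 1))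
    (v : H) : Filter.Tendsto (fun n => inner ℂ v (η n)) Filter.atTop (nhds 0) := by
  set D : H →L[ℂ] H := 1 - T.adjoint * T with hD
  have hDsa : ∀ u w, inner ℂ (D u) w = inner ℂ u (D w) := by
    intro u w
    simp [hD, inner_sub_left, inner_sub_right, ContinuousLinearMap.adjoint_inner_left,
      ContinuousLinearMap.adjoint_inner_right]
  have hbd : ∀ u, ‖D u‖ ^ 2 ≤ ‖u‖ ^ 2 - ‖T u‖ ^ 2 := by
    intro u
    have e : D u = u - T.adjoint (T u) := rfl
    rw [e, norm_sq_sub_re, ContinuousLinearMap.adjoint_inner_right, inner_self_eq_norm_sq_to_K]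
    have h1 : ‖T.adjoint (T u)‖ ≤ ‖T u‖ := by
      have := T.adjoint.le_opNorm (T u)
      rwa [LinearIsometryEquiv.norm_map, hT, one_mul] at this
    have h2 : ((‖T u‖ : ℂ) ^ 2).re = ‖T u‖ ^ 2 := by rw [← Complex.ofReal_pow, Complex.ofReal_re]
    have h3 : ‖T.adjoint (T u)‖ ^ 2 ≤ ‖T u‖ ^ 2 := by gcongr
    have h2' : (((‖T u‖ : ℝ) : ℂ) ^ 2).re = ‖T u‖ ^ 2 := h2
    erw [h2']
    linarith
  have hker : ∀ u, D u = 0 → u = 0 := by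
    intro u hu
    by_contra hu0
    have h1 : inner ℂ u (D u) = 0 := by rw [hu]; simp
    have e : D u = u - T.adjoint (T u) := rfl
    rw [e, inner_sub_right, ContinuousLinearMap.adjoint_inner_right, inner_self_eq_norm_sq_to_K,
      inner_self_eq_norm_sq_to_K, sub_eq_zero] at h1
    have h2 : ‖u‖ ^ 2 = ‖T u‖ ^ 2 := by exact_mod_cast h1
    have h3 : ‖u‖ = ‖T u‖ := by
      exact (sq_eq_sq₀ (norm_nonneg _) (norm_nonneg _)).mp h2
    have hnu : ‖u‖ ≠ 0 := norm_ne_zero_iff.mpr hu0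
    refine hn ((‖u‖⁻¹ : ℂ) • u) ?_ ?_
    · rw [norm_smul]; simp [hnu]
    · rw [map_smul, norm_smul, ← h3]; simp [hnu]
  have hdense : Dense (D.range : Set H) := by
    rw [Submodule.dense_iff_topologicalClosure_eq_top, Submodule.topologicalClosure_eq_top_iff, Submodule.eq_bot_iff]
    intro u hu
    apply hker
    rw [Submodule.mem_orthogonal] at hu
    have := hu (D (D u)) ⟨D u, rfl⟩
    rw [hDsa] at this
    exact inner_self_eq_zero.mp this
  have hDn : Filter.Tendsto (fun n => ‖D (η n)‖) Filter.atTop (nhds 0) := by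
    have h1 : Filter.Tendsto (fun n => Real.sqrt (1 - ‖T (η n)‖ ^ 2)) Filter.atTop (nhds 0) := by
      have := (hl.pow 2).const_sub 1 |>.sqrt
      simpa using this
    refine squeeze_zero (fun _ => norm_nonneg _) (fun n => ?_) h1
    apply Real.le_sqrt_of_sq_le
    have := hbd (η n)
    rwa [hη, one_pow] at this
  rw [Metric.tendsto_atTop]
  intro ε hε
  obtain ⟨z, hz, ⟨w, hw⟩⟩ := Metric.dense_iff.mp hdense v (ε / 2) (by positivity)
  have h2 : Filter.Tendsto (fun n => ‖w‖ * ‖D (η n)‖) Filter.atTop (nhds 0) := by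
    simpa using hDn.const_mul ‖w‖
  obtain ⟨N, hN⟩ := Metric.tendsto_atTop.mp h2 (ε / 2) (by positivity)
  refine ⟨N, fun n hn' => ?_⟩
  have h3 := hN n hn'
  rw [Real.dist_0_eq_abs, abs_of_nonneg (by positivity)] at h3
  rw [dist_zero_right]
  have hz' : ‖v - D w‖ < ε / 2 := by
    have hw' : D w = z := hw
    rw [hw', ← dist_eq_norm, dist_comm]; exact hz
  calc ‖inner ℂ v (η n)‖ = ‖inner ℂ (v - D w) (η n) + inner ℂ w (D (η n))‖ := by
        rw [inner_sub_left, hDsa]; simp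
    _ ≤ ‖inner ℂ (v - D w) (η n)‖ + ‖inner ℂ w (D (η n))‖ := norm_add_le _ _
    _ ≤ ‖v - D w‖ * ‖η n‖ + ‖w‖ * ‖D (η n)‖ := add_le_add (norm_inner_le_norm _ _) (norm_inner_le_norm _ _)
    _ < ε := by rw [hη]; linarith

lemma exists_unit_orth {T : H →L[ℂ] H} (hT : ‖T‖ = 1) (hn : ∀ η, ‖η‖ = 1 → ‖T η‖ ≠ 1)
    (η : ℕ → H) (hη : ∀ n, ‖η n‖ = 1) (hl : Filter.Tendsto (fun n => ‖T (η n)‖) Filter.atTop (nhds 1))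
    (F : Submodule ℂ H) [FiniteDimensional ℂ F] {ε : ℝ} (hε : 0 < ε) :
    ∃ ζ : H, ‖ζ‖ = 1 ∧ 1 - ε < ‖T ζ‖ ∧ ∀ v ∈ F, inner ℂ v ζ = 0 := by
  have hp : Filter.Tendsto (fun n => ‖F.starProjection (η n)‖) Filter.atTop (nhds 0) := by
    have b := stdOrthonormalBasis ℂ F
    have h1 : ∀ n, F.starProjection (η n) = ∑ i, inner ℂ (b i : H) (η n) • (b i : H) := fun n => by
      rw [b.starProjection_eq_sum_rankOne]; simp [ContinuousLinearMap.sum_apply]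
    have h2 : Filter.Tendsto (fun n => ∑ i, inner ℂ (b i : H) (η n) • (b i : H)) Filter.atTop
        (nhds (∑ i, (0 : ℂ) • (b i : H))) :=
      tendsto_finset_sum _ fun i _ => (weak_null hT hn η hη hl (b i)).smul_const _
    simp only [zero_smul, Finset.sum_const_zero] at h2
    simp only [h1]
    simpa using h2.norm
  have h3 := hl.sub hp
  rw [sub_zero] at h3
  obtain ⟨n, hn1, hn2⟩ := ((h3.eventually (lt_mem_nhds (show (1 : ℝ) - min ε 1 < 1 from
    by have : 0 < min ε 1 := lt_min hε one_pos
       linarith))).and (Filter.eventually_ge_atTop 0)).exists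
  set p := F.starProjection (η n) with hpdef
  set z := η n - p with hz
  have hTz : ‖T (η n)‖ - ‖p‖ ≤ ‖T z‖ := by
    rw [hz, map_sub]
    have h4 : ‖T p‖ ≤ ‖p‖ := by simpa [hT] using T.le_opNorm p
    linarith [norm_sub_norm_le (T (η n)) (T p)]
  have hzn : ‖z‖ ≤ 1 := by
    have h5 : z ∈ Fᗮ := F.sub_starProjection_mem_orthogonal (η n)
    have h6 : inner ℂ p z = 0 := (Submodule.mem_orthogonal _ _).mp h5 p (F.starProjection_apply_mem _)
    have h7 := norm_sq_add_re p z
    rw [h6, show p + z = η n by rw [hz]; abel, hη] at h7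
    simp at h7
    nlinarith [norm_nonneg z, norm_nonneg p]
  have hTz1 : 1 - min ε 1 < ‖T z‖ := by linarith
  have hz0 : 0 < ‖z‖ := by
    by_contra h
    have : z = 0 := by rw [← norm_eq_zero]; exact le_antisymm (not_lt.mp h) (norm_nonneg _)
    rw [this] at hTz1
    simp at hTz1
  refine ⟨((‖z‖⁻¹ : ℝ) : ℂ) • z, ?_, ?_, ?_⟩
  · rw [norm_smul, Complex.norm_real, Real.norm_of_nonneg (by positivity)]; field_simp
  · rw [map_smul, norm_smul, Complex.norm_real, Real.norm_of_nonneg (by positivity)]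
    have : 1 ≤ ‖z‖⁻¹ := (one_le_inv₀ hz0).mpr hzn
    have h8 : ‖T z‖ ≤ ‖z‖⁻¹ * ‖T z‖ := le_mul_of_one_le_left (norm_nonneg _) this
    linarith [min_le_left ε 1]
  · intro v hv
    rw [inner_smul_right, (Submodule.mem_orthogonal _ _).mp (F.sub_starProjection_mem_orthogonal (η n)) v hv,
      mul_zero]

lemma exists_on_seq {T : H →L[ℂ] H} (hT : ‖T‖ = 1) (hn : ∀ η, ‖η‖ = 1 → ‖T η‖ ≠ 1) :
    ∃ ζ : ℕ → H, (∀ n, ‖ζ n‖ = 1) ∧ (∀ m n, m < n → inner ℂ (ζ m) (ζ n) = 0) ∧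
      Filter.Tendsto (fun n => ‖T (ζ n)‖) Filter.atTop (nhds 1) := by
  classical
  have hle : ∀ v : H, ‖v‖ = 1 → ‖T v‖ ≤ 1 := fun v hv => by simpa [hT, hv] using T.le_opNorm v
  have hsup : ∀ n : ℕ, ∃ v : H, ‖v‖ = 1 ∧ 1 - 1 / ((n : ℝ) + 1) < ‖T v‖ := by
    intro n
    by_contra hcon
    push Not at hcon
    have hpos : (0 : ℝ) < 1 / ((n : ℝ) + 1) := by positivity
    have hle1 : 1 / ((n : ℝ) + 1) ≤ 1 := by
      rw [div_le_one (by positivity)]; linarith [(Nat.cast_nonneg n : (0 : ℝ) ≤ n)]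
    have : ‖T‖ ≤ 1 - 1 / ((n : ℝ) + 1) := by
      refine T.opNorm_le_of_unit_norm (by linarith) hcon
    linarith
  choose η hη hη2 using hsup
  have h1n : Filter.Tendsto (fun n : ℕ => 1 - 1 / ((n : ℝ) + 1)) Filter.atTop (nhds 1) := by
    simpa using (tendsto_one_div_add_atTop_nhds_zero_nat (𝕜 := ℝ)).const_sub 1
  have hl : Filter.Tendsto (fun n => ‖T (η n)‖) Filter.atTop (nhds 1) :=
    tendsto_of_tendsto_of_tendsto_of_le_of_le h1n tendsto_const_nhds (fun n => (hη2 n).le)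
      (fun n => hle _ (hη n))
  obtain ⟨f, hf1, hf2⟩ := exists_seq_of_forall_finset_exists
    (fun p : H × ℕ => ‖p.1‖ = 1 ∧ 1 - 1 / ((p.2 : ℝ) + 1) < ‖T p.1‖)
    (fun p q => inner ℂ p.1 q.1 = 0 ∧ p.2 < q.2) (by
      intro s _
      set F := Submodule.span ℂ ((s.image Prod.fst : Finset H) : Set H)
      set N := s.sup Prod.snd + 1
      obtain ⟨ζ, h1, h2, h3⟩ := exists_unit_orth hT hn η hη hl F
        (show (0 : ℝ) < 1 / ((N : ℝ) + 1) by positivity)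
      refine ⟨(ζ, N), ⟨h1, h2⟩, fun p hp => ⟨h3 _ (Submodule.subset_span ?_), ?_⟩⟩
      · simp only [Finset.coe_image, Set.mem_image, Finset.mem_coe]
        exact ⟨p, hp, rfl⟩
      · exact Nat.lt_succ_of_le (Finset.le_sup (f := Prod.snd) hp))
  refine ⟨fun n => (f n).1, fun n => (hf1 n).1, fun m n h => (hf2 m n h).1, ?_⟩
  have hmono : StrictMono (fun n => (f n).2) := fun m n h => (hf2 m n h).2
  exact tendsto_of_tendsto_of_tendsto_of_le_of_le (h1n.comp hmono.tendsto_atTop) tendsto_const_nhds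
    (fun n => (hf1 n).2.le) (fun n => hle _ (hf1 n).1)

/-- Every derivative at a smooth point is a vector functional at a point. -/
lemma isSm_mem {f : C₀(ℝ, H →L[ℂ] H)} {ψ : C₀(ℝ, H →L[ℂ] H) →ₗ[ℂ] ℂ} (hs : IsSm f ψ)
    (hf : ‖f‖ = 1) : ∃ (x : ℝ) (ξ η : H), ‖ξ‖ = 1 ∧ ‖η‖ = 1 ∧ ∀ a, ψ a = inner ℂ ξ (a x η) := by
  obtain ⟨x, hx⟩ := C0_attain f hf
  by_cases hatt : ∃ η, ‖η‖ = 1 ∧ ‖f x η‖ = 1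
  · obtain ⟨η, h1, h2⟩ := hatt
    exact ⟨x, f x η, η, h2, h1, isSm_of_attain hs h1 h2⟩
  exfalso
  push Not at hatt
  obtain ⟨ζ, hζ1, hζ2, hζ3⟩ := exists_on_seq hx hatt
  set K := (Submodule.span ℂ (Set.range fun n : ℕ => ζ (2 * n))).topologicalClosure with hK
  haveI : CompleteSpace K := (Submodule.isClosed_topologicalClosure _).completeSpace_coe
  set q := K.starProjection with hq
  have hq1 : ∀ n, q (ζ (2 * n)) = ζ (2 * n) := fun n =>
    K.starProjection_eq_self_iff.mpr (Submodule.le_topologicalClosure _ (Submodule.subset_span ⟨n, rfl⟩))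
  have hq2 : ∀ n, q (ζ (2 * n + 1)) = 0 := fun n => by
    rw [hq, Submodule.starProjection_apply_eq_zero_iff, hK, Submodule.orthogonal_closure,
      Submodule.mem_orthogonal]
    intro u hu
    induction hu using Submodule.span_induction with
    | mem u hu =>
      obtain ⟨m, rfl⟩ := hu
      rcases lt_or_gt_of_ne (show 2 * m ≠ 2 * n + 1 by omega) with h | h
      · exact hζ2 _ _ h
      · have := hζ2 _ _ h
        show inner ℂ (ζ (2 * m)) (ζ (2 * n + 1)) = 0
        rw [← inner_conj_symm, this]; simp
    | zero => simp
    | add u v _ _ hu hv => rw [inner_add_left, hu, hv, add_zero]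
    | smul c u _ hu => rw [inner_smul_left, hu, mul_zero]
  have t1 : Filter.Tendsto (fun n : ℕ => 2 * n) Filter.atTop Filter.atTop :=
    Filter.tendsto_atTop_mono (fun n => by show n ≤ 2 * n; omega) Filter.tendsto_id
  have t2 : Filter.Tendsto (fun n : ℕ => 2 * n + 1) Filter.atTop Filter.atTop :=
    Filter.tendsto_atTop_mono (fun n => by show n ≤ 2 * n + 1; omega) Filter.tendsto_id
  have h1 := isSm_rmul_ge hs x q (fun n => ζ (2 * n)) (fun n => hζ1 _) hq1 (hζ3.comp t1)
  have h2 := isSm_rmul_ge hs x (1 - q) (fun n => ζ (2 * n + 1)) (fun n => hζ1 _)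
    (fun n => by simp [hq2]) (hζ3.comp t2)
  have e : rmul f q + rmul f (1 - q) = f := by
    ext1 t
    show f t * q + f t * (1 - q) = f t
    rw [mul_sub, mul_one]; abel
  have h3 : (ψ f).re ≤ 1 := by
    refine le_of_forall_pos_le_add fun ε hε => ?_
    obtain ⟨δ, hδ, h⟩ := hs (-f) ε hε
    set t := min (δ / 2) (1 / 2) with ht
    have ht0 : 0 < t := lt_min (by positivity) (by norm_num)
    have ht1 : t ≤ 1 / 2 := min_le_right _ _
    have := h t ht0 ((min_le_left _ _).trans_lt (by linarith))
    have e2 : f + (t : ℂ) • (-f) = ((1 - t : ℝ) : ℂ) • f := by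
      ext1 y
      show f y + (t : ℂ) • (-(f y)) = ((1 - t : ℝ) : ℂ) • f y
      push_cast; rw [sub_smul, smul_neg, one_smul]; abel
    rw [e2, norm_smul, hf, Complex.norm_real, Real.norm_of_nonneg (by linarith), map_neg,
      Complex.neg_re] at this
    nlinarith
  rw [← e, map_add, Complex.add_re] at h3
  linarith

/-- surjective isometries preserve vector functionals -/
lemma surj_iso_dual {S : C₀(ℝ, H →L[ℂ] H) →ₗ[ℂ] C₀(ℝ, H →L[ℂ] H)} (hS : Function.Surjective S)
    (hi : ∀ a, ‖S a‖ = ‖a‖) (x : ℝ) {ξ η : H} (hξ : ‖ξ‖ = 1) (hη : ‖η‖ = 1) :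
    ∃ (x' : ℝ) (ξ' η' : H), ‖ξ'‖ = 1 ∧ ‖η'‖ = 1 ∧
      ∀ a, inner ℂ ξ (S a x η) = inner ℂ ξ' (a x' η') := by
  obtain ⟨f, hf⟩ := hS (tens (pk x) (rankOne ℂ ξ η))
  have hfn : ‖f‖ = 1 := by
    rw [← hi, hf, tens_pk_norm, norm_rankOne, hξ, hη, one_mul]
  let ψ : C₀(ℝ, H →L[ℂ] H) →ₗ[ℂ] ℂ :=
    { toFun := fun a => inner ℂ ξ (S a x η)
      map_add' := fun a b => by
        rw [map_add]; show inner ℂ ξ (S a x η + S b x η) = _; rw [inner_add_right]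
      map_smul' := fun c a => by
        rw [map_smul]; show inner ℂ ξ (c • S a x η) = _; rw [inner_smul_right]; rfl }
  have hs : IsSm f ψ := by
    intro a ε hε
    obtain ⟨δ, hδ, h⟩ := isSm_pk x hξ hη (S a) ε hε
    refine ⟨δ, hδ, fun t h1 h2 => ?_⟩
    rw [← hi, map_add, map_smul, hf]
    exact h t h1 h2
  exact isSm_mem hs hfn

end sm

section str
variable {H : Type*} [NormedAddCommGroup H] [InnerProductSpace ℂ H]

/-- peak function times a bounded continuous function -/
noncomputable def pkm (y : ℝ) (g : ℝ → ℝ) (hg : Continuous g) (hb : ∀ t, |g t| ≤ 1) : C₀(ℝ, ℂ) where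
  toFun t := pk y t * (g t : ℂ)
  continuous_toFun := (map_continuous (pk y)).mul (Complex.continuous_ofReal.comp hg)
  zero_at_infty' := by
    refine squeeze_zero_norm (a := fun t => ‖pk y t‖) (fun t => ?_) (by simpa using (zero_at_infty (pk y)).norm)
    rw [norm_mul, Complex.norm_real]
    exact mul_le_of_le_one_right (norm_nonneg _) (hb t)

lemma pkm_apply (y : ℝ) (g : ℝ → ℝ) (hg : Continuous g) (hb : ∀ t, |g t| ≤ 1) (t : ℝ) :
    pkm y g hg hb t = pk y t * (g t : ℂ) := rfl

lemma exists_sep {y a b : ℝ} (h1 : y ≠ a) (h2 : y ≠ b) : ∃ q : C₀(ℝ, ℂ), q y ≠ 0 ∧ q a = 0 ∧ q b = 0 := by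
  refine ⟨pkm y (fun t => min 1 |t - a| * min 1 |t - b|) (by fun_prop) (fun t => ?_), ?_, ?_, ?_⟩
  · rw [abs_of_nonneg (by positivity)]
    exact mul_le_one₀ (min_le_left _ _) (by positivity) (min_le_left _ _)
  · rw [pkm_apply]
    have e1 : 0 < |y - a| := abs_pos.mpr (sub_ne_zero.mpr h1)
    have e2 : 0 < |y - b| := abs_pos.mpr (sub_ne_zero.mpr h2)
    have : 0 < min 1 |y - a| * min 1 |y - b| := by positivity
    exact mul_ne_zero (pk_ne _ _) (by exact_mod_cast this.ne')
  · rw [pkm_apply]; simp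
  · rw [pkm_apply]; simp

lemma sep_aux {x1 x2 x3 : ℝ} {ξ1 ξ2 ξ3 η1 η2 η3 : H} (hξ1 : ‖ξ1‖ = 1) (hη1 : ‖η1‖ = 1) (c : ℂ)
    (h : ∀ a : C₀(ℝ, H →L[ℂ] H), inner ℂ ξ1 (a x1 η1) + inner ℂ ξ2 (a x2 η2) = c * inner ℂ ξ3 (a x3 η3))
    (h12 : x1 ≠ x2) (h13 : x1 ≠ x3) : False := by
  obtain ⟨q, q1, q2, q3⟩ := exists_sep h12 h13
  have := h (tens q (rankOne ℂ ξ1 η1))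
  simp [q2, q3, hξ1, hη1, inner_smul_right] at this
  exact q1 this

lemma same_pt {x1 x2 x3 : ℝ} {ξ1 ξ2 ξ3 η1 η2 η3 : H} (hξ1 : ‖ξ1‖ = 1) (hη1 : ‖η1‖ = 1)
    (hξ2 : ‖ξ2‖ = 1) (hη2 : ‖η2‖ = 1) (c : ℂ)
    (h : ∀ a : C₀(ℝ, H →L[ℂ] H), inner ℂ ξ1 (a x1 η1) + inner ℂ ξ2 (a x2 η2) = c * inner ℂ ξ3 (a x3 η3)) :
    x1 = x2 := by
  by_contra h12
  by_cases h13 : x1 = x3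
  · subst h13
    exact sep_aux hξ2 hη2 c (fun a => by rw [add_comm]; exact h a) (Ne.symm h12) (Ne.symm h12)
  · exact sep_aux hξ1 hη1 c h h12 h13

lemma exists_normalize {w0 : H} (hw : ‖w0‖ = 1) (v : H) : ∃ (w : H) (r : ℝ), ‖w‖ = 1 ∧ v = (r : ℂ) • w := by
  by_cases hv : v = 0
  · exact ⟨w0, 0, hw, by simp [hv]⟩
  · have h0 : ‖v‖ ≠ 0 := norm_ne_zero_iff.mpr hv
    refine ⟨((‖v‖⁻¹ : ℝ) : ℂ) • v, ‖v‖, ?_, ?_⟩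
    · rw [norm_smul, Complex.norm_real, Real.norm_of_nonneg (by positivity)]; field_simp
    · rw [smul_smul, ← Complex.ofReal_mul, mul_inv_cancel₀ h0]; simp

lemma opNorm_le_of_inner (T : H →L[ℂ] H) {M : ℝ} (hM : 0 ≤ M)
    (h : ∀ ξ η : H, ‖ξ‖ = 1 → ‖η‖ = 1 → ‖inner ℂ ξ (T η)‖ ≤ M) : ‖T‖ ≤ M := by
  refine T.opNorm_le_bound hM fun v => ?_
  by_cases hv : v = 0
  · simp [hv]
  have h0 : ‖v‖ ≠ 0 := norm_ne_zero_iff.mpr hv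
  obtain ⟨η, s, hη, es⟩ := exists_normalize
    (w0 := ((‖v‖⁻¹ : ℝ) : ℂ) • v) (by
      rw [norm_smul, Complex.norm_real, Real.norm_of_nonneg (by positivity)]; field_simp) v
  rw [es, map_smul, norm_smul, norm_smul, hη, mul_one, mul_comm]
  refine mul_le_mul_of_nonneg_right ?_ (norm_nonneg _)
  obtain ⟨ξ, r, hξ, e⟩ := exists_normalize hη (T η)
  have := h ξ η hξ hη
  rw [e, inner_smul_right, inner_self_eq_norm_sq_to_K, hξ] at this
  rw [e, norm_smul, hξ]
  simpa using this

variable [CompleteSpace H] [Nontrivial H]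

lemma struct_pt {S : C₀(ℝ, H →L[ℂ] H) →ₗ[ℂ] C₀(ℝ, H →L[ℂ] H)} (hS : Function.Surjective S)
    (hi : ∀ a, ‖S a‖ = ‖a‖) : ∃ φ : ℝ → ℝ, ∀ (x : ℝ) (ξ η : H), ‖ξ‖ = 1 → ‖η‖ = 1 →
      ∃ ξ' η' : H, ‖ξ'‖ = 1 ∧ ‖η'‖ = 1 ∧
      ∀ a, inner ℂ ξ (S a x η) = inner ℂ ξ' (a (φ x) η') := by
  obtain ⟨w, hw⟩ : ∃ w : H, ‖w‖ = 1 := exists_norm_eq H zero_le_one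
  choose X h using fun x (ξ η : {v : H // ‖v‖ = 1}) => surj_iso_dual hS hi x ξ.2 η.2
  have r1 : ∀ x ξ η1 η2, X x ξ η1 = X x ξ η2 := by
    intro x ξ η1 η2
    obtain ⟨a1, b1, ha1, hb1, e1⟩ := h x ξ η1
    obtain ⟨a2, b2, ha2, hb2, e2⟩ := h x ξ η2
    obtain ⟨v, r, hv, er⟩ := exists_normalize hw ((η1 : H) + η2)
    obtain ⟨a3, b3, ha3, hb3, e3⟩ := h x ξ ⟨v, hv⟩
    refine same_pt ha1 hb1 ha2 hb2 (r : ℂ) (x3 := X x ξ ⟨v, hv⟩) (ξ3 := a3) (η3 := b3) fun a => ?_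
    rw [← e1, ← e2, ← e3, ← inner_add_right, ← map_add, er, map_smul, inner_smul_right]
  have r2 : ∀ x ξ1 ξ2 η, X x ξ1 η = X x ξ2 η := by
    intro x ξ1 ξ2 η
    obtain ⟨a1, b1, ha1, hb1, e1⟩ := h x ξ1 η
    obtain ⟨a2, b2, ha2, hb2, e2⟩ := h x ξ2 η
    obtain ⟨v, r, hv, er⟩ := exists_normalize hw ((ξ1 : H) + ξ2)
    obtain ⟨a3, b3, ha3, hb3, e3⟩ := h x ⟨v, hv⟩ η
    refine same_pt ha1 hb1 ha2 hb2 (r : ℂ) (x3 := X x ⟨v, hv⟩ η) (ξ3 := a3) (η3 := b3) fun a => ?_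
    rw [← e1, ← e2, ← e3, ← inner_add_left, er, inner_smul_left, Complex.conj_ofReal]
  refine ⟨fun x => X x ⟨w, hw⟩ ⟨w, hw⟩, fun x ξ η hξ hη => ?_⟩
  have := h x ⟨ξ, hξ⟩ ⟨η, hη⟩
  rwa [r2 x _ ⟨w, hw⟩, r1 x _ _ ⟨w, hw⟩] at this

/-- well-behaved linear maps of `B(H)` -/
structure Good (τ : (H →L[ℂ] H) →ₗ[ℂ] (H →L[ℂ] H)) : Prop where
  surj : Function.Surjective τ
  iso : ∀ T, ‖τ T‖ = ‖T‖
  dual : ∀ ξ η : H, ‖ξ‖ = 1 → ‖η‖ = 1 → ∃ ξ' η' : H, ‖ξ'‖ = 1 ∧ ‖η'‖ = 1 ∧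
    ∀ T, inner ℂ ξ (τ T η) = inner ℂ ξ' (T η')
  codual : ∀ ξ' η' : H, ‖ξ'‖ = 1 → ‖η'‖ = 1 → ∃ ξ η : H, ‖ξ‖ = 1 ∧ ‖η‖ = 1 ∧
    ∀ T, inner ℂ ξ (τ T η) = inner ℂ ξ' (T η')

lemma struct_norm_le {S : C₀(ℝ, H →L[ℂ] H) → C₀(ℝ, H →L[ℂ] H)} {φ : ℝ → ℝ}
    (h : ∀ (x : ℝ) (ξ η : H), ‖ξ‖ = 1 → ‖η‖ = 1 →
      ∃ ξ' η' : H, ‖ξ'‖ = 1 ∧ ‖η'‖ = 1 ∧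
      ∀ a, inner ℂ ξ (S a x η) = inner ℂ ξ' (a (φ x) η')) (a : C₀(ℝ, H →L[ℂ] H)) (x : ℝ) :
    ‖S a x‖ ≤ ‖a (φ x)‖ := by
  refine opNorm_le_of_inner _ (norm_nonneg _) fun ξ η hξ hη => ?_
  obtain ⟨ξ', η', h1, h2, e⟩ := h x ξ η hξ hη
  rw [e]
  exact inner_apply_norm_le _ h1 h2

theorem surj_iso_struct {S : C₀(ℝ, H →L[ℂ] H) →ₗ[ℂ] C₀(ℝ, H →L[ℂ] H)} (hS : Function.Surjective S)
    (hi : ∀ a, ‖S a‖ = ‖a‖) : ∃ φ : ℝ → ℝ, Function.Bijective φ ∧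
      ∀ x, ∃ τ : (H →L[ℂ] H) →ₗ[ℂ] (H →L[ℂ] H), Good τ ∧ ∀ f, S f x = τ (f (φ x)) := by
  have hinj : Function.Injective S := by
    rw [injective_iff_map_eq_zero]
    intro a ha
    rw [← norm_eq_zero, ← hi, ha, norm_zero]
  let E := LinearEquiv.ofBijective S ⟨hinj, hS⟩
  have hE : ∀ a, E.symm (S a) = a := fun a => E.symm_apply_apply a
  have hE' : ∀ a, S (E.symm a) = a := fun a => E.apply_symm_apply a
  have hi' : ∀ a, ‖E.symm.toLinearMap a‖ = ‖a‖ := fun a => by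
    rw [← hi]; exact congrArg _ (hE' a)
  obtain ⟨φ, hφ⟩ := struct_pt hS hi
  obtain ⟨ψ, hψ⟩ := struct_pt (S := E.symm.toLinearMap) E.symm.surjective hi'
  have n1 := struct_norm_le (S := S) hφ
  have n2 := struct_norm_le (S := E.symm) hψ
  have c1 : ∀ y, φ (ψ y) = y := by
    intro y
    have h1 := n1 (tens (pk y) 1) (ψ y)
    have h2 := n2 (S (tens (pk y) 1)) y
    rw [hE] at h2
    refine pk_norm_eq_one ?_
    have := h2.trans h1
    simpa [norm_smul] using this
  have c2 : ∀ y, ψ (φ y) = y := by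
    intro y
    have h1 := n2 (tens (pk y) 1) (φ y)
    have h2 := n1 (E.symm (tens (pk y) 1)) y
    rw [hE'] at h2
    refine pk_norm_eq_one ?_
    have := h2.trans h1
    simpa [norm_smul] using this
  refine ⟨φ, ⟨Function.LeftInverse.injective c2, Function.RightInverse.surjective c1⟩, fun x => ?_⟩
  have neq : ∀ a, ‖S a x‖ = ‖a (φ x)‖ := fun a => le_antisymm (n1 a x) (by
    have := n2 (S a) (φ x)
    rwa [hE, c2] at this)
  have key : ∀ a b : C₀(ℝ, H →L[ℂ] H), a (φ x) = b (φ x) → S a x = S b x := by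
    intro a b hab
    have := neq (a - b)
    rw [map_sub] at this
    have e : (a - b) (φ x) = 0 := by show a (φ x) - b (φ x) = 0; rw [hab, sub_self]
    rw [e, norm_zero, norm_eq_zero] at this
    exact sub_eq_zero.mp this
  let τ : (H →L[ℂ] H) →ₗ[ℂ] (H →L[ℂ] H) :=
    { toFun := fun T => S (tens (pk (φ x)) T) x
      map_add' := fun T T' => by
        rw [← ZeroAtInftyContinuousMap.add_apply, ← map_add]
        exact key _ _ (by simp)
      map_smul' := fun c T => by
        rw [RingHom.id_apply, ← ZeroAtInftyContinuousMap.smul_apply, ← map_smul]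
        exact key _ _ (by simp) }
  have hτ : ∀ f, S f x = τ (f (φ x)) := fun f => key _ _ (by simp)
  have hτ' : ∀ T, τ T = S (tens (pk (φ x)) T) x := fun T => rfl
  refine ⟨τ, ⟨fun B => ?_, fun T => ?_, fun ξ η hξ hη => ?_, fun ξ η hξ hη => ?_⟩, hτ⟩
  · refine ⟨E.symm (tens (pk x) B) (φ x), ?_⟩
    rw [← hτ, hE']; simp
  · rw [hτ', neq]; simp
  · obtain ⟨ξ', η', h1, h2, e⟩ := hφ x ξ η hξ hη
    exact ⟨ξ', η', h1, h2, fun T => by rw [hτ', e]; simp⟩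
  · obtain ⟨ξ', η', h1, h2, e⟩ := hψ (φ x) ξ η hξ hη
    refine ⟨ξ', η', h1, h2, fun T => ?_⟩
    have := e (S (tens (pk (φ x)) T))
    rw [c2] at this
    rw [hτ', ← this]
    show inner ℂ ξ (E.symm (S (tens (pk (φ x)) T)) (φ x) η) = _
    rw [hE]; simp

end str

section gd
variable {H : Type*} [NormedAddCommGroup H] [InnerProductSpace ℂ H]

lemma refl_norm {ξ : H} (hξ : ‖ξ‖ = 1) (w : H) : ‖(2 * inner ℂ ξ w) • ξ - w‖ = ‖w‖ := by
  have h := norm_sq_sub_re ((2 * inner ℂ ξ w) • ξ) w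
  rw [inner_smul_left, norm_smul, hξ, map_mul, norm_mul] at h
  have e : (starRingEnd ℂ 2 * (starRingEnd ℂ) (inner ℂ ξ w) * inner ℂ ξ w).re = 2 * ‖inner ℂ ξ w‖ ^ 2 := by
    rw [mul_assoc, Complex.conj_mul']
    have : (starRingEnd ℂ) 2 = ((2 : ℝ) : ℂ) := by simpa using map_ofNat (starRingEnd ℂ) 2
    rw [this, ← Complex.ofReal_pow, ← Complex.ofReal_mul, Complex.ofReal_re]
  rw [e] at h
  simp at h
  have h2 : ‖(2 * inner ℂ ξ w) • ξ - w‖ ^ 2 = ‖w‖ ^ 2 := by rw [h]; ring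
  exact (sq_eq_sq₀ (norm_nonneg _) (norm_nonneg _)).mp h2

variable [CompleteSpace H]

lemma orth_est {ξ η : H} (hξ : ‖ξ‖ = 1) (hη : ‖η‖ = 1) {D : H →L[ℂ] H} (h1 : D η = 0)
    (h2 : D.adjoint ξ = 0) (v : H) :
    ‖rankOne ℂ ξ η v + D v‖ ^ 2 = ‖inner ℂ η v‖ ^ 2 + ‖D v‖ ^ 2 := by
  rw [norm_sq_add_re, rankOne_apply, inner_smul_left, ← ContinuousLinearMap.adjoint_inner_left, h2,
    norm_smul, hξ]
  simp

lemma orth_est_le {ξ η : H} (hξ : ‖ξ‖ = 1) (hη : ‖η‖ = 1) {D : H →L[ℂ] H} (h1 : D η = 0)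
    (h2 : D.adjoint ξ = 0) (h3 : ‖D‖ ≤ 1) : ‖rankOne ℂ ξ η + D‖ ≤ 1 := by
  refine le_of_sq_bound _ zero_le_one fun v => ?_
  rw [add_apply, orth_est hξ hη h1 h2, (unit_decomp hη v).2]
  have : ‖D v‖ ≤ ‖v - inner ℂ η v • η‖ := by
    have e : D v = D (v - inner ℂ η v • η) := by rw [map_sub, map_smul, h1, smul_zero, sub_zero]
    rw [e]
    calc _ ≤ ‖D‖ * ‖v - inner ℂ η v • η‖ := D.le_opNorm _
      _ ≤ 1 * ‖v - inner ℂ η v • η‖ := by gcongr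
      _ = _ := one_mul _
  have : ‖D v‖ ^ 2 ≤ ‖v - inner ℂ η v • η‖ ^ 2 := by gcongr
  linarith

lemma Good.rank_one {τ : (H →L[ℂ] H) →ₗ[ℂ] (H →L[ℂ] H)} (hτ : Good τ) {ξ η ξ' η' : H}
    (hξ : ‖ξ‖ = 1) (hη : ‖η‖ = 1) (hξ' : ‖ξ'‖ = 1) (hη' : ‖η'‖ = 1)
    (h : ∀ T, inner ℂ ξ (τ T η) = inner ℂ ξ' (T η')) : τ (rankOne ℂ ξ' η') = rankOne ℂ ξ η := by
  set T := τ (rankOne ℂ ξ' η') with hT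
  have hTn : ‖T‖ ≤ 1 := by rw [hT, hτ.iso, norm_rankOne, hξ', hη']; norm_num
  have hT1 : inner ℂ ξ (T η) = 1 := by rw [hT, h]; simp [hξ', hη']
  have a1 := contr_right hTn hξ hη hT1
  have a2 := contr_left hTn hξ hη hT1
  set d := T - rankOne ℂ ξ η with hd
  have d1 : d η = 0 := by rw [hd, sub_apply, a1]; simp [hη]
  have d2 : d.adjoint ξ = 0 := by
    rw [hd, map_sub, sub_apply, a2, adjoint_rankOne]; simp [hξ]
  by_contra hne
  have hd0 : 0 < ‖d‖ := norm_pos_iff.mpr (sub_ne_zero.mpr hne)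
  have bound : ∀ s : ℝ, 0 ≤ s → ‖rankOne ℂ ξ η + (s : ℂ) • d‖ ≤ 1 → s * ‖d‖ ≤ 1 := by
    intro s hs hb
    have : ‖(s : ℂ) • d‖ ≤ 1 := by
      refine le_of_sq_bound _ zero_le_one fun v => ?_
      have e := orth_est hξ hη (D := (s : ℂ) • d) (by rw [smul_apply, d1, smul_zero])
        (by rw [map_smulₛₗ, smul_apply, d2, smul_zero]) v
      have e2 := (rankOne ℂ ξ η + (s : ℂ) • d).le_opNorm v
      rw [add_apply] at e2
      have e3 : ‖(rankOne ℂ ξ η) v + ((s : ℂ) • d) v‖ ≤ ‖v‖ := by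
        refine e2.trans (mul_le_of_le_one_left (norm_nonneg _) hb)
      have e4 := pow_le_pow_left₀ (norm_nonneg _) e3 2
      nlinarith [sq_nonneg ‖inner ℂ η v‖]
    rwa [norm_smul, Complex.norm_real, Real.norm_of_nonneg hs] at this
  set r : ℝ := ‖d‖⁻¹ with hr
  have hr0 : 0 < r := by positivity
  obtain ⟨W, hW⟩ := hτ.surj (rankOne ℂ ξ η + ((-r : ℝ) : ℂ) • d)
  have hWn : ‖W‖ ≤ 1 := by
    rw [← hτ.iso, hW]
    refine orth_est_le hξ hη (by rw [smul_apply, d1, smul_zero])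
        (by rw [map_smulₛₗ, smul_apply, d2, smul_zero]) ?_
    rw [norm_smul, Complex.norm_real, norm_neg, Real.norm_of_nonneg hr0.le, hr]
    field_simp; exact le_rfl
  have hW1 : inner ℂ ξ' (W η') = 1 := by
    rw [← h, hW, add_apply, smul_apply, d1]; simp [hξ, hη]
  have b2 := contr_left hWn hξ' hη' hW1
  have hV : ‖(2 : ℂ) • rankOne ℂ ξ' η' - W‖ ≤ 1 := by
    refine ContinuousLinearMap.opNorm_le_bound _ zero_le_one fun v => ?_
    have e : ((2 : ℂ) • rankOne ℂ ξ' η' - W) v = (2 * inner ℂ ξ' (W v)) • ξ' - W v := by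
      rw [← ContinuousLinearMap.adjoint_inner_left, b2]
      simp [smul_smul]
    rw [e, refl_norm hξ', one_mul]
    exact (W.le_opNorm v).trans (mul_le_of_le_one_left (norm_nonneg _) hWn)
  rw [← hτ.iso, map_sub, map_smul, hW, ← hT] at hV
  have e : (2 : ℂ) • T - (rankOne ℂ ξ η + ((-r : ℝ) : ℂ) • d) = rankOne ℂ ξ η + ((2 + r : ℝ) : ℂ) • d := by
    have : T = rankOne ℂ ξ η + d := by rw [hd]; abel
    rw [this]; push_cast; module
  rw [e] at hV
  have := bound _ (by positivity) hV
  have e5 : r * ‖d‖ = 1 := by rw [hr]; field_simp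
  nlinarith

lemma Good.unit_aux {τ : (H →L[ℂ] H) →ₗ[ℂ] (H →L[ℂ] H)} (hτ : Good τ) {ξ0 η0 : H}
    (hξ : ‖ξ0‖ = 1) (hη : ‖η0‖ = 1) : ∃ ξ η : H, τ 1 η = ξ ∧ (τ 1).adjoint ξ = η ∧
      inner ℂ ξ ξ0 ≠ 0 ∧ inner ℂ η0 η ≠ 0 := by
  obtain ⟨ξ', η', h1, h2, e⟩ := hτ.dual ξ0 η0 hξ hη
  have hc := hτ.rank_one hξ hη h1 h2 e
  obtain ⟨ζ, hζ, z1, z2⟩ : ∃ ζ : H, ‖ζ‖ = 1 ∧ inner ℂ η' ζ ≠ 0 ∧ inner ℂ ζ ξ' ≠ 0 := by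
    by_cases h0 : inner ℂ η' ξ' = 0
    · obtain ⟨w, r, hw, er⟩ := exists_normalize h1 (η' + ξ')
      refine ⟨w, hw, fun h => ?_, fun h => ?_⟩
      · have := congrArg (inner ℂ η') er
        rw [inner_smul_right, h, inner_add_right, h0] at this
        simp [h2] at this
      · have := congrArg (fun v => inner ℂ v ξ') er
        simp only [inner_smul_left, h, inner_add_left, h0] at this
        simp [h1] at this
    · exact ⟨η', h2, by simp [h2], h0⟩
  obtain ⟨ξ, η, k1, k2, k⟩ := hτ.codual ζ ζ hζ hζ
  have hu : ‖τ 1‖ ≤ 1 := by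
    rw [hτ.iso]; exact ContinuousLinearMap.norm_id_le
  have hu1 : inner ℂ ξ (τ 1 η) = 1 := by rw [k]; simp [hζ]
  have := k (rankOne ℂ ξ' η')
  rw [hc] at this
  simp only [rankOne_apply, inner_smul_right] at this
  have h3 := mul_ne_zero z1 z2
  rw [← this] at h3
  exact ⟨ξ, η, contr_right hu k1 k2 hu1, contr_left hu k1 k2 hu1, right_ne_zero_of_mul h3,
    left_ne_zero_of_mul h3⟩

lemma Good.unitary {τ : (H →L[ℂ] H) →ₗ[ℂ] (H →L[ℂ] H)} (hτ : Good τ) :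
    (∀ v, (τ 1).adjoint (τ 1 v) = v) ∧ (∀ v, τ 1 ((τ 1).adjoint v) = v) := by
  refine ⟨fun v => ?_, fun v => ?_⟩
  · by_contra hne
    have hv : v - (τ 1).adjoint (τ 1 v) ≠ 0 := sub_ne_zero.mpr (Ne.symm hne)
    obtain ⟨w, r, hw, er⟩ := exists_normalize (w0 := ((‖v - (τ 1).adjoint (τ 1 v)‖⁻¹ : ℝ) : ℂ) • (v - (τ 1).adjoint (τ 1 v)))
      (by have := norm_ne_zero_iff.mpr hv
          rw [norm_smul, Complex.norm_real, Real.norm_of_nonneg (by positivity)]; field_simp)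
      (v - (τ 1).adjoint (τ 1 v))
    obtain ⟨ξ, η, a1, a2, a3, a4⟩ := hτ.unit_aux hw hw
    have : inner ℂ (v - (τ 1).adjoint (τ 1 v)) η = 0 := by
      rw [inner_sub_left, ContinuousLinearMap.adjoint_inner_left, a1,
        ← ContinuousLinearMap.adjoint_inner_right, a2, sub_self]
    rw [er, inner_smul_left] at this
    rcases mul_eq_zero.mp this with h | h
    · simp at h; rw [h] at er; simp at er; exact hv er
    · exact a4 h
  · by_contra hne
    have hv : v - τ 1 ((τ 1).adjoint v) ≠ 0 := sub_ne_zero.mpr (Ne.symm hne)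
    obtain ⟨w, r, hw, er⟩ := exists_normalize (w0 := ((‖v - τ 1 ((τ 1).adjoint v)‖⁻¹ : ℝ) : ℂ) • (v - τ 1 ((τ 1).adjoint v)))
      (by have := norm_ne_zero_iff.mpr hv
          rw [norm_smul, Complex.norm_real, Real.norm_of_nonneg (by positivity)]; field_simp)
      (v - τ 1 ((τ 1).adjoint v))
    obtain ⟨ξ, η, a1, a2, a3, a4⟩ := hτ.unit_aux hw hw
    have : inner ℂ ξ (v - τ 1 ((τ 1).adjoint v)) = 0 := by
      rw [inner_sub_right, ← ContinuousLinearMap.adjoint_inner_left, a2,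
        ContinuousLinearMap.adjoint_inner_right, a1, sub_self]
    rw [er, inner_smul_right] at this
    rcases mul_eq_zero.mp this with h | h
    · simp at h; rw [h] at er; simp at er; exact hv er
    · exact a3 h

/-- `T` has either trivial kernel or trivial cokernel -/
def Full (T : H →L[ℂ] H) : Prop := ∀ ξ η : H, ‖ξ‖ = 1 → ‖η‖ = 1 → T η = 0 → T.adjoint ξ = 0 → False

lemma Good.full {τ : (H →L[ℂ] H) →ₗ[ℂ] (H →L[ℂ] H)} (hτ : Good τ) {T : H →L[ℂ] H} (hT : ‖T‖ ≤ 1)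
    (hF : Full T) : Full (τ T) := by
  intro ξ η hξ hη h1 h2
  obtain ⟨ξ', η', k1, k2, e⟩ := hτ.dual ξ η hξ hη
  have hc := hτ.rank_one hξ hη k1 k2 e
  have n1 : ‖rankOne ℂ ξ' η' + T‖ ≤ 1 := by
    rw [← hτ.iso, map_add, hc]
    exact orth_est_le hξ hη h1 h2 (by rwa [hτ.iso])
  have n2 : ‖rankOne ℂ ξ' η' - T‖ ≤ 1 := by
    rw [← hτ.iso, map_sub, hc, sub_eq_add_neg]
    exact orth_est_le hξ hη (by rw [neg_apply, h1, neg_zero])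
      (by rw [map_neg, neg_apply, h2, neg_zero]) (by rwa [norm_neg, hτ.iso])
  refine hF ξ' η' k1 k2 ?_ ?_
  · refine zero_of_par (u := ξ') k1 ?_ ?_
    · have := (rankOne ℂ ξ' η' + T).le_opNorm η'
      rw [add_apply, rankOne_apply, inner_self_eq_norm_sq_to_K, k2] at this
      simp at this
      linarith
    · have := (rankOne ℂ ξ' η' - T).le_opNorm η'
      rw [sub_apply, rankOne_apply, inner_self_eq_norm_sq_to_K, k2] at this
      simp at this
      linarith
  · refine zero_of_par (u := η') k2 ?_ ?_
    · have := (rankOne ℂ ξ' η' + T).adjoint.le_opNorm ξ'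
      rw [LinearIsometryEquiv.norm_map, map_add, add_apply, adjoint_rankOne, rankOne_apply, inner_self_eq_norm_sq_to_K, k1] at this
      simp at this
      linarith
    · have := (rankOne ℂ ξ' η' - T).adjoint.le_opNorm ξ'
      rw [LinearIsometryEquiv.norm_map, map_sub, sub_apply, adjoint_rankOne, rankOne_apply, inner_self_eq_norm_sq_to_K, k1] at this
      simp at this
      linarith

lemma Good.rank_one' {τ : (H →L[ℂ] H) →ₗ[ℂ] (H →L[ℂ] H)} (hτ : Good τ) {ξ' η' : H}
    (hξ' : ‖ξ'‖ = 1) (hη' : ‖η'‖ = 1) : ∃ ξ η : H, ‖ξ‖ = 1 ∧ ‖η‖ = 1 ∧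
      τ (rankOne ℂ ξ' η') = rankOne ℂ ξ η := by
  obtain ⟨ξ, η, h1, h2, e⟩ := hτ.codual ξ' η' hξ' hη'
  exact ⟨ξ, η, h1, h2, hτ.rank_one h1 h2 hξ' hη' e⟩

end gd

section bh
variable {H : Type*} [NormedAddCommGroup H] [InnerProductSpace ℂ H] [CompleteSpace H]

/-- weak operator compactness -/
lemma weak_limit {ι : Type*} (U : Ultrafilter ι) (As : ι → H →L[ℂ] H) {C : ℝ} (hC : ∀ i, ‖As i‖ ≤ C) :
    ∃ A : H →L[ℂ] H, ∀ v w, Filter.Tendsto (fun i => inner ℂ v (As i w)) U (nhds (inner ℂ v (A w))) := by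
  have bd : ∀ v w i, ‖inner ℂ v (As i w)‖ ≤ C * ‖v‖ * ‖w‖ := by
    intro v w i
    calc ‖inner ℂ v (As i w)‖ ≤ ‖v‖ * ‖As i w‖ := norm_inner_le_norm _ _
      _ ≤ ‖v‖ * (‖As i‖ * ‖w‖) := by gcongr; exact (As i).le_opNorm w
      _ ≤ ‖v‖ * (C * ‖w‖) := by gcongr; exact hC i
      _ = _ := by ring
  have ex : ∀ v w : H, ∃ z : ℂ, ‖z‖ ≤ C * ‖v‖ * ‖w‖ ∧ Filter.Tendsto (fun i => inner ℂ v (As i w)) U (nhds z) := by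
    intro v w
    obtain ⟨z, hz, hz2⟩ := (isCompact_closedBall (0 : ℂ) (C * ‖v‖ * ‖w‖)).ultrafilter_le_nhds
      (U.map (fun i => inner ℂ v (As i w))) (by
        rw [Filter.le_principal_iff]
        exact Filter.mem_map.mpr (Filter.univ_mem' fun i => by simpa using bd v w i))
    exact ⟨z, by simpa using hz, hz2⟩
  choose L hL1 hL2 using ex
  let B : H →ₗ⋆[ℂ] H →ₗ[ℂ] ℂ := LinearMap.mk₂'ₛₗ _ _ L
    (fun a b w => tendsto_nhds_unique (hL2 _ _) (by
      simpa only [inner_add_left] using (hL2 a w).add (hL2 b w)))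
    (fun c a w => tendsto_nhds_unique (hL2 _ _) (by
      simpa only [inner_smul_left, smul_eq_mul] using (hL2 a w).const_mul (starRingEnd ℂ c)))
    (fun a b w => tendsto_nhds_unique (hL2 _ _) (by
      simpa only [map_add, inner_add_right] using (hL2 a b).add (hL2 a w)))
    (fun c a w => tendsto_nhds_unique (hL2 _ _) (by
      simpa only [map_smul, inner_smul_right, smul_eq_mul, RingHom.id_apply] using (hL2 a w).const_mul c))
  let B' : H →L⋆[ℂ] H →L[ℂ] ℂ := B.mkContinuous₂ C (fun v w => hL1 v w)
  refine ⟨(continuousLinearMapOfBilin B').adjoint, fun v w => ?_⟩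
  rw [ContinuousLinearMap.adjoint_inner_right, continuousLinearMapOfBilin_apply]
  exact hL2 v w

/-- unital isometry with the properties inherited from `Good` maps -/
structure Nice (Ψ : (H →L[ℂ] H) →ₗ[ℂ] (H →L[ℂ] H)) : Prop where
  iso : ∀ T, ‖Ψ T‖ = ‖T‖
  one : Ψ 1 = 1
  rk : ∀ ξ' η' : H, ‖ξ'‖ = 1 → ‖η'‖ = 1 → ∃ ξ η : H, ‖ξ‖ = 1 ∧ ‖η‖ = 1 ∧
      Ψ (rankOne ℂ ξ' η') = rankOne ℂ ξ η
  full : ∀ T, ‖T‖ ≤ 1 → Full T → Full (Ψ T)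

lemma Nice.inj {Ψ : (H →L[ℂ] H) →ₗ[ℂ] (H →L[ℂ] H)} (h : Nice Ψ) {T : H →L[ℂ] H} (hT : Ψ T = 0) : T = 0 := by
  rw [← norm_eq_zero, ← h.iso, hT, norm_zero]

lemma Nice.proj {Ψ : (H →L[ℂ] H) →ₗ[ℂ] (H →L[ℂ] H)} (h : Nice Ψ) {e : H} (he : ‖e‖ = 1) :
    ∃ f : H, ‖f‖ = 1 ∧ Ψ (rankOne ℂ e e) = rankOne ℂ f f := by
  obtain ⟨ξ, η, h1, h2, e1⟩ := h.rk e e he he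
  have n1 : ‖(2 : ℂ) • rankOne ℂ e e - 1‖ ≤ 1 := by
    refine ContinuousLinearMap.opNorm_le_bound _ zero_le_one fun v => ?_
    have : ((2 : ℂ) • rankOne ℂ e e - 1) v = (2 * inner ℂ e v) • e - v := by
      simp [smul_smul]
    rw [this, refl_norm he, one_mul]
  rw [← h.iso, map_sub, map_smul, h.one, e1] at n1
  have n2 := ((2 : ℂ) • rankOne ℂ ξ η - 1).le_opNorm η
  have e2 : ((2 : ℂ) • rankOne ℂ ξ η - 1) η = ((2 : ℝ) : ℂ) • ξ - η := by
    simp [h2]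
  rw [e2, h2] at n2
  have n3 := norm_sq_sub_re (((2 : ℝ) : ℂ) • ξ) η
  rw [inner_smul_left, Complex.conj_ofReal, Complex.re_ofReal_mul, norm_smul, h1, h2, Complex.norm_real] at n3
  have n4 : ‖((2 : ℝ) : ℂ) • ξ - η‖ ^ 2 ≤ 1 := by
    refine pow_le_one₀ (norm_nonneg _) (by linarith)
  have : ξ = η := by
    refine eq_of_inner_one h1.le h2.le ?_
    rw [n3] at n4
    norm_num at n4
    linarith
  exact ⟨η, h2, by rw [e1, this]⟩

lemma Nice.orth {Ψ : (H →L[ℂ] H) →ₗ[ℂ] (H →L[ℂ] H)} (h : Nice Ψ) {e e' f f' : H} (he : ‖e‖ = 1) (he' : ‖e'‖ = 1)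
    (hf : ‖f‖ = 1) (hf' : ‖f'‖ = 1) (h1 : Ψ (rankOne ℂ e e) = rankOne ℂ f f)
    (h2 : Ψ (rankOne ℂ e' e') = rankOne ℂ f' f') (ho : inner ℂ e' e = 0) : inner ℂ f' f = 0 := by
  have n1 : ‖rankOne ℂ e e + rankOne ℂ e' e'‖ ≤ 1 := by
    refine orth_est_le he he ?_ ?_ ?_
    · simp [ho]
    · simp [ho]
    · simp [he']
  rw [← h.iso, map_add, h1, h2] at n1
  have n2 := (rankOne ℂ f f + rankOne ℂ f' f').le_opNorm f
  have e2 : (rankOne ℂ f f + rankOne ℂ f' f') f = f + inner ℂ f' f • f' := by simp [hf]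
  rw [e2, hf] at n2
  have n3 := norm_sq_add_re f (inner ℂ f' f • f')
  rw [inner_smul_right, ← inner_conj_symm f f', Complex.mul_conj', norm_smul, hf, hf', ← Complex.ofReal_pow,
    Complex.ofReal_re] at n3
  have n4 : ‖f + inner ℂ f' f • f'‖ ^ 2 ≤ 1 := pow_le_one₀ (norm_nonneg _) (by linarith)
  have : ‖inner ℂ f' f‖ ^ 2 ≤ 0 := by nlinarith
  rw [← norm_eq_zero]
  exact pow_eq_zero_iff (two_ne_zero) |>.mp (le_antisymm this (sq_nonneg _))

/-- compression lemma -/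
lemma Nice.compr {Ψ : (H →L[ℂ] H) →ₗ[ℂ] (H →L[ℂ] H)} (h : Nice Ψ) {P A : H →L[ℂ] H}
    (hP1 : ∀ v, P (P v) = P v) (hP2 : ∀ v w, inner ℂ (P v) w = inner ℂ v (P w))
    (hPA : ∀ v, P (A (P v)) = 0) {ζ : H} (hζ : Ψ P ζ = ζ) : inner ℂ ζ (Ψ A ζ) = 0 := by
  by_cases hζ0 : ζ = 0
  · simp [hζ0]
  wlog hn : ‖ζ‖ = 1 generalizing ζ
  · have h0 : ‖ζ‖ ≠ 0 := norm_ne_zero_iff.mpr hζ0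
    have := this (ζ := ((‖ζ‖⁻¹ : ℝ) : ℂ) • ζ) (by rw [map_smul, hζ]) (by
      refine smul_ne_zero ?_ hζ0
      exact_mod_cast inv_ne_zero h0) (by
      rw [norm_smul, Complex.norm_real, Real.norm_of_nonneg (by positivity)]; field_simp)
    rw [map_smul, inner_smul_left, inner_smul_right] at this
    have h3 : ((‖ζ‖⁻¹ : ℝ) : ℂ) ≠ 0 := by exact_mod_cast inv_ne_zero h0
    simpa [h3, h0, hζ0] using this
  set M := ‖A‖ with hM
  have hM0 : 0 ≤ M := norm_nonneg _
  have est : ∀ t : ℂ, ‖P + t • A‖ ≤ Real.sqrt (1 + 2 * ‖t‖ ^ 2 * M ^ 2) := by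
    intro t
    have pos : 0 ≤ 1 + 2 * ‖t‖ ^ 2 * M ^ 2 := by positivity
    refine le_of_sq_bound _ (Real.sqrt_nonneg _) fun v => ?_
    rw [Real.sq_sqrt pos]
    have pyth : ∀ w, ‖w‖ ^ 2 = ‖P w‖ ^ 2 + ‖w - P w‖ ^ 2 := by
      intro w
      have := norm_sq_add_re (P w) (w - P w)
      rw [hP2, map_sub, hP1, sub_self, inner_zero_right] at this
      simpa using this
    have e1 : P ((P + t • A) v) = P v + t • P (A (v - P v)) := by
      simp [map_sub, hP1, hPA]
    have e2 : (P + t • A) v - P ((P + t • A) v) = t • (A v - P (A v)) := by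
      simp [hP1, smul_sub]
    have b1 : ‖P v + t • P (A (v - P v))‖ ≤ ‖P v‖ + ‖t‖ * (M * ‖v - P v‖) := by
      refine (norm_add_le _ _).trans ?_
      rw [norm_smul]
      gcongr
      have c1 : ‖P (A (v - P v))‖ ≤ ‖A (v - P v)‖ := by
        have := pyth (A (v - P v))
        exact (sq_le_sq₀ (norm_nonneg _) (norm_nonneg _)).mp (by nlinarith [sq_nonneg ‖A (v - P v) - P (A (v - P v))‖])
      exact c1.trans (A.le_opNorm _)
    have b2 : ‖t • (A v - P (A v))‖ ≤ ‖t‖ * (M * ‖v‖) := by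
      rw [norm_smul]
      gcongr
      have c1 : ‖A v - P (A v)‖ ≤ ‖A v‖ := by
        have := pyth (A v)
        exact (sq_le_sq₀ (norm_nonneg _) (norm_nonneg _)).mp (by nlinarith [sq_nonneg ‖P (A v)‖])
      exact c1.trans (A.le_opNorm _)
    rw [pyth ((P + t • A) v), e2, e1]
    have b3 := pow_le_pow_left₀ (norm_nonneg _) b1 2
    have b4 := pow_le_pow_left₀ (norm_nonneg _) b2 2
    have p := pyth v
    nlinarith [sq_nonneg (‖t‖ * M * ‖P v‖ - ‖v - P v‖)]
  set μ := inner ℂ ζ (Ψ A ζ) with hμ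
  have key : ∀ t : ℂ, ‖1 + t * μ‖ ^ 2 ≤ 1 + 2 * ‖t‖ ^ 2 * M ^ 2 := by
    intro t
    have k1 := inner_apply_norm_le (Ψ (P + t • A)) hn hn
    rw [h.iso] at k1
    have k2 : inner ℂ ζ (Ψ (P + t • A) ζ) = 1 + t * μ := by
      rw [map_add, map_smul, add_apply, smul_apply, hζ, inner_add_right, inner_smul_right,
        inner_self_eq_norm_sq_to_K, hn]; simp [hμ]
    rw [k2] at k1
    have := pow_le_pow_left₀ (norm_nonneg _) (k1.trans (est t)) 2
    rwa [Real.sq_sqrt (by positivity)] at this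
  set s : ℝ := (2 * (M ^ 2 + 1))⁻¹ with hs
  have hs0 : 0 < s := by positivity
  have hs1 : s * (2 * (M ^ 2 + 1)) = 1 := by rw [hs]; field_simp
  have k := key ((s : ℂ) * starRingEnd ℂ μ)
  rw [mul_assoc, Complex.conj_mul', norm_mul, Complex.norm_real, RCLike.norm_conj,
    Real.norm_of_nonneg hs0.le] at k
  have e3 : (1 : ℂ) + (s : ℂ) * (‖μ‖ : ℂ) ^ 2 = ((1 + s * ‖μ‖ ^ 2 : ℝ) : ℂ) := by push_cast; ring
  rw [e3, Complex.norm_real, Real.norm_of_nonneg (by positivity)] at k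
  by_contra hne
  have hμ0 : 0 < ‖μ‖ := norm_pos_iff.mpr hne
  have q : 0 < s * ‖μ‖ ^ 2 := by positivity
  have : 2 * (s * ‖μ‖ ^ 2) ≤ (s * ‖μ‖ ^ 2) * (s * (2 * M ^ 2)) := by nlinarith [sq_nonneg (s * ‖μ‖ ^ 2)]
  nlinarith

end bh

section bh2
variable {H : Type*} [NormedAddCommGroup H] [InnerProductSpace ℂ H] [CompleteSpace H]

lemma Nice.entry {Ψ : (H →L[ℂ] H) →ₗ[ℂ] (H →L[ℂ] H)} (h : Nice Ψ) {ι : Type*} {e f : ι → H}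
    (he : Orthonormal ℂ e) (hf : Orthonormal ℂ f)
    (hef : ∀ i, Ψ (rankOne ℂ (e i) (e i)) = rankOne ℂ (f i) (f i)) {A : H →L[ℂ] H} (i j : ι)
    (h1 : inner ℂ (e i) (A (e i)) = 0) (h2 : inner ℂ (e i) (A (e j)) = 0)
    (h3 : inner ℂ (e j) (A (e i)) = 0) (h4 : inner ℂ (e j) (A (e j)) = 0) :
    inner ℂ (f i) (Ψ A (f j)) = 0 := by
  have ne := he.1
  have nf := hf.1
  by_cases hij : i = j
  · subst hij
    refine h.compr (P := rankOne ℂ (e i) (e i)) ?_ ?_ ?_ ?_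
    · intro v; simp [ne]
    · intro v w; simp [inner_smul_left, inner_smul_right, mul_comm]
    · intro v; simp [h1]
    · rw [hef]; simp [nf]
  have oe : inner ℂ (e i) (e j) = 0 := he.2 hij
  have oe' : inner ℂ (e j) (e i) = 0 := he.2 (Ne.symm hij)
  have of : inner ℂ (f i) (f j) = 0 := hf.2 hij
  have of' : inner ℂ (f j) (f i) = 0 := hf.2 (Ne.symm hij)
  have key : ∀ a b : ℂ, inner ℂ (a • f i + b • f j) (Ψ A (a • f i + b • f j)) = 0 := by
    intro a b
    refine h.compr (P := rankOne ℂ (e i) (e i) + rankOne ℂ (e j) (e j)) ?_ ?_ ?_ ?_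
    · intro v
      simp only [add_apply, rankOne_apply, inner_add_right, inner_smul_right, oe, oe',
        inner_self_eq_norm_sq_to_K, ne]
      simp
    · intro v w; simp [inner_smul_left, inner_smul_right, mul_comm, inner_add_left, inner_add_right]
    · intro v
      simp only [add_apply, rankOne_apply, inner_add_right, inner_smul_right, map_add, map_smul, h1, h2, h3, h4]
      simp
    · have e1 : Ψ (rankOne ℂ (e i) (e i) + rankOne ℂ (e j) (e j)) =
          rankOne ℂ (f i) (f i) + rankOne ℂ (f j) (f j) := by rw [map_add, hef, hef]
      rw [e1]
      simp only [add_apply, rankOne_apply, inner_add_right, inner_smul_right, of, of',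
        inner_self_eq_norm_sq_to_K, nf]
      simp
  have k1 := key 1 0
  have k2 := key 0 1
  have k3 := key 1 1
  have k4 := key 1 Complex.I
  simp only [one_smul, zero_smul, add_zero, zero_add, map_add, map_smul, inner_add_left, inner_add_right,
    inner_smul_left, inner_smul_right, Complex.conj_I] at k1 k2 k3 k4
  rw [k1, k2] at k3 k4
  have : Complex.I * (2 * inner ℂ (f i) (Ψ A (f j))) = 0 := by
    linear_combination k4 + Complex.I * k3
  simpa using this

lemma Nice.total {Ψ : (H →L[ℂ] H) →ₗ[ℂ] (H →L[ℂ] H)} (h : Nice Ψ) {ι : Type*} [Countable ι] {e f : ι → H}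
    (he : Orthonormal ℂ e) (hf : Orthonormal ℂ f)
    (hef : ∀ i, Ψ (rankOne ℂ (e i) (e i)) = rankOne ℂ (f i) (f i))
    (ht : ∀ v, (∀ i, inner ℂ (e i) v = 0) → v = 0) (v : H) (hv : ∀ i, inner ℂ (f i) v = 0) : v = 0 := by
  classical
  have ne := he.1
  have nf := hf.1
  haveI := Encodable.ofCountable ι
  obtain ⟨w, hw, c, hc, hc1⟩ := posSumOfEncodable zero_lt_one ι
  let Ψ' : (H →L[ℂ] H) →L[ℂ] (H →L[ℂ] H) := (LinearIsometry.mk Ψ h.iso).toContinuousLinearMap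
  have nrm : ∀ i, ‖(w i : ℂ) • rankOne ℂ (e i) (e i)‖ = w i := by
    intro i; rw [norm_smul, norm_rankOne, ne, Complex.norm_real, Real.norm_of_nonneg (hw i).le]; simp
  have hs : Summable fun i => (w i : ℂ) • rankOne ℂ (e i) (e i) :=
    Summable.of_norm (by simpa only [nrm] using hc.summable)
  set K : H →L[ℂ] H := ∑' i, (w i : ℂ) • rankOne ℂ (e i) (e i) with hK
  have hKs : HasSum (fun i => (w i : ℂ) • rankOne ℂ (e i) (e i)) K := hs.hasSum
  have hKn : ‖K‖ ≤ 1 := by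
    refine (norm_tsum_le_tsum_norm (by simpa only [nrm] using hc.summable)).trans ?_
    simp only [nrm]; rw [hc.tsum_eq]; exact hc1
  have hΨK : HasSum (fun i => (w i : ℂ) • rankOne ℂ (f i) (f i)) (Ψ K) := by
    have := hKs.mapL Ψ'
    have e1 : (fun i => (w i : ℂ) • rankOne ℂ (f i) (f i)) =
        fun i => Ψ' ((w i : ℂ) • rankOne ℂ (e i) (e i)) := by
      funext i
      rw [map_smul]
      show _ = (w i : ℂ) • Ψ (rankOne ℂ (e i) (e i))
      rw [hef]
    rw [e1]
    exact this
  have app : ∀ (g : ι → H) (T : H →L[ℂ] H), HasSum (fun i => (w i : ℂ) • rankOne ℂ (g i) (g i)) T →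
      ∀ x y, HasSum (fun i => (w i : ℂ) * (inner ℂ (g i) y * inner ℂ x (g i))) (inner ℂ x (T y)) := by
    intro g T hT x y
    have h1 := (hT.mapL (ContinuousLinearMap.apply ℂ H y)).mapL (innerSL ℂ x)
    simpa [inner_smul_right] using h1
  have hKF : Full K := by
    intro ξ η hξ hη h1 h2
    have : η = 0 := by
      refine ht _ fun j => ?_
      have s1 := app e K hKs (e j) η
      have s2 := s1.unique (hasSum_single j (fun i hi => by
        rw [he.2 (Ne.symm hi)]; simp))
      rw [h1, inner_zero_right] at s2
      have hwj : (w j : ℂ) ≠ 0 := by exact_mod_cast (hw j).ne'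
      simpa [ne, hwj] using s2.symm
    rw [this] at hη; simp at hη
  by_contra hv0
  obtain ⟨n, r, hn, er⟩ := exists_normalize (w0 := ((‖v‖⁻¹ : ℝ) : ℂ) • v)
      (by have := norm_ne_zero_iff.mpr hv0
          rw [norm_smul, Complex.norm_real, Real.norm_of_nonneg (by positivity)]; field_simp) v
  have hr : r ≠ 0 := by rintro rfl; simp at er; exact hv0 er
  have hn0 : ∀ i, inner ℂ (f i) n = 0 := by
    intro i
    have := hv i
    rw [er, inner_smul_right] at this
    simpa [hr] using this
  have hn0' : ∀ i, inner ℂ n (f i) = 0 := fun i => inner_eq_zero_symm.mp (hn0 i)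
  refine h.full K hKn hKF n n hn hn ?_ ?_
  · refine ext_inner_left ℂ fun x => ?_
    have := app f _ hΨK x n
    simp only [hn0, zero_mul, mul_zero] at this
    rw [inner_zero_right]
    exact this.unique hasSum_zero
  · refine ext_inner_right ℂ fun x => ?_
    rw [ContinuousLinearMap.adjoint_inner_left]
    have := app f _ hΨK n x
    simp only [hn0', zero_mul, mul_zero] at this
    rw [inner_zero_left]
    exact this.unique hasSum_zero

lemma op_ext_total {ι : Type*} {f : ι → H} (ht : ∀ v, (∀ i, inner ℂ (f i) v = 0) → v = 0)
    {D : H →L[ℂ] H} (hD : ∀ i j, inner ℂ (f i) (D (f j)) = 0) : D = 0 := by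
  have h1 : ∀ j, D (f j) = 0 := fun j => ht _ fun i => hD i j
  have h2 : D.adjoint = 0 := by
    ext v
    refine ht _ fun i => ?_
    rw [ContinuousLinearMap.adjoint_inner_right, h1, inner_zero_left]
  simpa using h2

/-- preimages of matrix units -/
lemma Nice.units {Ψ : (H →L[ℂ] H) →ₗ[ℂ] (H →L[ℂ] H)} (h : Nice Ψ) {ι : Type*} {e f : ι → H}
    (he : Orthonormal ℂ e) (hf : Orthonormal ℂ f)
    (hef : ∀ i, Ψ (rankOne ℂ (e i) (e i)) = rankOne ℂ (f i) (f i))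
    (htf : ∀ v, (∀ i, inner ℂ (f i) v = 0) → v = 0) (i j : ι) :
    ∃ A : H →L[ℂ] H, Ψ A = rankOne ℂ (f i) (f j) ∧
      ∀ k l, ¬ (i ∈ ({k, l} : Set ι) ∧ j ∈ ({k, l} : Set ι)) → inner ℂ (e k) (A (e l)) = 0 := by
  by_cases hij : i = j
  · subst hij
    refine ⟨_, hef i, fun k l hkl => ?_⟩
    have hk : i ≠ k := by rintro rfl; simp at hkl
    simp [he.2 hk, he.2 (Ne.symm hk)]
  have ent : ∀ a b : ℂ, ∀ k l, ¬ (i ∈ ({k, l} : Set ι) ∧ j ∈ ({k, l} : Set ι)) →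
      inner ℂ (e k) ((a • rankOne ℂ (e i) (e j) + b • rankOne ℂ (e j) (e i)) (e l)) = 0 := by
    intro a b k l hkl
    have c1 : inner ℂ (e k) (e i) = 0 ∨ inner ℂ (e j) (e l) = 0 := by
      by_contra hc
      push Not at hc
      have e1 : k = i := by by_contra hh; exact hc.1 (he.2 hh)
      have e2 : j = l := by by_contra hh; exact hc.2 (he.2 hh)
      subst e1; subst e2; simp at hkl
    have c2 : inner ℂ (e k) (e j) = 0 ∨ inner ℂ (e i) (e l) = 0 := by
      by_contra hc
      push Not at hc
      have e1 : k = j := by by_contra hh; exact hc.1 (he.2 hh)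
      have e2 : i = l := by by_contra hh; exact hc.2 (he.2 hh)
      subst e1; subst e2; simp at hkl
    simp only [add_apply, smul_apply, rankOne_apply, inner_add_right, inner_smul_right]
    rcases c1 with c1 | c1 <;> rcases c2 with c2 | c2 <;> simp [c1, c2]
  have entf : ∀ a b : ℂ, ∀ k l, ¬ (i ∈ ({k, l} : Set ι) ∧ j ∈ ({k, l} : Set ι)) →
      inner ℂ (f k) (Ψ (a • rankOne ℂ (e i) (e j) + b • rankOne ℂ (e j) (e i)) (f l)) = 0 := by
    intro a b k l hkl
    refine h.entry he hf hef k l (ent a b _ _ ?_) (ent a b _ _ ?_) (ent a b _ _ ?_) (ent a b _ _ ?_)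
    · rintro ⟨p, q⟩; exact hkl ⟨by simp at p; simp [p], by simp at q; simp [q]⟩
    · exact hkl
    · rw [Set.pair_comm]; exact hkl
    · rintro ⟨p, q⟩; exact hkl ⟨by simp at p; simp [p], by simp at q; simp [q]⟩
  let Lm : ℂ × ℂ →ₗ[ℂ] ℂ × ℂ :=
    { toFun := fun p =>
        (inner ℂ (f i) (Ψ (p.1 • rankOne ℂ (e i) (e j) + p.2 • rankOne ℂ (e j) (e i)) (f j)),
         inner ℂ (f j) (Ψ (p.1 • rankOne ℂ (e i) (e j) + p.2 • rankOne ℂ (e j) (e i)) (f i)))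
      map_add' := fun p q => by
        simp only [Prod.fst_add, Prod.snd_add, add_smul, map_add, add_apply, inner_add_right, Prod.mk_add_mk,
          Prod.mk.injEq]
        constructor <;> ring
      map_smul' := fun c p => by
        simp only [Prod.smul_fst, Prod.smul_snd, smul_eq_mul, mul_smul, map_add, map_smul, add_apply, smul_apply,
          inner_add_right, inner_smul_right, Prod.smul_mk, RingHom.id_apply, Prod.mk.injEq]
        constructor <;> ring }
  have twocase : ∀ k l, (i ∈ ({k, l} : Set ι) ∧ j ∈ ({k, l} : Set ι)) → (k = i ∧ l = j) ∨ (k = j ∧ l = i) := by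
    rintro k l ⟨p, q⟩
    simp at p q
    rcases p with p | p <;> rcases q with q | q
    · exact absurd (p.trans q.symm) hij
    · exact Or.inl ⟨p.symm, q.symm⟩
    · exact Or.inr ⟨q.symm, p.symm⟩
    · exact absurd (p.trans q.symm) hij
  have hinj : Function.Injective Lm := by
    rw [injective_iff_map_eq_zero]
    rintro ⟨a, b⟩ hab
    have hab' := Prod.ext_iff.mp hab
    obtain ⟨ha, hb⟩ : inner ℂ (f i) (Ψ (a • rankOne ℂ (e i) (e j) + b • rankOne ℂ (e j) (e i)) (f j)) = 0 ∧
      inner ℂ (f j) (Ψ (a • rankOne ℂ (e i) (e j) + b • rankOne ℂ (e j) (e i)) (f i)) = 0 := hab'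
    have z : Ψ (a • rankOne ℂ (e i) (e j) + b • rankOne ℂ (e j) (e i)) = 0 := by
      refine op_ext_total htf fun k l => ?_
      by_cases hkl : (i ∈ ({k, l} : Set ι) ∧ j ∈ ({k, l} : Set ι))
      · rcases twocase k l hkl with ⟨rfl, rfl⟩ | ⟨rfl, rfl⟩
        · exact ha
        · exact hb
      · exact entf a b k l hkl
    have z2 := h.inj z
    have z3 := congrArg (fun T : H →L[ℂ] H => inner ℂ (e i) (T (e j))) z2
    have z4 := congrArg (fun T : H →L[ℂ] H => inner ℂ (e j) (T (e i))) z2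
    simp [he.1, he.2 hij, he.2 (Ne.symm hij), inner_add_right, inner_smul_right] at z3 z4
    rw [z3, z4]; rfl
  obtain ⟨⟨a, b⟩, hab⟩ := (LinearMap.injective_iff_surjective.mp hinj) (1, 0)
  have hab' := Prod.ext_iff.mp hab
  obtain ⟨ha, hb⟩ : inner ℂ (f i) (Ψ (a • rankOne ℂ (e i) (e j) + b • rankOne ℂ (e j) (e i)) (f j)) = 1 ∧
      inner ℂ (f j) (Ψ (a • rankOne ℂ (e i) (e j) + b • rankOne ℂ (e j) (e i)) (f i)) = 0 := hab'
  refine ⟨a • rankOne ℂ (e i) (e j) + b • rankOne ℂ (e j) (e i), ?_, ent a b⟩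
  rw [← sub_eq_zero]
  refine op_ext_total htf fun k l => ?_
  rw [sub_apply, inner_sub_right]
  by_cases hkl : (i ∈ ({k, l} : Set ι) ∧ j ∈ ({k, l} : Set ι))
  · rcases twocase k l hkl with ⟨rfl, rfl⟩ | ⟨rfl, rfl⟩
    · rw [ha]; simp [hf.1]
    · rw [hb]; simp [hf.2 hij, hf.2 (Ne.symm hij)]
  · rw [entf a b k l hkl]
    have : inner ℂ (f k) (f i) = 0 ∨ inner ℂ (f j) (f l) = 0 := by
      by_contra hc
      push Not at hc
      have e1 : k = i := by by_contra hh; exact hc.1 (hf.2 hh)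
      have e2 : j = l := by by_contra hh; exact hc.2 (hf.2 hh)
      subst e1; subst e2; simp at hkl
    rw [rankOne_apply, inner_smul_right]
    rcases this with c | c <;> rw [c] <;> simp

theorem Nice.surj' {Ψ : (H →L[ℂ] H) →ₗ[ℂ] (H →L[ℂ] H)} (h : Nice Ψ) {ι : Type*} {e f : ι → H}
    (he : Orthonormal ℂ e) (hf : Orthonormal ℂ f)
    (hef : ∀ i, Ψ (rankOne ℂ (e i) (e i)) = rankOne ℂ (f i) (f i))
    (htf : ∀ v, (∀ i, inner ℂ (f i) v = 0) → v = 0) : Function.Surjective Ψ := by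
  classical
  intro B
  choose A hA1 hA2 using fun i j => h.units he hf hef htf i j
  let As : Finset ι → H →L[ℂ] H := fun s => ∑ i ∈ s, ∑ j ∈ s, inner ℂ (f i) (B (f j)) • A i j
  have hAs : ∀ s, As s = ∑ i ∈ s, ∑ j ∈ s, inner ℂ (f i) (B (f j)) • A i j := fun s => rfl
  let Q : Finset ι → H →L[ℂ] H := fun s => ∑ i ∈ s, rankOne ℂ (f i) (f i)
  have hQ : ∀ s v, Q s v = ∑ i ∈ s, inner ℂ (f i) v • f i := fun s v => by simp [Q]
  have hQn : ∀ s, ‖Q s‖ ≤ 1 := by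
    intro s
    refine le_of_sq_bound _ zero_le_one fun v => ?_
    have e1 : ‖Q s v‖ ^ 2 = ∑ i ∈ s, ‖inner ℂ (f i) v‖ ^ 2 := by
      have : ((‖Q s v‖ ^ 2 : ℝ) : ℂ) = ((∑ i ∈ s, ‖inner ℂ (f i) v‖ ^ 2 : ℝ) : ℂ) := by
        push_cast
        have t := inner_self_eq_norm_sq_to_K (𝕜 := ℂ) (Q s v)
        rw [hQ, hf.inner_sum] at t
        rw [hQ]
        refine Eq.trans (Eq.symm t) ?_
        exact Finset.sum_congr rfl fun i _ => Complex.conj_mul' _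
      exact_mod_cast this
    rw [e1, one_pow, one_mul]
    exact hf.sum_inner_products_le v
  have hΨ : ∀ s, Ψ (As s) = Q s ∘L B ∘L Q s := by
    intro s
    ext v
    rw [hAs, map_sum]
    simp only [map_sum, map_smul, hA1, ContinuousLinearMap.comp_apply, hQ, sum_apply, smul_apply, rankOne_apply]
    refine Finset.sum_congr rfl fun i _ => ?_
    rw [inner_sum, Finset.sum_smul]
    refine Finset.sum_congr rfl fun j _ => ?_
    rw [inner_smul_right, smul_smul, mul_comm]
  have hbd : ∀ s, ‖As s‖ ≤ ‖B‖ := by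
    intro s
    rw [← h.iso, hΨ]
    calc _ ≤ ‖Q s‖ * ‖B ∘L Q s‖ := ContinuousLinearMap.opNorm_comp_le _ _
      _ ≤ ‖Q s‖ * (‖B‖ * ‖Q s‖) := by gcongr; exact ContinuousLinearMap.opNorm_comp_le _ _
      _ ≤ 1 * (‖B‖ * 1) := by gcongr <;> exact hQn s
      _ = _ := by ring
  have hent : ∀ k l, ∀ s : Finset ι, k ∈ s → l ∈ s → ∀ p ∈ ({k, l} : Finset ι), ∀ q ∈ ({k, l} : Finset ι),
      inner ℂ (e p) (As s (e q)) = inner ℂ (e p) (As {k, l} (e q)) := by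
    intro k l s hk hl p hp q hq
    have sub : ({k, l} : Finset ι) ⊆ s := by
      intro x hx; simp at hx; rcases hx with rfl | rfl <;> assumption
    have van : ∀ i j, ¬ (i ∈ ({k, l} : Finset ι) ∧ j ∈ ({k, l} : Finset ι)) →
        inner ℂ (e p) (A i j (e q)) = 0 := by
      intro i j hij
      refine hA2 i j p q fun hh => hij ?_
      simp only [Finset.mem_insert, Finset.mem_singleton, Set.mem_insert_iff, Set.mem_singleton_iff] at *
      grind
    rw [hAs, hAs]
    simp only [sum_apply, smul_apply, inner_sum, inner_smul_right]
    symm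
    rw [← Finset.sum_subset sub]
    · refine Finset.sum_congr rfl fun i hi => ?_
      refine Finset.sum_subset sub fun j _ hj => ?_
      rw [van i j (fun hh => hj hh.2), mul_zero]
    · intro i _ hi
      refine Finset.sum_eq_zero fun j _ => ?_
      rw [van i j (fun hh => hi hh.1), mul_zero]
  haveI : (Filter.atTop : Filter (Finset ι)).NeBot := Filter.atTop_neBot
  obtain ⟨A', hA'⟩ := weak_limit (Ultrafilter.of (Filter.atTop : Filter (Finset ι))) As hbd
  have hlim : ∀ k l, ∀ p ∈ ({k, l} : Finset ι), ∀ q ∈ ({k, l} : Finset ι),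
      inner ℂ (e p) (A' (e q)) = inner ℂ (e p) (As {k, l} (e q)) := by
    intro k l p hp q hq
    refine tendsto_nhds_unique (hA' (e p) (e q)) ?_
    refine tendsto_const_nhds.congr' ?_
    refine (Ultrafilter.of_le (Filter.atTop : Filter (Finset ι))) ?_
    filter_upwards [Filter.eventually_ge_atTop ({k, l} : Finset ι)] with s hs
    exact (hent k l s (hs (by simp)) (hs (by simp)) p hp q hq).symm
  refine ⟨A', ?_⟩
  rw [← sub_eq_zero]
  refine op_ext_total htf fun k l => ?_
  have z := h.entry he hf hef (A := A' - As {k, l}) k l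
    (by rw [sub_apply, inner_sub_right, hlim k l k (by simp) k (by simp), sub_self])
    (by rw [sub_apply, inner_sub_right, hlim k l k (by simp) l (by simp), sub_self])
    (by rw [sub_apply, inner_sub_right, hlim k l l (by simp) k (by simp), sub_self])
    (by rw [sub_apply, inner_sub_right, hlim k l l (by simp) l (by simp), sub_self])
  rw [map_sub, sub_apply, inner_sub_right, sub_eq_zero] at z
  rw [sub_apply, inner_sub_right, z, hΨ, sub_eq_zero]
  have q1 : ∀ m ∈ ({k, l} : Finset ι), Q {k, l} (f m) = f m := by
    intro m hm
    rw [hQ, Finset.sum_eq_single m]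
    · simp [hf.1]
    · intro b _ hb; rw [hf.2 hb, zero_smul]
    · exact fun hh => absurd hm hh
  have q2 : ∀ v w, inner ℂ v (Q {k, l} w) = inner ℂ (Q {k, l} v) w := by
    intro v w
    rw [hQ, hQ, inner_sum, sum_inner]
    refine Finset.sum_congr rfl fun i _ => ?_
    rw [inner_smul_left, inner_smul_right, inner_conj_symm, mul_comm]
  simp only [ContinuousLinearMap.comp_apply]
  rw [q1 l (by simp), q2, q1 k (by simp)]

theorem Nice.surj [TopologicalSpace.SeparableSpace H] {Ψ : (H →L[ℂ] H) →ₗ[ℂ] (H →L[ℂ] H)} (h : Nice Ψ) :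
    Function.Surjective Ψ := by
  obtain ⟨w, b, hb⟩ := exists_hilbertBasis ℂ H
  have he := b.orthonormal
  have ht : ∀ v, (∀ i, inner ℂ (b i) v = 0) → v = 0 := by
    intro v hv
    have := b.hasSum_repr v
    simp only [b.repr_apply_apply, hv, zero_smul] at this
    exact this.unique hasSum_zero
  haveI : Countable w := by
    refine Pairwise.countable_of_isOpen_disjoint (s := fun i => Metric.ball (b i) (1 / 2)) ?_
      (fun i => Metric.isOpen_ball) (fun i => ⟨b i, by simp⟩)
    intro i j hij
    refine Metric.ball_disjoint_ball ?_
    rw [dist_eq_norm]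
    have := norm_sq_sub_re (b i) (b j)
    rw [he.2 hij, he.1, he.1] at this
    norm_num at this
    nlinarith [norm_nonneg (b i - b j)]
  choose f hf1 hf2 using fun i => h.proj (he.1 i)
  have hf : Orthonormal ℂ f := ⟨hf1, fun i j hij =>
    h.orth (he.1 j) (he.1 i) (hf1 j) (hf1 i) (hf2 j) (hf2 i) (he.2 hij)⟩
  exact h.surj' he hf hf2 (h.total he hf hf2 ht)

/-- reflexivity for `B(H)` -/
theorem good_refl [TopologicalSpace.SeparableSpace H] {σ : (H →L[ℂ] H) →ₗ[ℂ] (H →L[ℂ] H)}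
    (hσ : ∀ T, ∃ τ, Good τ ∧ σ T = τ T) : Function.Surjective σ := by
  obtain ⟨τ1, g1, e1⟩ := hσ 1
  obtain ⟨u1, u2⟩ := g1.unitary
  rw [← e1] at u1 u2
  set u := σ 1 with hu
  have hun : ‖u‖ ≤ 1 := by rw [e1, g1.iso]; exact ContinuousLinearMap.norm_id_le
  have hun' : ‖u.adjoint‖ ≤ 1 := by rwa [LinearIsometryEquiv.norm_map]
  have iso_u : ∀ v, ‖u v‖ = ‖v‖ := by
    intro v
    refine le_antisymm ((u.le_opNorm v).trans (mul_le_of_le_one_left (norm_nonneg _) hun)) ?_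
    conv_lhs => rw [← u1 v]
    exact (u.adjoint.le_opNorm _).trans (mul_le_of_le_one_left (norm_nonneg _) hun')
  have iso_u' : ∀ v, ‖u.adjoint v‖ = ‖v‖ := by
    intro v
    rw [← iso_u, u2]
  have hiso : ∀ T, ‖σ T‖ = ‖T‖ := by
    intro T
    obtain ⟨τ, g, e⟩ := hσ T
    rw [e, g.iso]
  let Ψ : (H →L[ℂ] H) →ₗ[ℂ] (H →L[ℂ] H) :=
    { toFun := fun T => u.adjoint ∘L σ T
      map_add' := fun a b => by rw [map_add, ContinuousLinearMap.comp_add]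
      map_smul' := fun c a => by rw [map_smul, ContinuousLinearMap.comp_smul]; rfl }
  have hΨ : ∀ T, Ψ T = u.adjoint ∘L σ T := fun T => rfl
  have nice : Nice Ψ := by
    refine ⟨fun T => ?_, ?_, fun ξ η hξ hη => ?_, fun T hT hF => ?_⟩
    · rw [hΨ, ← hiso T]
      apply le_antisymm
      · refine ContinuousLinearMap.opNorm_le_bound _ (norm_nonneg _) fun v => ?_
        rw [ContinuousLinearMap.comp_apply, iso_u']; exact (σ T).le_opNorm v
      · refine ContinuousLinearMap.opNorm_le_bound _ (norm_nonneg _) fun v => ?_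
        rw [← iso_u' (σ T v)]; exact (u.adjoint ∘L σ T).le_opNorm v
    · ext v
      rw [hΨ, ContinuousLinearMap.comp_apply, ← hu, u1]; rfl
    · obtain ⟨τ, g, e⟩ := hσ (rankOne ℂ ξ η)
      obtain ⟨ξ', η', h1, h2, h3⟩ := g.rank_one' hξ hη
      refine ⟨u.adjoint ξ', η', by rw [iso_u', h1], h2, ?_⟩
      rw [hΨ, e, h3, InnerProductSpace.comp_rankOne]
    · obtain ⟨τ, g, e⟩ := hσ T
      have hF2 := g.full hT hF
      intro ξ η hξ hη h1 h2
      rw [← e] at hF2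
      refine hF2 (u ξ) η (by rw [iso_u, hξ]) hη ?_ ?_
      · rw [← u2 (σ T η)]
        rw [hΨ, ContinuousLinearMap.comp_apply] at h1
        rw [h1, map_zero]
      · rw [hΨ, ContinuousLinearMap.adjoint_comp, ContinuousLinearMap.adjoint_adjoint] at h2
        exact h2
  intro B
  obtain ⟨A, hA⟩ := nice.surj (u.adjoint ∘L B)
  refine ⟨A, ?_⟩
  ext v
  rw [← u2 (σ A v), ← u2 (B v)]
  exact congrArg u (congrArg (fun T : H →L[ℂ] H => T v) hA)

end bh2

section fin
variable {H : Type*} [NormedAddCommGroup H] [InnerProductSpace ℂ H] [CompleteSpace H]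

structure Loc (Φ : C₀(ℝ, H →L[ℂ] H) →ₗ[ℂ] C₀(ℝ, H →L[ℂ] H)) : Prop where
  iso : ∀ f, ‖Φ f‖ = ‖f‖
  loc : ∀ f, ∃ θ : ℝ → ℝ, Function.Bijective θ ∧
      ∀ x, ∃ τ : (H →L[ℂ] H) →ₗ[ℂ] (H →L[ℂ] H), Good τ ∧ Φ f x = τ (f (θ x))

/-- isometry onto, pointwise -/
def IsU (u : H →L[ℂ] H) : Prop := ∀ v, ‖u v‖ = ‖v‖

lemma Good.isU {τ : (H →L[ℂ] H) →ₗ[ℂ] (H →L[ℂ] H)} (hτ : Good τ) : IsU (τ 1) := by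
  obtain ⟨u1, u2⟩ := hτ.unitary
  have hun : ‖τ 1‖ ≤ 1 := by rw [hτ.iso]; exact ContinuousLinearMap.norm_id_le
  have hunb : ‖(τ 1).adjoint‖ ≤ 1 := by rwa [LinearIsometryEquiv.norm_map]
  intro v
  refine le_antisymm (((τ 1).le_opNorm v).trans (mul_le_of_le_one_left (norm_nonneg _) hun)) ?_
  conv_lhs => rw [← u1 v]
  exact ((τ 1).adjoint.le_opNorm _).trans (mul_le_of_le_one_left (norm_nonneg _) hunb)

/-- if all `X + λ ρ u` are multiples of isometries, then `X` is a multiple of the unitary `u` -/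
lemma scalar_of_isU [Nontrivial H] {X u : H →L[ℂ] H} (hu : IsU u) (hu2 : ∀ v, u (u.adjoint v) = v) {ρ : ℝ} (hρ : ρ ≠ 0)
    (h : ∀ l : ℂ, ∃ (w : ℂ) (u' : H →L[ℂ] H), IsU u' ∧ X + (l * ρ) • u = w • u') : ∃ z : ℂ, X = z • u := by
  obtain ⟨v0, hv0⟩ : ∃ w : H, ‖w‖ = 1 := exists_norm_eq H zero_le_one
  have h' : ∀ l : ℂ, ∃ r : ℝ, ∀ v, ‖X v + (l * ρ) • u v‖ ^ 2 = r * ‖v‖ ^ 2 := by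
    intro l
    obtain ⟨w, u', h1, h2⟩ := h l
    refine ⟨‖w‖ ^ 2, fun v => ?_⟩
    have : X v + (l * ρ) • u v = w • u' v := by
      have := congrArg (fun T : H →L[ℂ] H => T v) h2
      simpa using this
    rw [this, norm_smul, h1]; ring
  obtain ⟨r0, h0⟩ := h' 0
  obtain ⟨r1, h1⟩ := h' 1
  obtain ⟨r2, h2⟩ := h' Complex.I
  have e0 : ∀ v, ‖X v‖ ^ 2 = r0 * ‖v‖ ^ 2 := fun v => by simpa using h0 v
  have e1 : ∀ v, (inner ℂ (u v) (X v)).re = ((r1 - r0 - ρ ^ 2) / (2 * ρ)) * ‖v‖ ^ 2 := by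
    intro v
    have := h1 v
    rw [norm_sq_add_re, e0, one_mul, inner_smul_right, ← inner_conj_symm, norm_smul, hu v, Complex.norm_real,
      Complex.re_ofReal_mul, Complex.conj_re, mul_pow, Real.norm_eq_abs, sq_abs] at this
    field_simp
    linarith
  have e2 : ∀ v, (inner ℂ (u v) (X v)).im = ((r2 - r0 - ρ ^ 2) / (2 * ρ)) * ‖v‖ ^ 2 := by
    intro v
    have := h2 v
    rw [norm_sq_add_re, e0, inner_smul_right, ← inner_conj_symm, norm_smul, hu v, norm_mul, Complex.norm_I,
      one_mul, Complex.norm_real, mul_pow, Real.norm_eq_abs, sq_abs] at this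
    simp at this
    have hi : (inner ℂ (X v) (u v)).im = -(inner ℂ (u v) (X v)).im := by
      rw [← inner_conj_symm, Complex.conj_im]
    rw [hi] at this
    field_simp
    linarith
  set z : ℂ := ⟨(r1 - r0 - ρ ^ 2) / (2 * ρ), (r2 - r0 - ρ ^ 2) / (2 * ρ)⟩ with hz
  have e3 : ∀ v, inner ℂ (u v) (X v) = z * ((‖v‖ ^ 2 : ℝ) : ℂ) := by
    intro v
    apply Complex.ext
    · rw [e1, Complex.re_mul_ofReal]
    · rw [e2, Complex.im_mul_ofReal]
  refine ⟨z, ?_⟩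
  have e4 : (u.adjoint ∘L X).toLinearMap = ((starRingEnd ℂ (starRingEnd ℂ z)) • (1 : H →L[ℂ] H)).toLinearMap := by
    rw [← ext_inner_map]
    intro v
    have := congrArg (starRingEnd ℂ) (e3 v)
    rw [inner_conj_symm] at this
    simp only [ContinuousLinearMap.coe_coe, ContinuousLinearMap.comp_apply]
    rw [ContinuousLinearMap.adjoint_inner_left, this]
    simp [inner_smul_left]
  ext v
  have e5 := congrArg (fun T : H →ₗ[ℂ] H => u (T v)) e4
  simp [hu2] at e5
  rw [e5]; simp

variable [Nontrivial H] {Φ : C₀(ℝ, H →L[ℂ] H) →ₗ[ℂ] C₀(ℝ, H →L[ℂ] H)}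

lemma Loc.scal (h : Loc Φ) (x : ℝ) (g : C₀(ℝ, ℂ)) : ∃ (y : ℝ) (u : H →L[ℂ] H), IsU u ∧ (∀ v, u (u.adjoint v) = v) ∧
    Φ (tens g 1) x = g y • u := by
  obtain ⟨θ, -, ht⟩ := h.loc (tens g 1)
  obtain ⟨τ, hτ, e⟩ := ht x
  exact ⟨θ x, τ 1, hτ.isU, hτ.unitary.2, by rw [e, tens_apply, map_smul]⟩

lemma tens_add (g g' : C₀(ℝ, ℂ)) (T : H →L[ℂ] H) : tens (g + g') T = tens g T + tens g' T := by
  ext1 t; simp [add_smul]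

lemma tens_smul (c : ℂ) (g : C₀(ℝ, ℂ)) (T : H →L[ℂ] H) : tens (c • g) T = c • tens g T := by
  ext1 t; simp [mul_smul]

lemma inj_quot {s t : ℝ} (h : s / (1 + |s|) = t / (1 + |t|)) : s = t := by
  have hs : 0 < 1 + |s| := by positivity
  have ht : 0 < 1 + |t| := by positivity
  rw [div_eq_div_iff hs.ne' ht.ne'] at h
  rcases le_total 0 s with a | a <;> rcases le_total 0 t with b | b
  · rw [abs_of_nonneg a, abs_of_nonneg b] at h; linarith
  · rw [abs_of_nonneg a, abs_of_nonpos b] at h; nlinarith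
  · rw [abs_of_nonpos a, abs_of_nonneg b] at h; nlinarith
  · rw [abs_of_nonpos a, abs_of_nonpos b] at h; linarith

lemma Loc.point (h : Loc Φ) (x : ℝ) : ∃ (t0 c : ℝ) (u : H →L[ℂ] H), 0 < c ∧ IsU u ∧
    ∀ g : C₀(ℝ, ℂ), (∀ t, (g t).im = 0) → Φ (tens g 1) x = ((c : ℂ) * g t0) • u := by
  obtain ⟨y0, u, hu, hu2, e0⟩ := h.scal x (pk 0)
  set ρ : ℝ := (1 + |y0 - 0|)⁻¹ with hρ
  have hρ0 : 0 < ρ := pk_pos 0 y0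
  rw [pk_apply, ← hρ] at e0
  have hu0 : u ≠ 0 := by
    rintro rfl
    obtain ⟨w, hw⟩ : ∃ w : H, ‖w‖ = 1 := exists_norm_eq H zero_le_one
    have := hu w
    simp [hw] at this
  have ex : ∀ g : C₀(ℝ, ℂ), ∃ z : ℂ, Φ (tens g 1) x = z • u := by
    intro g
    refine scalar_of_isU hu hu2 hρ0.ne' fun l => ?_
    obtain ⟨y, u', h1, -, h2⟩ := h.scal x (g + l • pk 0)
    refine ⟨(g + l • pk 0) y, u', h1, ?_⟩
    rw [← h2, tens_add, tens_smul, map_add, map_smul, ZeroAtInftyContinuousMap.add_apply,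
      ZeroAtInftyContinuousMap.smul_apply, e0, smul_smul]
  choose L hL using ex
  have uniq : ∀ {a b : ℂ}, a • u = b • u → a = b := fun hab => smul_left_injective ℂ hu0 hab
  have Lp : L (pk 0) = ρ := uniq (by rw [← hL, e0])
  have Ladd : ∀ g g', L (g + g') = L g + L g' := fun g g' => uniq (by
    rw [← hL, tens_add, map_add, ZeroAtInftyContinuousMap.add_apply, hL, hL, add_smul])
  have Lsmul : ∀ (c : ℂ) g, L (c • g) = c * L g := fun c g => uniq (by
    rw [← hL, tens_smul, map_smul, ZeroAtInftyContinuousMap.smul_apply, hL, smul_smul])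
  have L0 : ∀ g, L g = 0 → ∃ y, g y = 0 := by
    intro g hg
    obtain ⟨y, u', h1, -, h2⟩ := h.scal x g
    rw [hL, hg, zero_smul] at h2
    obtain ⟨w, hw⟩ : ∃ w : H, ‖w‖ = 1 := exists_norm_eq H zero_le_one
    have := congrArg (fun T : H →L[ℂ] H => ‖T w‖) h2
    simp [norm_smul, h1 w, hw] at this
    exact ⟨y, by simpa using this.symm⟩
  have key : ∀ g, ∃ y, L g * pk 0 y = ρ * g y := by
    intro g
    obtain ⟨y, hy⟩ := L0 ((ρ : ℂ) • g + (-(L g)) • pk 0) (by rw [Ladd, Lsmul, Lsmul, Lp]; ring)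
    refine ⟨y, ?_⟩
    rw [ZeroAtInftyContinuousMap.add_apply, ZeroAtInftyContinuousMap.smul_apply,
      ZeroAtInftyContinuousMap.smul_apply, smul_eq_mul, smul_eq_mul] at hy
    linear_combination -hy
  let g0 : C₀(ℝ, ℂ) := pkm 0 (fun t => t / (1 + |t|))
    (Continuous.div₀ continuous_id (by fun_prop) fun t => by positivity) (fun t => by
      rw [abs_div, div_le_one (by positivity), abs_of_pos (show (0 : ℝ) < 1 + |t| by positivity)]; linarith)
  have hg0 : ∀ t, g0 t = pk 0 t * ((t / (1 + |t|) : ℝ) : ℂ) := fun t => rfl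
  obtain ⟨t0, ht0⟩ := key g0
  have Lg0 : L g0 = ((ρ * (t0 / (1 + |t0|)) : ℝ) : ℂ) := by
    rw [hg0] at ht0
    apply mul_right_cancel₀ (pk_ne 0 t0)
    rw [ht0]; push_cast; ring
  set q : ℝ → ℝ := fun t => (1 + |t - 0|)⁻¹ with hq
  have hq0 : ∀ t, 0 < q t := fun t => pk_pos 0 t
  have hpq : ∀ t, pk 0 t = (q t : ℂ) := fun t => rfl
  refine ⟨t0, ρ / q t0, u, div_pos hρ0 (hq0 t0), hu, fun g hg => ?_⟩
  have hgre : ∀ t, g t = ((g t).re : ℂ) := fun t => Complex.ext (by simp) (by simp [hg t])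
  obtain ⟨y1, hy1⟩ := key g
  have Lim : (L g).im = 0 := by
    have := congrArg Complex.im hy1
    rw [hpq, hgre y1, ← Complex.ofReal_mul, Complex.im_mul_ofReal, Complex.ofReal_im] at this
    exact (mul_eq_zero.mp this).resolve_right (hq0 y1).ne'
  have Lre : L g = ((L g).re : ℂ) := Complex.ext (by simp) (by simp [Lim])
  obtain ⟨y, hy⟩ := key (g0 + Complex.I • g)
  rw [Ladd, Lsmul, ZeroAtInftyContinuousMap.add_apply, ZeroAtInftyContinuousMap.smul_apply, smul_eq_mul,
    hg0, hpq, Lg0, Lre, hgre] at hy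
  have hre := congrArg Complex.re hy
  have him := congrArg Complex.im hy
  simp only [Complex.add_re, Complex.add_im, Complex.mul_re, Complex.mul_im, Complex.ofReal_re, Complex.ofReal_im,
    Complex.I_re, Complex.I_im] at hre him
  have hyt : y = t0 := by
    apply inj_quot
    have a : ρ * q y ≠ 0 := (mul_pos hρ0 (hq0 y)).ne'
    apply mul_left_cancel₀ a
    nlinarith
  subst hyt
  rw [hL, Lre, hgre y]
  congr 1
  rw [← Complex.ofReal_mul]
  congr 1
  have := hq0 y
  field_simp
  nlinarith

/-- real analysis part -/
lemma real_part {c φ : ℝ → ℝ} (hc : ∀ x, 0 < c x)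
    (h : ∀ y, ∃ θ : ℝ → ℝ, Function.Bijective θ ∧ ∀ x, c x * (1 + |φ x - y|)⁻¹ = (1 + |θ x - y|)⁻¹) :
    (∀ x, c x = 1) ∧ Function.Bijective φ := by
  have pl : ∀ a : ℝ, 0 < (1 + |a|)⁻¹ ∧ (1 + |a|)⁻¹ ≤ 1 := fun a =>
    ⟨by positivity, inv_le_one_of_one_le₀ (by linarith [abs_nonneg a])⟩
  have p1 : ∀ a : ℝ, (1 + |a|)⁻¹ = 1 → a = 0 := by
    intro a ha
    have ha := inv_eq_one.mp ha
    exact abs_eq_zero.mp (by linarith)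
  have cle : ∀ x, c x ≤ 1 := by
    intro x
    obtain ⟨θ, -, e⟩ := h (φ x)
    have := e x
    simp at this
    rw [this]; exact (pl _).2
  have sur : ∀ y, ∃ x, c x = 1 ∧ φ x = y := by
    intro y
    obtain ⟨θ, hb, e⟩ := h y
    obtain ⟨x, hx⟩ := hb.2 y
    have e1 := e x
    rw [hx] at e1
    simp at e1
    have c1 : c x = 1 := le_antisymm (cle x) (by
      rw [← e1]; exact mul_le_of_le_one_right (hc x).le (pl _).2)
    rw [c1, one_mul] at e1
    exact ⟨x, c1, by linarith [p1 _ e1]⟩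
  have c1 : ∀ x, c x = 1 := by
    intro x
    by_contra hne
    have hlt : c x < 1 := lt_of_le_of_ne (cle x) hne
    set r := (c x)⁻¹ - 1 with hr
    have hr0 : 0 < r := by
      have := (one_lt_inv₀ (hc x)).mpr hlt
      linarith
    obtain ⟨θ, hb, e⟩ := h (φ x)
    obtain ⟨x1, a1, b1⟩ := sur (φ x + r)
    obtain ⟨x2, a2, b2⟩ := sur (φ x - r)
    have v : ∀ z, (1 + |θ z - φ x|)⁻¹ = c x → |θ z - φ x| = r := by
      intro z hz
      rw [hr, ← hz, inv_inv]; ring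
    have w0 := v x (by rw [← e x]; simp)
    have w1 := v x1 (by
      rw [← e x1, a1, b1, show φ x + r - φ x = r by ring, abs_of_pos hr0, hr]; simp)
    have w2 := v x2 (by
      rw [← e x2, a2, b2, show φ x - r - φ x = -r by ring, abs_neg, abs_of_pos hr0, hr]; simp)
    have i01 : θ x ≠ θ x1 := fun hh => by have := hb.1 hh; rw [← this] at b1; linarith
    have i02 : θ x ≠ θ x2 := fun hh => by have := hb.1 hh; rw [← this] at b2; linarith
    have i12 : θ x1 ≠ θ x2 := fun hh => by have := hb.1 hh; rw [← this] at b2; linarith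
    rcases (abs_eq hr0.le).mp w0 with q0 | q0 <;> rcases (abs_eq hr0.le).mp w1 with q1 | q1 <;>
      rcases (abs_eq hr0.le).mp w2 with q2 | q2
    all_goals first
      | exact i01 (by linarith)
      | exact i02 (by linarith)
      | exact i12 (by linarith)
  refine ⟨c1, fun x1 x2 h12 => ?_, fun y => ?_⟩
  · obtain ⟨θ, hb, e⟩ := h (φ x1)
    have e1 := e x1
    have e2 := e x2
    rw [c1] at e1 e2
    rw [← h12] at e2
    simp only [sub_self, abs_zero, add_zero, inv_one, mul_one] at e1 e2
    apply hb.1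
    linarith [p1 _ e1.symm, p1 _ e2.symm]
  · obtain ⟨x, -, hx⟩ := sur y
    exact ⟨x, hx⟩

lemma homeo_of_bij {φ : ℝ → ℝ} (hc : Continuous φ) (hb : Function.Bijective φ) : ∃ e : ℝ ≃ₜ ℝ, ∀ x, e x = φ x := by
  rcases hc.strictMono_of_inj hb.1 with hm | hm
  · exact ⟨(hm.orderIsoOfSurjective φ hb.2).toHomeomorph, fun x => rfl⟩
  · have hm' : StrictMono (fun x => -φ x) := fun a b hab => neg_lt_neg (hm hab)
    have hs : Function.Surjective (fun x => -φ x) := fun y => by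
      obtain ⟨x, hx⟩ := hb.2 (-y)
      exact ⟨x, by simp [hx]⟩
    exact ⟨(hm'.orderIsoOfSurjective _ hs).toHomeomorph.trans (Homeomorph.neg ℝ), fun x => neg_neg (φ x)⟩

lemma surj_tail {φ : ℝ → ℝ} {σ : ℝ → (H →L[ℂ] H) →ₗ[ℂ] (H →L[ℂ] H)}
    (hφc : Continuous φ) (E : ℝ ≃ₜ ℝ) (hE : ∀ x, E x = φ x)
    (hσ : ∀ f x, Φ f x = σ x (f (φ x))) (hσiso : ∀ x T, ‖σ x T‖ = ‖T‖)
    (hσsurj : ∀ x, Function.Surjective (σ x)) : Function.Surjective Φ := by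
  intro f
  choose k hk using fun x => hσsurj x (f x)
  have hkc : Continuous k := by
    rw [continuous_iff_continuousAt]
    intro x0
    have e1 : ∀ x, σ x (k x0) = (pk (φ x0) (φ x))⁻¹ • Φ (tens (pk (φ x0)) (k x0)) x := by
      intro x
      rw [hσ (tens (pk (φ x0)) (k x0)) x, tens_apply, map_smul, smul_smul, inv_mul_cancel₀ (pk_ne _ _), one_smul]
    have e2 : Continuous fun x => ‖f x - σ x (k x0)‖ := by
      simp only [e1]
      have q1 : Continuous fun x => pk (φ x0) (φ x) := (map_continuous (pk (φ x0))).comp hφc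
      have q2 : Continuous fun x => (pk (φ x0) (φ x))⁻¹ := q1.inv₀ fun x => pk_ne _ _
      have q3 : Continuous fun x => Φ (tens (pk (φ x0)) (k x0)) x := map_continuous _
      have q4 : Continuous fun x => f x := map_continuous f
      have q5 : Continuous fun x => (pk (φ x0) (φ x))⁻¹ • Φ (tens (pk (φ x0)) (k x0)) x := q2.smul q3
      exact (q4.sub q5).norm
    have e3 : ∀ x, ‖f x - σ x (k x0)‖ = dist (k x) (k x0) := by
      intro x
      rw [dist_eq_norm, ← hσiso x (k x - k x0), map_sub, hk]
    show Filter.Tendsto k (nhds x0) (nhds (k x0))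
    rw [tendsto_iff_dist_tendsto_zero]
    simp only [e3] at e2
    simpa using e2.tendsto x0
  let F : C₀(ℝ, H →L[ℂ] H) :=
    { toFun := fun y => k (E.symm y)
      continuous_toFun := hkc.comp E.symm.continuous
      zero_at_infty' := by
        have n1 : Filter.Tendsto (fun y => ‖f (E.symm y)‖) (Filter.cocompact ℝ) (nhds 0) := by
          have := (zero_at_infty f).comp E.symm.isClosedEmbedding.tendsto_cocompact
          simpa using this.norm
        refine squeeze_zero_norm (fun y => ?_) n1
        rw [← hk, hσiso] }
  refine ⟨F, ?_⟩
  ext1 x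
  rw [hσ]
  show σ x (k (E.symm (φ x))) = f x
  rw [← hE, E.symm_apply_apply, hk]

set_option maxHeartbeats 1000000 in
theorem Loc.surj [TopologicalSpace.SeparableSpace H] (h : Loc Φ) : Function.Surjective Φ := by
  choose φ c u hc hu hg using h.point
  have pkre : ∀ y t, (pk y t).im = 0 := fun y t => by rw [pk_apply, Complex.ofReal_im]
  obtain ⟨w0, hw0⟩ : ∃ w : H, ‖w‖ = 1 := exists_norm_eq H zero_le_one
  have hun : ∀ u : H →L[ℂ] H, IsU u → ‖u‖ = 1 := by
    intro u hu
    refine le_antisymm (u.opNorm_le_bound zero_le_one fun v => by rw [hu, one_mul]) ?_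
    have := u.le_opNorm w0
    rw [hu, hw0, mul_one] at this
    exact this
  obtain ⟨c1, hφb⟩ := real_part (c := c) (φ := φ) hc (by
    intro y
    obtain ⟨θ, hb, ht⟩ := h.loc (tens (pk y) 1)
    refine ⟨θ, hb, fun x => ?_⟩
    obtain ⟨τ, hτ, e⟩ := ht x
    have e1 : ‖Φ (tens (pk y) 1) x‖ = (1 + |θ x - y|)⁻¹ := by
      rw [e, hτ.iso, tens_apply, norm_smul, pk_norm, norm_one, mul_one]
    rw [← e1, hg x _ (pkre y), norm_smul, hun _ (hu x), norm_mul, pk_norm, Complex.norm_real,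
      Real.norm_of_nonneg (hc x).le, mul_one])
  have hg1 : ∀ x (g : C₀(ℝ, ℂ)), (∀ t, (g t).im = 0) → Φ (tens g 1) x = g (φ x) • u x := by
    intro x g hgr
    rw [hg x g hgr, c1]; simp
  have hφc : Continuous φ := by
    rw [continuous_iff_continuousAt]
    intro x
    have h1 : Continuous fun z => ‖Φ (tens (pk (φ x)) 1) z‖ := (map_continuous _).norm
    have h2 : ∀ z, ‖Φ (tens (pk (φ x)) 1) z‖ = (1 + |φ z - φ x|)⁻¹ := by
      intro z
      rw [hg1 z _ (pkre _), norm_smul, hun _ (hu z), pk_norm, mul_one]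
    have h3 : Filter.Tendsto (fun z => (1 + |φ z - φ x|)⁻¹) (nhds x) (nhds 1) := by
      have := h1.tendsto x
      simp only [h2] at this
      simpa using this
    have h4 := (h3.inv₀ one_ne_zero).sub_const 1
    simp only [inv_inv, inv_one, sub_self, add_sub_cancel_left] at h4
    show Filter.Tendsto φ (nhds x) (nhds (φ x))
    rw [tendsto_iff_dist_tendsto_zero]
    exact h4
  obtain ⟨E, hE⟩ := homeo_of_bij hφc hφb
  -- locality
  have locz1 : ∀ (f : C₀(ℝ, H →L[ℂ] H)) x, ‖f‖ ≤ 1 → f (φ x) = 0 → Φ f x = 0 := by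
    intro f x hf hfx
    have hfl : ∀ t, ‖f t‖ ≤ 1 := fun t => (C0_apply_le f t).trans hf
    let g : C₀(ℝ, ℂ) := pkm (φ x) (fun t => 1 - ‖f t‖) (continuous_const.sub (map_continuous f).norm) (fun t => by
      rw [abs_of_nonneg (by linarith [hfl t])]; linarith [norm_nonneg (f t)])
    have hgt : ∀ t, g t = pk (φ x) t * ((1 - ‖f t‖ : ℝ) : ℂ) := fun t => rfl
    have hgn : ∀ t, ‖g t‖ ≤ 1 - ‖f t‖ := by
      intro t
      rw [hgt, norm_mul, Complex.norm_real, Real.norm_of_nonneg (by linarith [hfl t])]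
      exact mul_le_of_le_one_left (by linarith [hfl t]) (pk_norm_le _ _)
    have hgx : Φ (tens g 1) x = u x := by
      rw [hg1 x g (fun t => by rw [hgt, pk_apply, ← Complex.ofReal_mul, Complex.ofReal_im]), hgt, hfx]; simp
    have n1 : ‖tens g 1 + f‖ ≤ 1 := by
      refine C0_norm_le _ zero_le_one fun t => ?_
      refine (norm_add_le (tens g 1 t) (f t)).trans ?_
      rw [tens_apply, norm_smul, norm_one, mul_one]; linarith [hgn t]
    have n2 : ‖tens g 1 - f‖ ≤ 1 := by
      refine C0_norm_le _ zero_le_one fun t => ?_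
      refine (norm_sub_le (tens g 1 t) (f t)).trans ?_
      rw [tens_apply, norm_smul, norm_one, mul_one]; linarith [hgn t]
    have m1 : ‖u x + Φ f x‖ ≤ 1 := by
      rw [← h.iso, map_add] at n1
      rw [← hgx]
      exact (C0_apply_le _ x).trans n1
    have m2 : ‖u x - Φ f x‖ ≤ 1 := by
      rw [← h.iso, map_sub] at n2
      rw [← hgx]
      exact (C0_apply_le _ x).trans n2
    ext v
    refine zero_of_par (hu x v) ?_ ?_
    · exact ((u x + Φ f x).le_opNorm v).trans (mul_le_of_le_one_left (norm_nonneg _) m1)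
    · exact ((u x - Φ f x).le_opNorm v).trans (mul_le_of_le_one_left (norm_nonneg _) m2)
  have locz : ∀ (f : C₀(ℝ, H →L[ℂ] H)) x, f (φ x) = 0 → Φ f x = 0 := by
    intro f x hfx
    have hp : (0 : ℝ) < 1 + ‖f‖ := by positivity
    have := locz1 ((((1 + ‖f‖)⁻¹ : ℝ) : ℂ) • f) x (by
      rw [norm_smul, Complex.norm_real, Real.norm_of_nonneg (by positivity), inv_mul_le_iff₀ hp]; linarith)
      (by rw [ZeroAtInftyContinuousMap.smul_apply, hfx, smul_zero])
    rw [map_smul, ZeroAtInftyContinuousMap.smul_apply] at this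
    refine (smul_eq_zero.mp this).resolve_left ?_
    exact_mod_cast (inv_pos.mpr hp).ne'
  have key : ∀ x (a b : C₀(ℝ, H →L[ℂ] H)), a (φ x) = b (φ x) → Φ a x = Φ b x := by
    intro x a b hab
    have := locz (a - b) x (by show a (φ x) - b (φ x) = 0; rw [hab, sub_self])
    rw [map_sub] at this
    exact sub_eq_zero.mp this
  obtain ⟨σ, hσ'⟩ : ∃ σ : ℝ → (H →L[ℂ] H) →ₗ[ℂ] (H →L[ℂ] H),
      ∀ x T, σ x T = Φ (tens (pk (φ x)) T) x := ⟨fun x =>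
    { toFun := fun T => Φ (tens (pk (φ x)) T) x
      map_add' := fun T T' => by
        rw [← ZeroAtInftyContinuousMap.add_apply, ← map_add]
        exact key _ _ _ (by simp)
      map_smul' := fun c T => by
        rw [RingHom.id_apply, ← ZeroAtInftyContinuousMap.smul_apply, ← map_smul]
        exact key _ _ _ (by simp) }, fun x T => rfl⟩
  have hσ : ∀ f x, Φ f x = σ x (f (φ x)) := fun f x => by
    rw [hσ']; exact key _ _ _ (by simp)
  have hσle : ∀ x T, ‖σ x T‖ ≤ ‖T‖ := by
    intro x T
    rw [hσ']
    refine (C0_apply_le _ x).trans ?_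
    rw [h.iso, tens_pk_norm]
  have hgood : ∀ x T, ∃ τ, Good τ ∧ σ x T = τ T := by
    intro x T
    obtain ⟨θ, hb, ht⟩ := h.loc (tens (pk (φ x)) T)
    by_cases hT : T = 0
    · obtain ⟨τ, hτ, -⟩ := ht x
      exact ⟨τ, hτ, by rw [hT, map_zero, map_zero]⟩
    obtain ⟨z, hz⟩ := hb.2 (φ x)
    obtain ⟨τ, hτ, e⟩ := ht z
    have e' : Φ (tens (pk (φ x)) T) z = τ T := by rw [e, hz]; simp
    have hzx : z = x := by
      apply hφb.1
      apply pk_norm_eq_one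
      have n1 : ‖Φ (tens (pk (φ x)) T) z‖ = ‖T‖ := by rw [e', hτ.iso]
      have n2 := hσle z (tens (pk (φ x)) T (φ z))
      rw [← hσ, n1, tens_apply, norm_smul] at n2
      have hT0 : 0 < ‖T‖ := norm_pos_iff.mpr hT
      by_contra hlt
      push Not at hlt
      nlinarith
    rw [hzx] at e'
    exact ⟨τ, hτ, (hσ' x T).trans e'⟩
  have hσiso : ∀ x T, ‖σ x T‖ = ‖T‖ := by
    intro x T
    obtain ⟨τ, hτ, e⟩ := hgood x T
    rw [e, hτ.iso]
  have hσsurj : ∀ x, Function.Surjective (σ x) := fun x => good_refl (hgood x)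
  exact surj_tail hφc E hE hσ hσiso hσsurj

end fin

end helpers

/-- The group of surjective linear isometries of the suspension
`C₀(ℝ, B(H))` of `B(H)` is algebraically reflexive. -/
theorem iso_reflexive_suspension_BH
    {H : Type*} [NormedAddCommGroup H] [InnerProductSpace ℂ H] [CompleteSpace H]
    [TopologicalSpace.SeparableSpace H] (hH : ¬ FiniteDimensional ℂ H)
    (Φ : C₀(ℝ, H →L[ℂ] H) →L[ℂ] C₀(ℝ, H →L[ℂ] H))
    (hΦ : ∀ f : C₀(ℝ, H →L[ℂ] H), ∃ S : C₀(ℝ, H →L[ℂ] H) → C₀(ℝ, H →L[ℂ] H),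
      IsSurjectiveLinearIsometry S ∧ Φ f = S f) :
    IsSurjectiveLinearIsometry (⇑Φ) := by
  have hnt : Nontrivial H := by
    by_contra hn
    rw [not_nontrivial_iff_subsingleton] at hn
    exact hH inferInstance
  have hloc : Loc Φ.toLinearMap := by
    refine ⟨fun f => ?_, fun f => ?_⟩
    · obtain ⟨S, ⟨-, -, hi⟩, e⟩ := hΦ f
      rw [ContinuousLinearMap.coe_coe, e, hi]
    · obtain ⟨S, ⟨hl, hs, hi⟩, e⟩ := hΦ f
      obtain ⟨φ, hb, hτ⟩ := surj_iso_struct (S := hl.mk' S) hs hi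
      refine ⟨φ, hb, fun x => ?_⟩
      obtain ⟨τ, hg, ht⟩ := hτ x
      refine ⟨τ, hg, ?_⟩
      rw [ContinuousLinearMap.coe_coe, e]
      exact ht f
  exact ⟨Φ.toLinearMap.isLinear, hloc.surj, hloc.iso⟩
end

section
/- Let X be a locally compact Hausdorff space. A closed two-sided ideal 𝓘 of C₀(X, B(H)) is of the form 𝓘 = {f ∈ C₀(X, B(H)) : f(x₀) = 0} for some point x₀ ∈ X if and only if: 𝓘 is a proper subset of a maximal closed two-sided ideal 𝓘_m of C₀(X, B(H)), there is no closed two-sided ideal strictly between 𝓘 and 𝓘_m, and 𝓘 is not the intersection of two distinct maximal closed two-sided ideals of C₀(X, B(H)). -/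
open scoped ZeroAtInfty

/-- A maximal closed two-sided ideal: a closed proper two-sided ideal which is maximal
among proper closed two-sided ideals. -/
def IsMaximalClosedTwoSidedIdeal {A : Type*} [NonUnitalNonAssocRing A] [TopologicalSpace A]
    (J : TwoSidedIdeal A) : Prop :=
  IsClosed (J : Set A) ∧ J ≠ ⊤ ∧
    ∀ K : TwoSidedIdeal A, IsClosed (K : Set A) → K ≠ ⊤ → J ≤ K → J = K


section OperatorLemmas
open ContinuousLinearMap

variable {H : Type*} [NormedAddCommGroup H] [InnerProductSpace ℂ H]

lemma aux_pythagoras {ι : Type*} (f : ι → H) (hf : ∀ i j, i ≠ j → inner ℂ (f i) (f j) = 0)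
    (a : ι → ℂ) (s : Finset ι) :
    ‖∑ i ∈ s, a i • f i‖ ^ 2 = ∑ i ∈ s, ‖a i‖ ^ 2 * ‖f i‖ ^ 2 := by
  classical
  induction s using Finset.induction_on with
  | empty => simp
  | insert i s hi ih =>
    rw [Finset.sum_insert hi, Finset.sum_insert hi, ← ih]
    have h0 : inner ℂ (a i • f i) (∑ j ∈ s, a j • f j) = 0 := by
      rw [inner_sum]
      refine Finset.sum_eq_zero fun j hj => ?_
      rw [inner_smul_left, inner_smul_right, hf i j (by rintro rfl; exact hi hj)]
      simp
    have := norm_add_sq_eq_norm_sq_add_norm_sq_of_inner_eq_zero _ _ h0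
    rw [norm_smul (a i)] at this
    nlinarith [this]

variable [CompleteSpace H]

lemma aux_delta (T : H →L[ℂ] H) (hT : ¬ IsCompactOperator T) :
    ∃ δ : ℝ, 0 < δ ∧ ∀ F : Submodule ℂ H, FiniteDimensional ℂ F →
      ∃ v ∈ Fᗮ, ‖v‖ = 1 ∧ δ ≤ ‖T v‖ := by
  by_contra! hcon
  apply hT
  have hcl : IsClosed {S : H →L[ℂ] H | IsCompactOperator S} := isClosed_setOfPred_isCompactOperator
  have : T ∈ closure {S : H →L[ℂ] H | IsCompactOperator S} := by
    rw [Metric.mem_closure_iff]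
    intro ε hε
    obtain ⟨F, hF, hv⟩ := hcon (ε / 2) (by positivity)
    refine ⟨T ∘L F.starProjection, ?_, ?_⟩
    · have : IsCompactOperator (F.starProjection : H →L[ℂ] H) := by
        have h1 : IsCompactOperator (F.orthogonalProjectionOnto : H →L[ℂ] F) :=
          isCompactOperator_of_locallyCompactSpace_dom _
        exact h1.clm_comp F.subtypeL
      exact this.clm_comp T
    · rw [dist_eq_norm]
      refine lt_of_le_of_lt (ContinuousLinearMap.opNorm_le_bound _ (by positivity : 0 ≤ ε / 2) ?_)
        (by linarith)
      intro x
      set w := x - F.starProjection x with hw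
      have hwF : w ∈ Fᗮ := F.sub_starProjection_mem_orthogonal x
      have hwn : ‖w‖ ≤ ‖x‖ := by
        have h2 : w = Fᗮ.starProjection x := by
          rw [Submodule.starProjection_orthogonal']; simp [hw]
        rw [h2]
        exact Submodule.norm_starProjection_apply_le _ _
      have : (T - T ∘L F.starProjection) x = T w := by simp [hw]
      rw [this]
      refine le_trans ?_ (mul_le_mul_of_nonneg_left hwn (by positivity))
      by_cases h0 : w = 0
      · simp [h0]
      · have hn : 0 < ‖w‖ := norm_pos_iff.2 h0
        have := hv ((‖w‖⁻¹ : ℂ) • w) (Submodule.smul_mem _ _ hwF) (by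
          rw [norm_smul]; simp [hn.ne'])
        rw [map_smul, norm_smul] at this
        simp only [norm_inv, Complex.norm_real, norm_norm] at this
        rw [inv_mul_lt_iff₀ hn] at this
        linarith
  rwa [hcl.closure_eq] at this

lemma aux_seq (T : H →L[ℂ] H) (hT : ¬ IsCompactOperator T) :
    ∃ δ : ℝ, 0 < δ ∧ ∃ e : ℕ → H, Orthonormal ℂ e ∧ (∀ n, δ ≤ ‖T (e n)‖) ∧
      ∀ i j, i ≠ j → inner ℂ (T (e i)) (T (e j)) = 0 := by
  classical
  obtain ⟨δ, hδ, h⟩ := aux_delta T hT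
  have := exists_seq_of_forall_finset_exists (fun v : H => ‖v‖ = 1 ∧ δ ≤ ‖T v‖)
    (fun x y => inner ℂ x y = 0 ∧ inner ℂ (T x) (T y) = 0) (by
      intro s _
      obtain ⟨v, hv, h1, h2⟩ := h (Submodule.span ℂ
        ((s ∪ s.image (fun x => (adjoint T) (T x)) : Finset H) : Set H))
        (FiniteDimensional.span_finset ℂ _)
      refine ⟨v, ⟨h1, h2⟩, fun x hx => ⟨?_, ?_⟩⟩
      · exact hv x (Submodule.subset_span (by simp [hx]))
      · rw [← adjoint_inner_left]
        exact hv _ (Submodule.subset_span (by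
          simp only [Finset.coe_union, Finset.coe_image]
          exact Or.inr ⟨x, hx, rfl⟩)))
  obtain ⟨e, he, hr⟩ := this
  refine ⟨δ, hδ, e, ⟨fun i => (he i).1, ?_⟩, fun i => (he i).2, ?_⟩
  · intro i j hij
    rcases lt_or_gt_of_ne hij with h | h
    · exact (hr _ _ h).1
    · exact inner_eq_zero_symm.1 (hr _ _ h).1
  · intro i j hij
    rcases lt_or_gt_of_ne hij with h | h
    · exact (hr _ _ h).2
    · exact inner_eq_zero_symm.1 (hr _ _ h).2

lemma aux_left_inv (S : H →L[ℂ] H) (c : ℝ) (hc : 0 < c) (h : ∀ x, c * ‖x‖ ≤ ‖S x‖) :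
    ∃ A : H →L[ℂ] H, A * S = 1 := by
  have hle : (((c ^ 2 : ℝ) : ℂ) • (1 : H →L[ℂ] H)) ≤ adjoint S * S := by
    rw [ContinuousLinearMap.le_def]
    rw [ContinuousLinearMap.isPositive_def']
    constructor
    · refine IsSelfAdjoint.sub (IsSelfAdjoint.star_mul_self S) ?_
      rw [isSelfAdjoint_iff, star_smul, star_one]
      simp
    · intro x
      have h1 : inner ℂ ((adjoint S) (S x)) x = ((‖S x‖ ^ 2 : ℝ) : ℂ) := by
        rw [adjoint_inner_left, inner_self_eq_norm_sq_to_K]; simp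
      have h2 : inner ℂ (((c ^ 2 : ℝ) : ℂ) • x) x = ((c ^ 2 * ‖x‖ ^ 2 : ℝ) : ℂ) := by
        rw [inner_smul_left, inner_self_eq_norm_sq_to_K]; simp
      have h3 : c ^ 2 * ‖x‖ ^ 2 ≤ ‖S x‖ ^ 2 := by
        rw [← mul_pow]; exact pow_le_pow_left₀ (by positivity) (h x) 2
      rw [reApplyInnerSelf_apply]
      have : (adjoint S * S - ((c ^ 2 : ℝ) : ℂ) • (1 : H →L[ℂ] H)) x
        = adjoint S (S x) - ((c ^ 2 : ℝ) : ℂ) • x := by simp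
      rw [this, inner_sub_left, h1, h2, ← Complex.ofReal_sub]
      change 0 ≤ (((‖S x‖ ^ 2 - c ^ 2 * ‖x‖ ^ 2 : ℝ)) : ℂ).re
      rw [Complex.ofReal_re]
      linarith
  have hu : IsUnit (((c ^ 2 : ℝ) : ℂ) • (1 : H →L[ℂ] H)) := by
    refine (isUnit_one).smul (Units.mk0 ((c ^ 2 : ℝ) : ℂ) ?_)
    exact_mod_cast (by positivity : c ^ 2 ≠ 0)
  have h0 : (0 : H →L[ℂ] H) ≤ (((c ^ 2 : ℝ) : ℂ) • (1 : H →L[ℂ] H)) := by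
    have : (((c ^ 2 : ℝ) : ℂ) • (1 : H →L[ℂ] H)) =
        star ((c : ℂ) • (1 : H →L[ℂ] H)) * ((c : ℂ) • (1 : H →L[ℂ] H)) := by
      rw [star_smul, star_one, smul_mul_smul_comm, mul_one]
      simp [pow_two]
    rw [this]
    exact star_mul_self_nonneg _
  obtain ⟨u, hu⟩ := CStarAlgebra.isUnit_of_le _ hle ⟨h0, hu⟩
  refine ⟨(↑u⁻¹ : H →L[ℂ] H) * adjoint S, ?_⟩
  rw [mul_assoc, ← hu]
  simp

lemma aux_noncompact [TopologicalSpace.SeparableSpace H] (T : H →L[ℂ] H)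
    (hT : ¬ IsCompactOperator T) : ∃ A B : H →L[ℂ] H, A * T * B = 1 := by
  classical
  obtain ⟨δ, hδ, e, he, hTe, hort⟩ := aux_seq T hT
  obtain ⟨w, b, -⟩ := exists_hilbertBasis ℂ H
  have hcount : Countable w := by
    have : (Set.univ : Set w).Countable := by
      refine Set.PairwiseDisjoint.countable_of_isOpen
        (s := fun i : w => Metric.ball (b i) (1 / 2)) ?_ (fun _ _ => Metric.isOpen_ball)
        (fun i _ => ⟨b i, by simp⟩)
      intro i _ j _ hij
      apply Metric.ball_disjoint_ball
      have h2 : ‖b i - b j‖ * ‖b i - b j‖ = ‖b i‖ * ‖b i‖ + ‖b j‖ * ‖b j‖ :=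
by
        have h0 : inner ℂ (b i) (b j) = 0 := b.orthonormal.2 hij
        have := @norm_sub_sq ℂ H _ _ _ (b i) (b j)
        rw [h0] at this
        simp only [map_zero] at this
        nlinarith
      rw [b.orthonormal.1, b.orthonormal.1] at h2
      rw [dist_eq_norm]
      nlinarith [norm_nonneg (b i - b j)]
    exact Set.countable_univ_iff.1 this
  obtain ⟨ι, hι⟩ := exists_injective_nat w
  have hfam := (he.comp ι hι).orthogonalFamily
  let V : H →L[ℂ] H := hfam.linearIsometry.toContinuousLinearMap ∘L
    (b.repr : H →L[ℂ] _)
  have hV : ∀ i, V (b i) = e (ι i) := by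
    intro i
    have h1 : V (b i) = hfam.linearIsometry (b.repr (b i)) := rfl
    rw [h1, b.repr_self, hfam.linearIsometry_apply_single]
    simp
  obtain ⟨A, hA⟩ := aux_left_inv (T * V) δ hδ (by
    intro x
    have hs := b.hasSum_repr x
    have hs2 := hs.mapL (T * V)
    refine le_of_tendsto_of_tendsto' (hs.norm.const_mul δ) hs2.norm ?_
    intro s
    have h3 : ∑ i ∈ s, (T * V) (b.repr x i • b i) = ∑ i ∈ s, b.repr x i • T (e (ι i)) := by
      refine Finset.sum_congr rfl fun i _ => ?_
      rw [map_smul]; simp [hV]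
    rw [h3]
    refine abs_le_of_sq_le_sq' ?_ (norm_nonneg _) |>.2
    rw [mul_pow, aux_pythagoras _ (fun i j hij => b.orthonormal.2 hij),
      aux_pythagoras _ (fun i j hij => hort _ _ (fun h => hij (hι h))), Finset.mul_sum]
    refine Finset.sum_le_sum fun i _ => ?_
    rw [b.orthonormal.1]
    have := pow_le_pow_left₀ hδ.le (hTe (ι i)) 2
    nlinarith [sq_nonneg ‖b.repr x i‖])
  exact ⟨A, V, by rw [mul_assoc]; exact hA⟩

lemma aux_compact_approx (L : TwoSidedIdeal (H →L[ℂ] H)) (T : H →L[ℂ] H) (hTL : T ∈ L)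
    (hT : T ≠ 0) (S : H →L[ℂ] H) (hS : IsCompactOperator S) (ε : ℝ) (hε : 0 < ε) :
    ∃ R ∈ L, ‖R - S‖ < ε := by
  obtain ⟨u, hu⟩ : ∃ u, T u ≠ 0 := by
    by_contra! h
    exact hT (ContinuousLinearMap.ext h)
  have hone : ∀ a b : H, InnerProductSpace.rankOne ℂ a b ∈ L := by
    intro a b
    have : InnerProductSpace.rankOne ℂ a b =
        InnerProductSpace.rankOne ℂ (((‖T u‖ ^ 2 : ℝ) : ℂ)⁻¹ • a) (T u) * T *
          InnerProductSpace.rankOne ℂ u b := by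
      ext x
      have : ((‖T u‖ ^ 2 : ℝ) : ℂ) ≠ 0 := by
        exact_mod_cast pow_ne_zero 2 (norm_ne_zero_iff.2 hu)
      have h1 : (InnerProductSpace.rankOne ℂ (((‖T u‖ ^ 2 : ℝ) : ℂ)⁻¹ • a) (T u) * T *
          InnerProductSpace.rankOne ℂ u b) x =
          inner ℂ (T u) (T (inner ℂ b x • u)) • (((‖T u‖ ^ 2 : ℝ) : ℂ)⁻¹ • a) := rfl
      have h2 : inner ℂ (T u) (T u) = ((‖T u‖ ^ 2 : ℝ) : ℂ) := by
        rw [inner_self_eq_norm_sq_to_K]; simp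
      rw [h1, map_smul, inner_smul_right, h2, smul_smul, mul_assoc, mul_inv_cancel₀ this, mul_one]
      rfl
    rw [this]
    exact L.mul_mem_right _ _ (L.mul_mem_left _ _ hTL)
  obtain ⟨K, hK, hSK⟩ := hS.image_closedBall_subset_compact (f := S.toLinearMap) 1
  obtain ⟨t, -, ht, htK⟩ := Metric.totallyBounded_iff.1 hK.totallyBounded (ε / 2) (by positivity)
    |>.imp fun t h => (⟨trivial, h.1, h.2⟩ : True ∧ _ ∧ _)
  let F := Submodule.span ℂ t
  have : FiniteDimensional ℂ F := FiniteDimensional.span_of_finite ℂ ht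
  have hP : F.starProjection ∈ L := by
    rw [(stdOrthonormalBasis ℂ F).starProjection_eq_sum_rankOne]
    exact sum_mem fun i _ => hone _ _
  refine ⟨F.starProjection * S, L.mul_mem_right _ _ hP, ?_⟩
  refine lt_of_le_of_lt (ContinuousLinearMap.opNorm_le_of_unit_norm (C := ε / 2) (by positivity) ?_)
        (by linarith)
  intro x hx
  have hxK : S x ∈ K := hSK ⟨x, by simp [hx], rfl⟩
  obtain ⟨y, hy, hxy⟩ := Set.mem_iUnion₂.1 (htK hxK)
  have hyF : y ∈ F := Submodule.subset_span hy
  have h1 : F.starProjection y = y := Submodule.starProjection_eq_self_iff.2 hyF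
  have h2 : (F.starProjection * S - S) x = - (Fᗮ.starProjection (S x - y)) := by
    rw [Submodule.starProjection_orthogonal']
    simp [h1]
  rw [h2, norm_neg]
  refine (Submodule.norm_starProjection_apply_le _ _).trans ?_
  rw [← dist_eq_norm]
  exact (Metric.mem_ball.1 hxy).le

end OperatorLemmas

section IdealLemmas

variable {H : Type*} [NormedAddCommGroup H] [InnerProductSpace ℂ H]
variable {X : Type*} [TopologicalSpace X]

/-- The function `x ↦ φ x • T`, for a compactly supported `φ`. -/
noncomputable def auxBump (φ : C(X, ℝ)) (hφ : HasCompactSupport φ) (T : H →L[ℂ] H) :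
    C₀(X, H →L[ℂ] H) where
  toFun x := φ x • T
  continuous_toFun := by fun_prop
  zero_at_infty' := by
    have h : HasCompactSupport (fun x => φ x • T) := hφ.smul_right (f' := fun _ => T)
    exact h.is_zero_at_infty

lemma auxBump_apply (φ : C(X, ℝ)) (hφ : HasCompactSupport φ) (T : H →L[ℂ] H) (x : X) :
    auxBump φ hφ T x = φ x • T := rfl

lemma aux_exists_bump [LocallyCompactSpace X] [T2Space X] (x : X) :
    ∃ φ : C(X, ℝ), HasCompactSupport φ ∧ φ x = 1 := by
  obtain ⟨f, h1, -, h2, -⟩ := exists_continuous_one_zero_of_isCompact (X := X) (s := {x}) (t := ∅)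
    isCompact_singleton isClosed_empty (by simp)
  exact ⟨f, h2, h1 rfl⟩

lemma aux_exists_bump2 [LocallyCompactSpace X] [T2Space X] {x y : X} (hxy : x ≠ y) :
    ∃ φ : C(X, ℝ), HasCompactSupport φ ∧ φ x = 1 ∧ φ y = 0 := by
  obtain ⟨f, h1, h0, h2, -⟩ := exists_continuous_one_zero_of_isCompact (X := X) (s := {x})
    (t := {y}) isCompact_singleton isClosed_singleton (by simpa using hxy)
  exact ⟨f, h2, h1 rfl, h0 rfl⟩

/-- The ideal of values at `x` of elements of `J`. -/
noncomputable def auxEval [LocallyCompactSpace X] [T2Space X]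
    (J : TwoSidedIdeal C₀(X, H →L[ℂ] H)) (x : X) : TwoSidedIdeal (H →L[ℂ] H) :=
  TwoSidedIdeal.mk' {T | ∃ f ∈ J, f x = T}
    ⟨0, J.zero_mem, rfl⟩
    (by rintro _ _ ⟨f, hf, rfl⟩ ⟨g, hg, rfl⟩; exact ⟨f + g, J.add_mem hf hg, rfl⟩)
    (by rintro _ ⟨f, hf, rfl⟩; exact ⟨-f, J.neg_mem hf, rfl⟩)
    (by
      rintro T _ ⟨f, hf, rfl⟩
      obtain ⟨φ, hφ, h1⟩ := aux_exists_bump x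
      exact ⟨auxBump φ hφ T * f, J.mul_mem_left _ _ hf, by simp [auxBump_apply, h1]⟩)
    (by
      rintro _ T ⟨f, hf, rfl⟩
      obtain ⟨φ, hφ, h1⟩ := aux_exists_bump x
      exact ⟨f * auxBump φ hφ T, J.mul_mem_right _ _ hf, by simp [auxBump_apply, h1]⟩)

lemma mem_auxEval [LocallyCompactSpace X] [T2Space X]
    (J : TwoSidedIdeal C₀(X, H →L[ℂ] H)) (x : X) (T : H →L[ℂ] H) :
    T ∈ auxEval J x ↔ ∃ f ∈ J, f x = T := by
  simp [auxEval]

/-- The ideal of functions whose value at `x` is compact. -/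
noncomputable def auxM (H : Type*) [NormedAddCommGroup H] [InnerProductSpace ℂ H] (x : X) :
    TwoSidedIdeal C₀(X, H →L[ℂ] H) :=
  TwoSidedIdeal.mk' {f | IsCompactOperator (f x)}
    (isCompactOperator_zero)
    (fun hf hg => IsCompactOperator.add hf hg)
    (fun hf => IsCompactOperator.neg hf)
    (fun {f g} hg => IsCompactOperator.clm_comp hg (f x))
    (fun {f g} hf => IsCompactOperator.comp_clm hf (g x))

lemma mem_auxM (x : X) (f : C₀(X, H →L[ℂ] H)) : f ∈ auxM H x ↔ IsCompactOperator (f x) := by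
  unfold auxM
  exact TwoSidedIdeal.mem_mk' _ _ _ _ _ _ f

lemma aux_dist_apply_le (f g : C₀(X, H →L[ℂ] H)) (x : X) : dist (f x) (g x) ≤ dist f g := by
  rw [← ZeroAtInftyContinuousMap.dist_toBCF_eq_dist]
  exact BoundedContinuousFunction.dist_coe_le_dist (f := f.toBCF) (g := g.toBCF) x

lemma aux_dist_le (f g : C₀(X, H →L[ℂ] H)) (C : ℝ) (hC : 0 ≤ C) (h : ∀ x, ‖(f - g) x‖ ≤ C) :
    dist f g ≤ C := by
  rw [← ZeroAtInftyContinuousMap.dist_toBCF_eq_dist]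
  refine (BoundedContinuousFunction.dist_le hC).2 fun x => ?_
  rw [dist_eq_norm]
  exact h x

lemma aux_continuous_eval (x : X) : Continuous (fun f : C₀(X, H →L[ℂ] H) => f x) := by
  refine (LipschitzWith.of_dist_le_mul (K := 1) ?_).continuous
  intro f g
  rw [NNReal.coe_one, one_mul]
  exact aux_dist_apply_le f g x

lemma isClosed_auxM [CompleteSpace H] (x : X) :
    IsClosed (auxM H x : Set C₀(X, H →L[ℂ] H)) := by
  have hcl : IsClosed {S : H →L[ℂ] H | IsCompactOperator S} := isClosed_setOfPred_isCompactOperator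
  have := hcl.preimage (aux_continuous_eval (H := H) x)
  convert this using 1
  ext f
  exact mem_auxM x f

variable [LocallyCompactSpace X] [T2Space X]

lemma aux_local (J : TwoSidedIdeal C₀(X, H →L[ℂ] H)) (hJ : IsClosed (J : Set C₀(X, H →L[ℂ] H)))
    (g : C₀(X, H →L[ℂ] H)) (hg : ∀ x, ∀ ε > 0, ∃ R ∈ auxEval J x, ‖R - g x‖ < ε) : g ∈ J := by
  classical
  change g ∈ (J : Set C₀(X, H →L[ℂ] H))
  rw [← hJ.closure_eq, Metric.mem_closure_iff]
  intro ε hε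
  have hε2 : 0 < ε / 2 := by positivity
  have hex : ∀ x, ∃ f ∈ J, ‖f x - g x‖ < ε / 2 := by
    intro x
    obtain ⟨R, hR, h⟩ := hg x (ε / 2) hε2
    obtain ⟨f, hf, rfl⟩ := (mem_auxEval J x R).1 hR
    exact ⟨f, hf, h⟩
  choose f hfJ hf using hex
  obtain ⟨K, hK, hgK⟩ : ∃ K : Set X, IsCompact K ∧ ∀ x ∉ K, ‖g x‖ < ε / 2 := by
    have h1 := (zero_at_infty g).eventually (Metric.ball_mem_nhds 0 hε2)
    obtain ⟨K, hK, h2⟩ := Filter.mem_cocompact.1 h1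
    exact ⟨K, hK, fun x hx => by simpa using h2 hx⟩
  let U : X → Set X := fun y => {x | ‖f y x - g x‖ < ε / 2}
  have hU : ∀ y, IsOpen (U y) := fun y =>
    isOpen_lt (((map_continuous (f y)).sub (map_continuous g)).norm) continuous_const
  obtain ⟨t, ht⟩ := hK.elim_finite_subcover U hU
    (fun x _ => Set.mem_iUnion.2 ⟨x, hf x⟩)
  obtain ⟨p, hp, hpc⟩ := PartitionOfUnity.exists_isSubordinate_of_locallyFinite_t2space hK
    (fun i : t => U i) (fun i => hU i) (locallyFinite_of_finite _)
    (fun x hx => by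
      obtain ⟨i, hi, h⟩ := Set.mem_iUnion₂.1 (ht hx)
      exact Set.mem_iUnion.2 ⟨⟨i, hi⟩, h⟩)
  let h : C₀(X, H →L[ℂ] H) := ∑ i : t, auxBump (p i) (hpc i) 1 * f i
  refine ⟨h, sum_mem fun i _ => J.mul_mem_left _ _ (hfJ _), ?_⟩
  rw [dist_comm]
  refine lt_of_le_of_lt (aux_dist_le _ _ (ε / 2) hε2.le ?_) (by linarith)
  intro x
  have hh : h x = ∑ i : t, p i x • f i x := by
    have h1 : ∀ s : Finset t, (∑ i ∈ s, auxBump (p i) (hpc i) 1 * f i : C₀(X, H →L[ℂ] H)) x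
        = ∑ i ∈ s, p i x • f i x := by
      intro s
      induction s using Finset.induction_on with
      | empty => simp
      | insert i s hi ih =>
        rw [Finset.sum_insert hi, Finset.sum_insert hi, ZeroAtInftyContinuousMap.add_apply, ih,
          ZeroAtInftyContinuousMap.mul_apply, auxBump_apply, smul_mul_assoc, one_mul]
    exact h1 _
  set σ : ℝ := ∑ i : t, p i x with hσ
  have hσ1 : σ ≤ 1 := by
    have := p.sum_le_one x
    rwa [finsum_eq_sum_of_fintype] at this
  have hdec : (h - g) x = (∑ i : t, p i x • (f i x - g x)) - (1 - σ) • g x := by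
    rw [ZeroAtInftyContinuousMap.sub_apply, hh]
    simp only [smul_sub, Finset.sum_sub_distrib, ← Finset.sum_smul, sub_smul, one_smul]
    rw [← hσ]
    abel
  rw [hdec]
  have hA : ‖∑ i : t, p i x • (f i x - g x)‖ ≤ σ * (ε / 2) := by
    rw [hσ, Finset.sum_mul]
    refine norm_sum_le_of_le _ fun i _ => ?_
    rw [norm_smul, Real.norm_of_nonneg (p.nonneg i x)]
    by_cases h0 : p i x = 0
    · simp [h0]
    · have : x ∈ U i := hp i (subset_tsupport _ h0)
      exact mul_le_mul_of_nonneg_left (le_of_lt this) (p.nonneg i x)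
  have hB : ‖(1 - σ) • g x‖ ≤ (1 - σ) * (ε / 2) := by
    rw [norm_smul, Real.norm_of_nonneg (by linarith)]
    by_cases hx : x ∈ K
    · have : σ = 1 := by
        have := p.sum_eq_one hx
        rwa [finsum_eq_sum_of_fintype] at this
      simp [this]
    · exact mul_le_mul_of_nonneg_left (hgK x hx).le (by linarith)
  calc _ ≤ _ := norm_sub_le _ _
    _ ≤ σ * (ε / 2) + (1 - σ) * (ε / 2) := add_le_add hA hB
    _ = ε / 2 := by ring

variable [CompleteSpace H]

lemma auxEval_of_noncompact [TopologicalSpace.SeparableSpace H]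
    (J : TwoSidedIdeal C₀(X, H →L[ℂ] H)) (x : X) (h : ¬ J ≤ auxM H x) (T : H →L[ℂ] H) :
    T ∈ auxEval J x := by
  obtain ⟨f, hf, hfx⟩ := SetLike.not_le_iff_exists.1 h
  rw [mem_auxM] at hfx
  obtain ⟨A, B, hAB⟩ := aux_noncompact (f x) hfx
  have h1 : f x ∈ auxEval J x := (mem_auxEval _ _ _).2 ⟨f, hf, rfl⟩
  have h2 : (1 : H →L[ℂ] H) ∈ auxEval J x := by
    rw [← hAB]
    exact TwoSidedIdeal.mul_mem_right _ _ _ (TwoSidedIdeal.mul_mem_left _ _ _ h1)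
  simpa using TwoSidedIdeal.mul_mem_left _ T _ h2

/-- Membership criterion for a closed ideal. -/
lemma aux_mem [TopologicalSpace.SeparableSpace H]
    (J : TwoSidedIdeal C₀(X, H →L[ℂ] H)) (hJ : IsClosed (J : Set C₀(X, H →L[ℂ] H)))
    (g : C₀(X, H →L[ℂ] H))
    (hg : ∀ x, g x = 0 ∨ (IsCompactOperator (g x) ∧ ∃ f ∈ J, f x ≠ 0) ∨ ¬ J ≤ auxM H x) :
    g ∈ J := by
  refine aux_local J hJ g fun x ε hε => ?_
  rcases hg x with h | ⟨h, f, hf, hfx⟩ | h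
  · exact ⟨0, TwoSidedIdeal.zero_mem _, by simpa [h] using hε⟩
  · exact aux_compact_approx _ (f x) ((mem_auxEval _ _ _).2 ⟨f, hf, rfl⟩) hfx _ h ε hε
  · exact ⟨g x, auxEval_of_noncompact J x h _, by simpa using hε⟩

lemma aux_one_noncompact (hH : ¬ FiniteDimensional ℂ H) :
    ¬ IsCompactOperator (1 : H →L[ℂ] H) :=
  fun h => hH (FiniteDimensional.of_isCompactOperator_id (𝕜 := ℂ) h)

lemma auxM_le_iff (hH : ¬ FiniteDimensional ℂ H) {x y : X} (h : ∀ f : C₀(X, H →L[ℂ] H), 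
    f x = 0 → f ∈ auxM H y) : x = y := by
  by_contra hxy
  obtain ⟨φ, hφ, h1, h0⟩ := aux_exists_bump2 (Ne.symm hxy)
  have := h (auxBump φ hφ 1) (by simp [auxBump_apply, h0])
  rw [mem_auxM, auxBump_apply, h1, one_smul] at this
  exact aux_one_noncompact hH this

lemma auxM_ne_top (hH : ¬ FiniteDimensional ℂ H) (x : X) : auxM H x ≠ ⊤ := by
  intro h
  obtain ⟨φ, hφ, h1⟩ := aux_exists_bump x
  have : auxBump φ hφ (1 : H →L[ℂ] H) ∈ auxM H x := by rw [h]; trivial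
  rw [mem_auxM, auxBump_apply, h1, one_smul] at this
  exact aux_one_noncompact hH this

lemma aux_le_auxM [TopologicalSpace.SeparableSpace H]
    (J : TwoSidedIdeal C₀(X, H →L[ℂ] H)) (hJ : IsClosed (J : Set C₀(X, H →L[ℂ] H)))
    (hne : J ≠ ⊤) : ∃ x, J ≤ auxM H x := by
  by_contra! h
  exact hne (top_le_iff.1 fun g _ => aux_mem J hJ g fun x => Or.inr (Or.inr (h x)))

lemma auxM_maximal [TopologicalSpace.SeparableSpace H] (hH : ¬ FiniteDimensional ℂ H) (x : X) :
    IsMaximalClosedTwoSidedIdeal (auxM H x) := by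
  refine ⟨isClosed_auxM x, auxM_ne_top hH x, fun K hK hne hle => ?_⟩
  obtain ⟨y, hy⟩ := aux_le_auxM K hK hne
  have : x = y := auxM_le_iff hH fun f hf => hy (hle (by
    rw [mem_auxM, hf]; exact isCompactOperator_zero))
  subst this
  exact le_antisymm hle hy

lemma aux_eq_auxM [TopologicalSpace.SeparableSpace H] (hH : ¬ FiniteDimensional ℂ H)
    (J : TwoSidedIdeal C₀(X, H →L[ℂ] H)) (hJ : IsMaximalClosedTwoSidedIdeal J) :
    ∃ x, J = auxM H x := by
  obtain ⟨x, hx⟩ := aux_le_auxM J hJ.1 hJ.2.1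
  exact ⟨x, hJ.2.2 _ (isClosed_auxM x) (auxM_ne_top hH x) hx⟩

lemma aux_exists_compact (hH : ¬ FiniteDimensional ℂ H) :
    ∃ T : H →L[ℂ] H, T ≠ 0 ∧ IsCompactOperator T := by
  have : Nontrivial H := by
    by_contra h
    rw [not_nontrivial_iff_subsingleton] at h
    exact hH inferInstance
  obtain ⟨v, hv⟩ := exists_ne (0 : H)
  refine ⟨(ContinuousLinearMap.toSpanSingleton ℂ v) ∘L (innerSL ℂ v), ?_, ?_⟩
  · intro h
    have := congrArg (fun T : H →L[ℂ] H => T v) h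
    simp [hv] at this
  · have : IsCompactOperator (innerSL ℂ v : H →L[ℂ] ℂ) :=
      isCompactOperator_of_locallyCompactSpace_dom _
    exact this.clm_comp (ContinuousLinearMap.toSpanSingleton ℂ v)

end IdealLemmas

/-- A closed two-sided ideal `I` of `C₀(X, B(H))` is of the form
`{f : f(x₀) = 0}` for some `x₀ ∈ X` iff `I` is properly contained in a maximal closed
two-sided ideal `Im` with no closed two-sided ideal strictly between `I` and `Im`, and
`I` is not the intersection of two distinct maximal closed two-sided ideals. -/
theorem closed_ideal_eq_vanishing_ideal_iff
    {H : Type*} [NormedAddCommGroup H] [InnerProductSpace ℂ H] [CompleteSpace H]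
    [TopologicalSpace.SeparableSpace H] (hH : ¬ FiniteDimensional ℂ H)
    {X : Type*} [TopologicalSpace X] [LocallyCompactSpace X] [T2Space X]
    (I : TwoSidedIdeal C₀(X, H →L[ℂ] H)) (hI : IsClosed (I : Set C₀(X, H →L[ℂ] H))) :
    (∃ x₀ : X, (I : Set C₀(X, H →L[ℂ] H)) = {f : C₀(X, H →L[ℂ] H) | f x₀ = 0}) ↔
      ((∃ Im : TwoSidedIdeal C₀(X, H →L[ℂ] H), IsMaximalClosedTwoSidedIdeal Im ∧ I < Im ∧
          ¬ ∃ K : TwoSidedIdeal C₀(X, H →L[ℂ] H),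
            IsClosed (K : Set C₀(X, H →L[ℂ] H)) ∧ I < K ∧ K < Im) ∧
        ¬ ∃ J₁ J₂ : TwoSidedIdeal C₀(X, H →L[ℂ] H),
          IsMaximalClosedTwoSidedIdeal J₁ ∧ IsMaximalClosedTwoSidedIdeal J₂ ∧ J₁ ≠ J₂ ∧
          (I : Set C₀(X, H →L[ℂ] H)) =
            (J₁ : Set C₀(X, H →L[ℂ] H)) ∩ (J₂ : Set C₀(X, H →L[ℂ] H))) := by
  constructor
  · rintro ⟨x₀, hx⟩
    have hmem : ∀ f, f ∈ I ↔ f x₀ = 0 := fun f => by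
      rw [← SetLike.mem_coe, hx]; rfl
    have hle : I ≤ auxM H x₀ := fun f hf => by
      rw [mem_auxM, (hmem f).1 hf]; exact isCompactOperator_zero
    refine ⟨⟨auxM H x₀, auxM_maximal hH x₀, lt_of_le_of_ne hle ?_, ?_⟩, ?_⟩
    · intro h
      obtain ⟨T, hT0, hT⟩ := aux_exists_compact hH
      obtain ⟨φ, hφ, h1⟩ := aux_exists_bump x₀
      have h2 : auxBump φ hφ T ∈ I := by
        rw [h, mem_auxM, auxBump_apply, h1, one_smul]; exact hT
      rw [hmem, auxBump_apply, h1, one_smul] at h2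
      exact hT0 h2
    · rintro ⟨K, hK, hIK, hKM⟩
      refine hKM.not_ge fun g hg => aux_mem K hK g fun x => ?_
      right
      by_cases h : x = x₀
      · subst h
        left
        refine ⟨(mem_auxM _ _).1 hg, ?_⟩
        obtain ⟨f, hf, hfI⟩ := SetLike.not_le_iff_exists.1 hIK.not_ge
        exact ⟨f, hf, fun h => hfI ((hmem f).2 h)⟩
      · right
        intro hKx
        exact h (auxM_le_iff hH fun f hf => hKx (hIK.le ((hmem f).2 hf))).symm
    · rintro ⟨J₁, J₂, h1, h2, hne, hI2⟩
      obtain ⟨y₁, rfl⟩ := aux_eq_auxM hH J₁ h1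
      obtain ⟨y₂, rfl⟩ := aux_eq_auxM hH J₂ h2
      have hi : ∀ f ∈ I, f ∈ auxM H y₁ ∧ f ∈ auxM H y₂ := fun f hf => by
        have : f ∈ (I : Set C₀(X, H →L[ℂ] H)) := hf
        rw [hI2] at this
        exact this
      have e1 : x₀ = y₁ := auxM_le_iff hH fun f hf => (hi f ((hmem f).2 hf)).1
      have e2 : x₀ = y₂ := auxM_le_iff hH fun f hf => (hi f ((hmem f).2 hf)).2
      exact hne (by rw [← e1, ← e2])
  · rintro ⟨⟨Im, hIm, hlt, hbet⟩, hint⟩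
    obtain ⟨x₀, rfl⟩ := aux_eq_auxM hH Im hIm
    have hy : ∀ y, y ≠ x₀ → ¬ I ≤ auxM H y := by
      intro y hyx hIy
      have hne : auxM (X := X) H x₀ ≠ auxM H y := fun h =>
        hyx (auxM_le_iff hH fun f hf => by
          rw [h, mem_auxM, hf]; exact isCompactOperator_zero)
      by_cases hI2 : I = auxM H x₀ ⊓ auxM H y
      · exact hint ⟨_, _, auxM_maximal hH x₀, auxM_maximal hH y, hne, by
          rw [hI2]; ext f; simp [TwoSidedIdeal.mem_inf]⟩
      · refine hbet ⟨auxM H x₀ ⊓ auxM H y, ?_, lt_of_le_of_ne (le_inf hlt.le hIy) hI2,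
          lt_of_le_of_ne inf_le_left ?_⟩
        · have := (isClosed_auxM (H := H) x₀).inter (isClosed_auxM (H := H) y)
          convert this using 1
          ext f; simp [TwoSidedIdeal.mem_inf]
        · intro h
          exact hne ((auxM_maximal hH x₀).2.2 _ (isClosed_auxM y) (auxM_ne_top hH y)
            (inf_eq_left.1 h))
    refine ⟨x₀, ?_⟩
    have hz : ∀ f ∈ I, f x₀ = 0 := by
      by_contra! hcon
      refine hlt.not_ge fun g hg => aux_mem I hI g fun x => ?_
      right
      by_cases h : x = x₀
      · subst h
        exact Or.inl ⟨(mem_auxM _ _).1 hg, hcon⟩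
      · exact Or.inr (hy x h)
    ext g
    refine ⟨fun hg => hz g hg, fun hg => aux_mem I hI g fun x => ?_⟩
    by_cases h : x = x₀
    · subst h
      exact Or.inl hg
    · exact Or.inr (Or.inr (hy x h))
end

section
/- Let X be a locally compact Hausdorff space. The maximal closed two-sided ideals of C₀(X, B(H)) are exactly the sets of the form {f ∈ C₀(X, B(H)) : f(x₀) ∈ K(H)} for some point x₀ ∈ X, where K(H) denotes the ideal of compact operators on H. -/
open scoped ZeroAtInfty

theorem aux_countable_of_orthonormal {H : Type*} [NormedAddCommGroup H] [InnerProductSpace ℂ H]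
    [TopologicalSpace.SeparableSpace H] (w : Set H)
    (hw : Orthonormal ℂ (fun x : w => (x : H))) : Countable w := by
  have hd : ∀ a b : w, a ≠ b → (1:ℝ) < ‖(a:H) - b‖ := by
    intro a b hab
    have h0 : inner ℂ (a:H) (b:H) = 0 := hw.2 hab
    have h1 := hw.1 a
    have h2 := hw.1 b
    have h3 : ‖(a:H) - b‖ ^ 2 = 2 := by
      rw [norm_sub_sq (𝕜 := ℂ), h0]
      simp only [] at h1 h2
      rw [h1, h2]; norm_num
    nlinarith [norm_nonneg ((a:H) - b)]
  have : w.Countable := by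
    refine Set.PairwiseDisjoint.countable_of_isOpen (s := fun x : H => Metric.ball x (1/2)) ?_
      (fun i _ => Metric.isOpen_ball) (fun i _ => ⟨i, Metric.mem_ball_self (by norm_num)⟩)
    intro a ha b hb hab
    apply Metric.ball_disjoint_ball
    have := hd ⟨a, ha⟩ ⟨b, hb⟩ (by simpa using hab)
    rw [dist_eq_norm]
    simp only [] at this
    linarith
  exact this.to_subtype

theorem aux_exists_unit {H : Type*} [NormedAddCommGroup H] [InnerProductSpace ℂ H]
    [CompleteSpace H] (T : H →L[ℂ] H) (hT : ¬ IsCompactOperator T) :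
    ∃ ε : ℝ, 0 < ε ∧ ∀ F : Submodule ℂ H, FiniteDimensional ℂ F →
      ∃ e ∈ Fᗮ, ‖e‖ = 1 ∧ ε ≤ ‖T e‖ := by
  by_contra! hcon
  apply hT
  have hcl : IsClosed {A : H →L[ℂ] H | IsCompactOperator A} := isClosed_setOfPred_isCompactOperator
  have : T ∈ closure {A : H →L[ℂ] H | IsCompactOperator A} := by
    rw [Metric.mem_closure_iff]
    intro ε hε
    obtain ⟨F, hF, h⟩ := hcon (ε / 2) (by positivity)
    refine ⟨T ∘L F.starProjection, ?_, ?_⟩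
    · have h1 : IsCompactOperator (F.subtypeL ∘L F.orthogonalProjectionOnto) := by
        have : ProperSpace F := FiniteDimensional.proper ℂ F
        have h2 : IsCompactOperator F.orthogonalProjectionOnto :=
          isCompactOperator_of_locallyCompactSpace_dom F.orthogonalProjectionOnto
        exact h2.clm_comp F.subtypeL
      exact h1.clm_comp T
    · rw [dist_eq_norm]
      refine lt_of_le_of_lt (ContinuousLinearMap.opNorm_le_bound _ (by positivity : 0 ≤ ε / 2) ?_)
        (half_lt_self hε)
      intro x
      set y := x - F.starProjection x with hy
      have hyF : y ∈ Fᗮ := Submodule.sub_starProjection_mem_orthogonal x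
      have hyx : ‖y‖ ≤ ‖x‖ := by
        have : y = Fᗮ.starProjection x := by
          rw [Submodule.starProjection_orthogonal_val]
        rw [this]
        exact Submodule.norm_starProjection_apply_le _ _
      have e1 : (T - T ∘L F.starProjection) x = T y := by simp [hy]
      rw [e1]
      rcases eq_or_ne y 0 with h0 | h0
      · rw [h0]; simp; positivity
      · have hn : 0 < ‖y‖ := norm_pos_iff.2 h0
        have := h ((‖y‖⁻¹ : ℂ) • y) (Fᗮ.smul_mem _ hyF) (by
          rw [norm_smul]; simp [hn.ne'])
        rw [map_smul, norm_smul] at this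
        simp only [norm_inv, Complex.norm_real, norm_norm] at this
        rw [inv_mul_lt_iff₀ hn] at this
        nlinarith
  rwa [hcl.closure_eq] at this

theorem aux_exists_seq {H : Type*} [NormedAddCommGroup H] [InnerProductSpace ℂ H]
    [CompleteSpace H] (T : H →L[ℂ] H) (hT : ¬ IsCompactOperator T) :
    ∃ ε : ℝ, 0 < ε ∧ ∃ e : ℕ → H, Orthonormal ℂ e ∧ (∀ n, ε ≤ ‖T (e n)‖) ∧
      ∀ m n, m ≠ n → inner ℂ (T (e m)) (T (e n)) = 0 := by
  obtain ⟨ε, hε, h⟩ := aux_exists_unit T hT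
  refine ⟨ε, hε, ?_⟩
  have : Std.Symm (fun x y : H => inner ℂ x y = 0 ∧ inner ℂ (T x) (T y) = 0) :=
    ⟨fun x y hxy => ⟨inner_eq_zero_symm.1 hxy.1, inner_eq_zero_symm.1 hxy.2⟩⟩
  obtain ⟨e, he1, he2⟩ := exists_seq_of_forall_finset_exists'
    (fun x : H => ‖x‖ = 1 ∧ ε ≤ ‖T x‖)
    (fun x y : H => inner ℂ x y = 0 ∧ inner ℂ (T x) (T y) = 0) (by
      intro s hs
      classical
      let t : Finset H := s ∪ s.image (fun x => ContinuousLinearMap.adjoint T (T x))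
      obtain ⟨y, hy, hy1, hy2⟩ := h (Submodule.span ℂ (t : Set H))
        (FiniteDimensional.span_finset ℂ t)
      refine ⟨y, ⟨hy1, hy2⟩, fun x hx => ?_⟩
      rw [Submodule.mem_orthogonal] at hy
      refine ⟨hy x (Submodule.subset_span (by simp [t, hx])), ?_⟩
      have := hy (ContinuousLinearMap.adjoint T (T x)) (Submodule.subset_span (by
        simp only [t, Finset.coe_union, Finset.coe_image]
        exact Or.inr ⟨x, hx, rfl⟩))
      rwa [ContinuousLinearMap.adjoint_inner_left] at this)
  exact ⟨e, ⟨fun n => (he1 n).1, fun m n hmn => (he2 hmn).1⟩, fun n => (he1 n).2,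
    fun m n hmn => (he2 hmn).2⟩

theorem aux_exists_factor {H : Type*} [NormedAddCommGroup H] [InnerProductSpace ℂ H]
    [CompleteSpace H] [TopologicalSpace.SeparableSpace H]
    (T : H →L[ℂ] H) (hT : ¬ IsCompactOperator T) :
    ∃ A B : H →L[ℂ] H, A * T * B = 1 := by
  obtain ⟨ε, hε, e, he, hTe, horth⟩ := aux_exists_seq T hT
  obtain ⟨w, b, hb⟩ := exists_hilbertBasis ℂ H
  have hcw : Countable w := aux_countable_of_orthonormal w (by
    have := b.orthonormal
    rwa [hb] at this)
  obtain ⟨ι, hι⟩ := hcw.exists_injective_nat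
  have he' : Orthonormal ℂ (fun i => e (ι i)) := he.comp ι hι
  let E := he'.orthogonalFamily.linearIsometry
  let B : H →L[ℂ] H := E.toContinuousLinearMap ∘L (b.repr.toContinuousLinearEquiv : H →L[ℂ] _)
  let S : H →L[ℂ] H := T ∘L B
  have hpos : ∀ n, 0 < ‖T (e n)‖ := fun n => hε.trans_le (hTe n)
  have hfo : Orthonormal ℂ (fun i => ((‖T (e (ι i))‖ : ℂ)⁻¹) • T (e (ι i))) := by
    constructor
    · intro i
      rw [norm_smul]; simp [(hpos (ι i)).ne']
    · intro i j hij
      simp only [inner_smul_left, inner_smul_right, horth _ _ (hι.ne hij), mul_zero]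
  have hin : ∀ x : H, ∀ i, inner ℂ (((‖T (e (ι i))‖ : ℂ)⁻¹) • T (e (ι i))) (S x)
      = ‖T (e (ι i))‖ * b.repr x i := by
    intro x i
    have h1 : HasSum (fun j => (b.repr x j) • e (ι j)) (B x) := by
      have := he'.orthogonalFamily.hasSum_linearIsometry (b.repr x)
      simpa using! this
    have h2 := (h1.mapL T).mapL (innerSL ℂ (((‖T (e (ι i))‖ : ℂ)⁻¹) • T (e (ι i))))
    have h3 := hasSum_single (f := fun j => innerSL ℂ (((‖T (e (ι i))‖ : ℂ)⁻¹) • T (e (ι i)))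
      (T ((b.repr x j) • e (ι j)))) i (by
        intro j hj
        simp [inner_smul_left, inner_smul_right, horth _ _ (hι.ne hj.symm)])
    have h4 := h2.unique h3
    have h5 : (‖T (e (ι i))‖ : ℂ) ≠ 0 := by exact_mod_cast (hpos _).ne'
    change inner ℂ _ (T (B x)) = _ 
    simp only [innerSL_apply_apply, map_smul, inner_smul_right] at h4
    rw [h4]
    simp only [inner_smul_left, inner_self_eq_norm_sq_to_K]
    simp
    field_simp
  have hbelow : ∀ x, ε * ‖x‖ ≤ ‖S x‖ := by
    intro x
    have h1 := hfo.tsum_inner_products_le (S x)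
    have hs := hfo.inner_products_summable (S x)
    have h2 : HasSum (fun i => ‖b.repr x i‖ ^ 2) (‖x‖ ^ 2) := by
      have := lp.hasSum_norm (p := 2) (by norm_num) (b.repr x)
      simpa using! this
    have h3 : ε ^ 2 * ‖x‖ ^ 2 ≤ ‖S x‖ ^ 2 := by
      refine le_trans ?_ h1
      refine hasSum_le ?_ (h2.mul_left (ε ^ 2)) hs.hasSum
      intro i
      rw [hin, norm_mul, mul_pow]
      have := hTe (ι i)
      simp only [Complex.norm_real, norm_norm]
      gcongr
    rw [← mul_pow] at h3
    exact le_of_sq_le_sq h3 (norm_nonneg _)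
  have hanti : AntilipschitzWith (Real.toNNReal ε⁻¹) S := by
    apply S.antilipschitz_of_bound
    intro x
    rw [Real.coe_toNNReal _ (by positivity), inv_mul_eq_div, le_div_iff₀ hε, mul_comm]
    exact hbelow x
  have hclo : IsClosed (Set.range S) := hanti.isClosed_range S.uniformContinuous
  have hcomp : CompleteSpace S.range := hclo.completeSpace_coe
  let G := S.equivRange hanti.injective hclo
  let A : H →L[ℂ] H := (G.symm : _ →L[ℂ] H) ∘L S.range.orthogonalProjectionOnto
  refine ⟨A, B, ?_⟩
  ext x
  change G.symm (S.range.orthogonalProjectionOnto (S x)) = x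
  rw [ContinuousLinearEquiv.symm_apply_eq]
  have : S.range.orthogonalProjectionOnto (S x) = ⟨S x, ⟨x, rfl⟩⟩ :=
    Submodule.orthogonalProjectionOnto_mem_subspace_eq_self (K := S.range) ⟨S x, ⟨x, rfl⟩⟩
  rw [this]
  rfl

theorem aux_zero_mul_const {H : Type*} [NormedAddCommGroup H] [InnerProductSpace ℂ H]
    {X : Type*} [TopologicalSpace X] (h : C₀(X, H →L[ℂ] H)) (A : H →L[ℂ] H) :
    ∃ k : C₀(X, H →L[ℂ] H), ∀ x, k x = h x * A := by
  refine ⟨⟨⟨fun x => h x * A, h.continuous.mul continuous_const⟩, ?_⟩, fun x => rfl⟩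
  have := (zero_at_infty h).mul_const A
  simpa using! this

theorem aux_zero_smul {H : Type*} [NormedAddCommGroup H] [InnerProductSpace ℂ H]
    {X : Type*} [TopologicalSpace X] (h : C₀(X, H →L[ℂ] H)) (φ : C(X, ℝ))
    (h0 : ∀ x, 0 ≤ φ x) (h1 : ∀ x, φ x ≤ 1) :
    ∃ k : C₀(X, H →L[ℂ] H), ∀ x, k x = (φ x : ℂ) • h x := by
  refine ⟨⟨⟨fun x => (φ x : ℂ) • h x, ?_⟩, ?_⟩, fun x => rfl⟩
  · exact (Complex.continuous_ofReal.comp φ.continuous).smul h.continuous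
  · have := (zero_at_infty h).norm
    rw [norm_zero] at this
    refine squeeze_zero_norm (fun x => ?_) this
    change ‖(φ x : ℂ) • h x‖ ≤ _
    rw [norm_smul, Complex.norm_real, Real.norm_of_nonneg (h0 x)]
    exact mul_le_of_le_one_left (norm_nonneg _) (h1 x)

theorem aux_zero_bump {H : Type*} [NormedAddCommGroup H] [InnerProductSpace ℂ H]
    {X : Type*} [TopologicalSpace X] [LocallyCompactSpace X] [T2Space X]
    (x₀ : X) (B : H →L[ℂ] H) :
    ∃ k : C₀(X, H →L[ℂ] H), k x₀ = B := by
  obtain ⟨φ, hφ1, -, hφc, -⟩ := exists_continuous_one_zero_of_isCompact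
    (isCompact_singleton (x := x₀)) isClosed_empty (Set.disjoint_empty _)
  have hc : Continuous (fun x => (φ x : ℂ) • B) :=
    (Complex.continuous_ofReal.comp φ.continuous).smul continuous_const
  refine ⟨⟨⟨fun x => (φ x : ℂ) • B, hc⟩, ?_⟩, ?_⟩
  · have hs : HasCompactSupport (fun x => (φ x : ℂ) • B) := by
      refine hφc.mono ?_
      intro x hx
      simp only [Function.mem_support] at hx ⊢
      intro h
      apply hx
      simp [h]
    exact hs.is_zero_at_infty
  · change (φ x₀ : ℂ) • B = B
    rw [hφ1 rfl]; simp

theorem aux_eval_continuous {H : Type*} [NormedAddCommGroup H] [InnerProductSpace ℂ H]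
    {X : Type*} [TopologicalSpace X] (x₀ : X) :
    Continuous (fun f : C₀(X, H →L[ℂ] H) => f x₀) := by
  have h1 : Continuous (ZeroAtInftyContinuousMap.toBCF : C₀(X, H →L[ℂ] H) → _) :=
    ZeroAtInftyContinuousMap.isometry_toBCF.continuous
  exact (continuous_eval_const (F := BoundedContinuousFunction X (H →L[ℂ] H)) x₀).comp h1

/-- The ideal of functions that are compact at `x₀`. -/
noncomputable def auxIdeal (H : Type*) [NormedAddCommGroup H] [InnerProductSpace ℂ H]
    {X : Type*} [TopologicalSpace X] (x₀ : X) : TwoSidedIdeal C₀(X, H →L[ℂ] H) :=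
  TwoSidedIdeal.mk' {f : C₀(X, H →L[ℂ] H) | IsCompactOperator (⇑(f x₀))}
    (isCompactOperator_zero)
    (fun {f g} hf hg => IsCompactOperator.add hf hg)
    (fun {f} hf => IsCompactOperator.neg hf)
    (fun {f g} hg => IsCompactOperator.clm_comp hg (f x₀))
    (fun {f g} hf => IsCompactOperator.comp_clm hf (g x₀))

theorem aux_coe_ideal (H : Type*) [NormedAddCommGroup H] [InnerProductSpace ℂ H]
    {X : Type*} [TopologicalSpace X] (x₀ : X) :
    (auxIdeal H x₀ : Set C₀(X, H →L[ℂ] H)) =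
      {f : C₀(X, H →L[ℂ] H) | IsCompactOperator (⇑(f x₀))} := by
  exact TwoSidedIdeal.coe_mk' _ _ _ _ _ _

theorem aux_closed {H : Type*} [NormedAddCommGroup H] [InnerProductSpace ℂ H] [CompleteSpace H]
    {X : Type*} [TopologicalSpace X] (x₀ : X) :
    IsClosed {f : C₀(X, H →L[ℂ] H) | IsCompactOperator (⇑(f x₀))} := by
  have hcl : IsClosed {A : H →L[ℂ] H | IsCompactOperator A} := isClosed_setOfPred_isCompactOperator
  exact hcl.preimage (aux_eval_continuous x₀)

theorem aux_proper {H : Type*} [NormedAddCommGroup H] [InnerProductSpace ℂ H]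
    (hH : ¬ FiniteDimensional ℂ H)
    {X : Type*} [TopologicalSpace X] [LocallyCompactSpace X] [T2Space X]
    (J : TwoSidedIdeal C₀(X, H →L[ℂ] H)) (x₀ : X)
    (hJ : (J : Set C₀(X, H →L[ℂ] H)) =
      {f : C₀(X, H →L[ℂ] H) | IsCompactOperator (⇑(f x₀))}) : J ≠ ⊤ := by
  rintro rfl
  obtain ⟨k, hk⟩ := aux_zero_bump x₀ (1 : H →L[ℂ] H)
  have : k ∈ ((⊤ : TwoSidedIdeal C₀(X, H →L[ℂ] H)) : Set C₀(X, H →L[ℂ] H)) := by simp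
  rw [hJ, Set.mem_ofPred_eq, hk] at this
  exact hH ((isCompactOperator_id_iff_finiteDimensional (𝕜 := ℂ)).1 this)

theorem aux_eq_top {H : Type*} [NormedAddCommGroup H] [InnerProductSpace ℂ H]
    {X : Type*} [TopologicalSpace X] [LocallyCompactSpace X] [T2Space X]
    (J : TwoSidedIdeal C₀(X, H →L[ℂ] H)) (hJ : IsClosed (J : Set C₀(X, H →L[ℂ] H)))
    (hg : ∀ x : X, ∃ g ∈ J, g x = 1) : J = ⊤ := by
  rw [eq_top_iff]
  intro h _
  choose g hgJ hg1 using hg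
  have hmem : h ∈ closure (J : Set C₀(X, H →L[ℂ] H)) := by
    rw [Metric.mem_closure_iff]
    intro δ hδ
    obtain ⟨ε, hε, hεδ⟩ : ∃ ε : ℝ, 0 < ε ∧ ε * (1 + ‖h‖) < δ := by
      refine ⟨δ / (2 * (1 + ‖h‖)), by positivity, ?_⟩
      have : 0 < 1 + ‖h‖ := by positivity
      field_simp
      norm_num
    have hnorm : ∀ x, ‖h x‖ ≤ ‖h‖ := fun x => by
      rw [← ZeroAtInftyContinuousMap.norm_toBCF_eq_norm]
      exact h.toBCF.norm_coe_le_norm x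
    obtain ⟨K, hK, hKh⟩ : ∃ K : Set X, IsCompact K ∧ ∀ x ∉ K, ‖h x‖ < ε := by
      have h1 := (zero_at_infty h).eventually (Metric.ball_mem_nhds 0 hε)
      obtain ⟨K, hK, hs⟩ := Filter.mem_cocompact.1 h1
      refine ⟨K, hK, fun x hx => ?_⟩
      have := hs hx
      simpa using! this
    let U : X → Set X := fun y => {x | ‖1 - g y x‖ < ε}
    have hU : ∀ y, IsOpen (U y) := fun y =>
      isOpen_lt (continuous_const.sub (g y).continuous).norm continuous_const
    obtain ⟨t, ht⟩ := hK.elim_finite_subcover U hU (fun x _ => by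
      refine Set.mem_iUnion.2 ⟨x, ?_⟩
      simp [U, hg1, hε])
    obtain ⟨φ, hφU, -⟩ := PartitionOfUnity.exists_isSubordinate_of_locallyFinite_t2space hK
      (fun y : t => U y) (fun y => hU y) (locallyFinite_of_finite _) (by
        intro x hx
        have := ht hx
        simp only [Set.mem_iUnion] at this ⊢
        obtain ⟨i, hi, hx⟩ := this
        exact ⟨⟨i, hi⟩, hx⟩)
    choose k hk using fun i : t => aux_zero_smul h (φ i) (φ.nonneg i) (φ.le_one i)
    refine ⟨∑ i : t, k i * g i, sum_mem fun i _ => J.mul_mem_left _ _ (hgJ i), ?_⟩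
    refine lt_of_le_of_lt ?_ hεδ
    rw [← ZeroAtInftyContinuousMap.dist_toBCF_eq_dist,
      BoundedContinuousFunction.dist_le (by positivity)]
    intro x
    have hsum : ∀ s : Finset t, (∑ i ∈ s, k i * g i) x = ∑ i ∈ s, (φ i x : ℂ) • (h x * g i x) := by
      classical
      intro s
      induction s using Finset.induction_on with
      | empty => simp
      | insert a s ha ih =>
        rw [Finset.sum_insert ha, Finset.sum_insert ha, ZeroAtInftyContinuousMap.add_apply, ih,
          ZeroAtInftyContinuousMap.mul_apply, hk, smul_mul_assoc]
    have hle : ∑ i : t, φ i x ≤ 1 := by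
      have := φ.sum_le_one x
      rwa [finsum_eq_sum_of_fintype] at this
    have hnn : 0 ≤ ∑ i : t, φ i x := Finset.sum_nonneg fun i _ => φ.nonneg i x
    have hdec : (h - ∑ i : t, k i * g i) x =
        ((1 - ∑ i : t, φ i x : ℝ) : ℂ) • h x
          + ∑ i : t, (φ i x : ℂ) • (h x * (1 - g i x)) := by
      rw [ZeroAtInftyContinuousMap.sub_apply, hsum]
      simp only [mul_sub, mul_one, smul_sub, Finset.sum_sub_distrib, ← Finset.sum_smul]
      push_cast
      rw [sub_smul, one_smul]
      abel
    change dist (h x) ((∑ i : t, k i * g i) x) ≤ _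
    rw [dist_eq_norm, ← ZeroAtInftyContinuousMap.sub_apply, hdec]
    have hA : ‖((1 - ∑ i : t, φ i x : ℝ) : ℂ) • h x‖ ≤ ε := by
      rw [norm_smul, Complex.norm_real, Real.norm_of_nonneg (by linarith)]
      by_cases hx : x ∈ K
      · have := φ.sum_eq_one hx
        rw [finsum_eq_sum_of_fintype] at this
        rw [this]; simp [hε.le]
      · have := hKh x hx
        nlinarith [norm_nonneg (h x)]
    have hB : ‖∑ i : t, (φ i x : ℂ) • (h x * (1 - g i x))‖ ≤ ε * ‖h‖ := by
      calc _ ≤ ∑ i : t, φ i x * (ε * ‖h‖) := by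
            refine norm_sum_le_of_le _ fun i _ => ?_
            rw [norm_smul, Complex.norm_real, Real.norm_of_nonneg (φ.nonneg i x)]
            by_cases hx : φ i x = 0
            · simp [hx]
            · have hxU : x ∈ U i := hφU i (subset_tsupport _ hx)
              have hxU' : ‖1 - g i x‖ < ε := hxU
              refine mul_le_mul_of_nonneg_left ?_ (φ.nonneg i x)
              refine (norm_mul_le _ _).trans ?_
              rw [mul_comm]
              exact mul_le_mul hxU'.le (hnorm x) (norm_nonneg _) hε.le
        _ = (∑ i : t, φ i x) * (ε * ‖h‖) := by rw [Finset.sum_mul]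
        _ ≤ 1 * (ε * ‖h‖) := by gcongr
        _ = _ := one_mul _
    calc _ ≤ ε + ε * ‖h‖ := (norm_add_le _ _).trans (add_le_add hA hB)
      _ = _ := by ring
  rwa [hJ.closure_eq] at hmem

/-- The maximal closed two-sided ideals of `C₀(X, B(H))` are exactly the
sets of the form `{f : f(x₀) ∈ K(H)}`, `x₀ ∈ X`, where `K(H)` is the ideal of compact
operators on `H`. -/
theorem maximal_closed_ideal_iff_compact_at_point
    {H : Type*} [NormedAddCommGroup H] [InnerProductSpace ℂ H] [CompleteSpace H]
    [TopologicalSpace.SeparableSpace H] (hH : ¬ FiniteDimensional ℂ H)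
    {X : Type*} [TopologicalSpace X] [LocallyCompactSpace X] [T2Space X]
    (J : TwoSidedIdeal C₀(X, H →L[ℂ] H)) :
    IsMaximalClosedTwoSidedIdeal J ↔
      ∃ x₀ : X, (J : Set C₀(X, H →L[ℂ] H)) =
        {f : C₀(X, H →L[ℂ] H) | IsCompactOperator (⇑(f x₀))} := by
  constructor
  · rintro ⟨hcl, hne, hmax⟩
    by_contra! hcon
    apply hne
    apply aux_eq_top J hcl
    intro x
    have hnle : ¬ J ≤ auxIdeal H x := by
      intro hle
      have := hmax (auxIdeal H x) (by rw [aux_coe_ideal]; exact aux_closed x)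
        (aux_proper hH _ x (aux_coe_ideal H x)) hle
      exact hcon x (by rw [this, aux_coe_ideal])
    rw [TwoSidedIdeal.le_iff, aux_coe_ideal, Set.not_subset] at hnle
    obtain ⟨f, hf, hfx⟩ := hnle
    obtain ⟨A, B, hAB⟩ := aux_exists_factor (f x) hfx
    obtain ⟨a, ha⟩ := aux_zero_bump x A
    obtain ⟨b, hb⟩ := aux_zero_bump x B
    refine ⟨a * f * b, J.mul_mem_right _ _ (J.mul_mem_left _ _ hf), ?_⟩
    rw [ZeroAtInftyContinuousMap.mul_apply, ZeroAtInftyContinuousMap.mul_apply, ha, hb, hAB]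
  · rintro ⟨x, hJ⟩
    refine ⟨by rw [hJ]; exact aux_closed x, aux_proper hH J x hJ, ?_⟩
    intro K hK hKne hle
    refine le_antisymm hle ?_
    by_contra hnle
    apply hKne
    rw [TwoSidedIdeal.le_iff, hJ, Set.not_subset] at hnle
    obtain ⟨f, hf, hfx⟩ := hnle
    obtain ⟨A, B, hAB⟩ := aux_exists_factor (f x) hfx
    obtain ⟨b, hb⟩ := aux_zero_bump x B
    rw [eq_top_iff]
    intro h _
    obtain ⟨k, hk⟩ := aux_zero_mul_const h A
    have h1 : k * f * b ∈ K := K.mul_mem_right _ _ (K.mul_mem_left _ _ hf)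
    have h2 : h - k * f * b ∈ (J : Set C₀(X, H →L[ℂ] H)) := by
      rw [hJ, Set.mem_ofPred_eq]
      have : (h - k * f * b) x = 0 := by
        rw [ZeroAtInftyContinuousMap.sub_apply, ZeroAtInftyContinuousMap.mul_apply,
          ZeroAtInftyContinuousMap.mul_apply, hk, hb, mul_assoc (h x), mul_assoc (h x), hAB,
          mul_one, sub_self]
      rw [this]
      exact isCompactOperator_zero
    have h3 : h - k * f * b ∈ K := hle h2
    have := K.add_mem h3 h1
    rwa [sub_add_cancel] at this
end
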